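/- There is a constant c depending only on n, R, d, θ_0 and δ (not on C, C̃ or ν) such that for all ν ∈ ℤ^R: ∫_{𝔪} |S(α, ν)| dα ≤ c C̃^{R²} P^{n − Rd − δ}. -/

import Mathlib

open MeasureTheory Filter MvPolynomial

noncomputable section

/-- `e t = exp (2 π i t)` -/
def eC (t : ℝ) : ℂ := Complex.exp (2 * (Real.pi : ℂ) * Complex.I * (t : ℂ))

abbrev Qbar : Type := AlgebraicClosure ℚ

/-- Dimension of the affine singular locus of `g` (the common zero set of the partial
derivatives of `g`), as the Krull dimension of its coordinate ring. -/
def singDim (n : ℕ) (g : MvPolynomial (Fin n) Qbar) : WithBot ℕ∞ :=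
  ringKrullDim (MvPolynomial (Fin n) Qbar ⧸
    Ideal.span (Set.range fun j : Fin n => MvPolynomial.pderiv j g))

/-- `Δ = max_{b ∈ ℤ^R \ {0}} dim Sing(b₁ g₁ + ⋯ + b_R g_R)`. -/
def birchDelta (n R : ℕ) (g : Fin R → MvPolynomial (Fin n) ℤ) : WithBot ℕ∞ :=
  ⨆ (b : Fin R → ℤ) (_ : b ≠ 0),
    singDim n (MvPolynomial.map (Int.castRingHom Qbar) (∑ i, b i • g i))

/-- `K = (n - Δ)/2^(d-1)` where `Δ = max_{b ≠ 0} dim Sing(f̃_b)`. -/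
def KofDelta (n R d : ℕ) (g : Fin R → MvPolynomial (Fin n) ℤ) (K : ℝ) : Prop :=
  ∃ Δ : ℕ, ((Δ : ℕ∞) : WithBot ℕ∞) = birchDelta n R g ∧
    K = ((n : ℝ) - (Δ : ℝ)) / 2 ^ (d - 1)

/-- The quantity `R(R+1)(d-1)` as a real number. -/
def BB (R d : ℕ) : ℝ := (R : ℝ) * ((R : ℝ) + 1) * ((d : ℝ) - 1)

/-- The `R × R` minor of the Jacobian matrix of `f` with columns given by the elements
of `I`. -/
def jacMinor {n R : ℕ} (f : Fin R → MvPolynomial (Fin n) ℤ)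
    (I : Finset (Fin n)) (hI : I.card = R) : MvPolynomial (Fin n) ℤ :=
  Matrix.det (Matrix.of fun i k : Fin R => MvPolynomial.pderiv (I.orderEmbOfFin hI k) (f i))

/-- `Cv` is the maximum of the absolute values of the coefficients of the `f i`. -/
def coeffMax {n R : ℕ} (f : Fin R → MvPolynomial (Fin n) ℤ) (Cv : ℝ) : Prop :=
  IsGreatest {x : ℝ | ∃ (i : Fin R) (m : (Fin n) →₀ ℕ), x = |((MvPolynomial.coeff m (f i) : ℤ) : ℝ)|} Cv

/-- The integer points of the dilated box `P𝓑`. -/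
def boxPts {n : ℕ} (aB bB : Fin n → ℝ) (P : ℝ) : Finset (Fin n → ℤ) :=
  Finset.Icc (fun j => ⌈P * aB j⌉) (fun j => ⌊P * bB j⌋)

/-- The exponential sum `S(α) = ∑_{x ∈ P𝓑 ∩ ℤ^n} e(α · f(x))`. -/
def Sexp {n R : ℕ} (f : Fin R → MvPolynomial (Fin n) ℤ) (aB bB : Fin n → ℝ) (P : ℝ)
    (α : Fin R → ℝ) : ℂ :=
  ∑ x ∈ boxPts aB bB P, eC (∑ i, α i * (MvPolynomial.eval x (f i) : ℝ))

/-- The complete exponential sum `S_{a,q} = ∑_{x mod q} e(a · f(x)/q)`. -/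
def Sgauss {n R : ℕ} (f : Fin R → MvPolynomial (Fin n) ℤ) (q : ℕ) (a : Fin R → ℤ) : ℂ :=
  ∑ x : Fin n → Fin q,
    eC ((∑ i, (a i : ℝ) * (MvPolynomial.eval (fun j => ((x j : ℕ) : ℤ)) (f i) : ℝ)) / q)

/-- `S_{a,q}(ν) = S_{a,q} e(-a·ν/q)`. -/
def SgaussNu {n R : ℕ} (f : Fin R → MvPolynomial (Fin n) ℤ) (q : ℕ) (a : Fin R → ℤ)
    (ν : Fin R → ℤ) : ℂ :=
  Sgauss f q a * eC (-(∑ i, (a i : ℝ) * (ν i : ℝ)) / q)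

/-- Residues `1 ≤ aᵢ ≤ q` (coded by `Fin q`, shifted by one) with `gcd(a₁, …, a_R, s) = 1`. -/
def resSet (R q s : ℕ) : Finset (Fin R → Fin q) :=
  Finset.univ.filter fun a => Nat.gcd (Finset.univ.gcd fun i => (a i : ℕ) + 1) s = 1

/-- The singular series `𝔖(ν)`. -/
def singularSeries {n R : ℕ} (f : Fin R → MvPolynomial (Fin n) ℤ) (ν : Fin R → ℤ) : ℂ :=
  ∑' q : ℕ, ((q : ℂ) ^ n)⁻¹ *
    ∑ a ∈ resSet R q q, SgaussNu f q (fun i => ((a i : ℕ) : ℤ) + 1) ν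

/-- The local density `𝔖_p(ν)`. -/
def localDensity {n R : ℕ} (f : Fin R → MvPolynomial (Fin n) ℤ) (ν : Fin R → ℤ) (p : ℕ) : ℂ :=
  ∑' r : ℕ, ((p : ℂ) ^ (r * n))⁻¹ *
    ∑ a ∈ resSet R (p ^ r) p, SgaussNu f (p ^ r) (fun i => ((a i : ℕ) : ℤ) + 1) ν

/-- The box `𝓑 = ∏ⱼ [aⱼ, bⱼ]` as a subset of `ℝ^n`. -/
def boxSet {n : ℕ} (aB bB : Fin n → ℝ) : Set (Fin n → ℝ) :=
  Set.univ.pi fun j => Set.Icc (aB j) (bB j)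

/-- The oscillatory integral `I(𝓒, γ) = ∫_{ζ ∈ 𝓒} e(γ · g(ζ)) dζ`. -/
def Iosc {n R : ℕ} (g : Fin R → MvPolynomial (Fin n) ℤ) (C : Set (Fin n → ℝ))
    (γ : Fin R → ℝ) : ℂ :=
  ∫ ζ in C, eC (∑ i, γ i * MvPolynomial.aeval ζ (g i))

/-- `J(μ, Φ) = ∫_{|γ| ≤ Φ} I(𝓑, γ) e(-γ·μ) dγ`. -/
def Jint {n R : ℕ} (g : Fin R → MvPolynomial (Fin n) ℤ) (aB bB : Fin n → ℝ)
    (μ : Fin R → ℝ) (Φ : ℝ) : ℂ :=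
  ∫ γ in {γ : Fin R → ℝ | ∀ i, |γ i| ≤ Φ}, Iosc g (boxSet aB bB) γ * eC (-(∑ i, γ i * μ i))

/-- The singular integral `J(μ) = lim_{Φ → ∞} J(μ, Φ)`. -/
def Jlim {n R : ℕ} (g : Fin R → MvPolynomial (Fin n) ℤ) (aB bB : Fin n → ℝ)
    (μ : Fin R → ℝ) : ℂ :=
  limUnder Filter.atTop fun Φ : ℝ => Jint g aB bB μ Φ

/-- `M(P, ν)`: the number of integer points `x ∈ P𝓑` with `f(x) = ν`. -/
def Mcount {n R : ℕ} (f : Fin R → MvPolynomial (Fin n) ℤ) (aB bB : Fin n → ℝ) (P : ℝ)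
    (ν : Fin R → ℤ) : ℕ :=
  ((boxPts aB bB P).filter fun x => ∀ i, MvPolynomial.eval x (f i) = ν i).card

/-- A single major arc `𝔐_{a,q}(θ)`. -/
def majorArc {R : ℕ} (d : ℕ) (Ct P θ : ℝ) (q : ℕ) (a : Fin R → ℤ) : Set (Fin R → ℝ) :=
  Set.univ.pi fun i => Set.Icc
    ((a i : ℝ) / q - Ct ^ (R - 1) * P ^ (-(d : ℝ) + (R : ℝ) * ((d : ℝ) - 1) * θ) / (2 * q))
    ((a i : ℝ) / q + Ct ^ (R - 1) * P ^ (-(d : ℝ) + (R : ℝ) * ((d : ℝ) - 1) * θ) / (2 * q))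

/-- The major arcs `𝔐(θ)`. -/
def majorArcs (R d : ℕ) (Ct P θ : ℝ) : Set (Fin R → ℝ) :=
  ⋃ (q : ℕ) (_ : 1 ≤ q ∧ (q : ℝ) ≤ Ct ^ R * P ^ ((R : ℝ) * ((d : ℝ) - 1) * θ))
    (a : Fin R → ℤ)
    (_ : (∀ i, 1 ≤ a i ∧ a i ≤ (q : ℤ)) ∧ Int.gcd (Finset.univ.gcd a) (q : ℤ) = 1),
    majorArc d Ct P θ q a

/-- The minor arcs `𝔪 = [0,1]^R \ 𝔐(θ)`, taken modulo `1`. -/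
def minorArcs (R d : ℕ) (Ct P θ : ℝ) : Set (Fin R → ℝ) :=
  {α | (∀ i, 0 ≤ α i ∧ α i ≤ 1) ∧
    ∀ z : Fin R → ℤ, (fun i => α i + (z i : ℝ)) ∉ majorArcs R d Ct P θ}

/-- Nonsingularity of the affine variety `f = 0` over `ℚ̄`: at every common zero the
Jacobian matrix has (maximal) rank `R`, i.e. some `R × R` minor is nonvanishing. -/
def AffineNonsingular {n : ℕ} (R : ℕ) (f : Fin R → MvPolynomial (Fin n) ℤ) : Prop :=
  ∀ x : Fin n → Qbar, (∀ i, MvPolynomial.aeval x (f i) = 0) →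
    ∃ (I : Finset (Fin n)) (hI : I.card = R), MvPolynomial.aeval x (jacMinor f I hI) ≠ 0

/-- Nonsingularity of the projective variety `g = 0` over `ℚ̄` (for forms `g`): at every
nonzero point of the affine cone the Jacobian matrix has rank `R`. -/
def ProjNonsingular {n : ℕ} (R : ℕ) (g : Fin R → MvPolynomial (Fin n) ℤ) : Prop :=
  ∀ x : Fin n → Qbar, x ≠ 0 → (∀ i, MvPolynomial.aeval x (g i) = 0) →
    ∃ (I : Finset (Fin n)) (hI : I.card = R), MvPolynomial.aeval x (jacMinor g I hI) ≠ 0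



lemma krullDim_le_nat_of {α : Type*} [Preorder α] (D : ℕ)
    (h : ∀ l : LTSeries α, l.length ≤ D) : Order.krullDim α ≤ (D : WithBot ℕ∞) := by
  unfold Order.krullDim
  refine iSup_le fun l => ?_
  exact_mod_cast h l

lemma length_le_of_krullDim_le {α : Type*} [Preorder α] (D : ℕ)
    (h : Order.krullDim α ≤ (D : WithBot ℕ∞)) (l : LTSeries α) : l.length ≤ D := by
  have := (Order.LTSeries.length_le_krullDim l).trans h
  exact_mod_cast this

/-- adding a generic linear form lowers the dimension -/
lemma krull_step {k : Type*} [Field k] [Infinite k] {n : ℕ} (I : Ideal (MvPolynomial (Fin n) k))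
    (D : ℕ) (h : ringKrullDim (MvPolynomial (Fin n) k ⧸ I) ≤ ((D + 1 : ℕ) : WithBot ℕ∞)) :
    ∃ a : Fin n → k, ringKrullDim (MvPolynomial (Fin n) k ⧸
      (I ⊔ Ideal.span {∑ i, a i • (X i : MvPolynomial (Fin n) k)})) ≤ (D : WithBot ℕ∞) := by
  classical
  let L : (Fin n → k) →ₗ[k] MvPolynomial (Fin n) k :=
    Fintype.linearCombination k (fun i => (X i : MvPolynomial (Fin n) k))
  have hL : ∀ a, L a = ∑ i, a i • (X i : MvPolynomial (Fin n) k) := fun a => by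
    simp [L, Fintype.linearCombination_apply]
  let sub : Ideal (MvPolynomial (Fin n) k) → Subspace k (Fin n → k) := fun q =>
    (q.restrictScalars k).comap L
  have hfin := Ideal.finite_minimalPrimes_of_isNoetherianRing (MvPolynomial (Fin n) k) I
  let s : Finset (Subspace k (Fin n → k)) := (hfin.toFinset.image sub).erase ⊤
  have hs : ⊤ ∉ s := by simp [s]
  have hne := Subspace.biUnion_ne_univ_of_top_notMem hs
  obtain ⟨a, ha⟩ := (Set.ne_univ_iff_exists_notMem _).1 hne
  refine ⟨a, ?_⟩
  rw [ringKrullDim_quotient] at h ⊢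
  apply krullDim_le_nat_of
  rw [← hL]
  intro l
  have hl0 : I ≤ l.head.1.asIdeal := le_trans le_sup_left (l.head.2)
  have hla : L a ∈ l.head.1.asIdeal :=
    l.head.2 ((le_sup_right : _ ≤ I ⊔ Ideal.span {L a}) (Ideal.subset_span rfl))
  obtain ⟨q, hq, hq'⟩ := Ideal.exists_minimalPrimes_le (J := l.head.1.asIdeal) hl0
  let q' : PrimeSpectrum.zeroLocus (R := MvPolynomial (Fin n) k) (I : Set _) :=
    ⟨⟨q, hq.1.1⟩, hq.1.2⟩
  let ι : PrimeSpectrum.zeroLocus (R := MvPolynomial (Fin n) k)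
      ((I ⊔ Ideal.span {L a} : Ideal _) : Set _) →
      PrimeSpectrum.zeroLocus (R := MvPolynomial (Fin n) k) (I : Set _) :=
    fun p => ⟨p.1, le_trans (le_sup_left : I ≤ I ⊔ Ideal.span {L a}) p.2⟩
  have hι : StrictMono ι := fun _ _ h => h
  by_cases hlt : q < l.head.1.asIdeal
  · have hc : q' < (l.map ι hι).head := by
      rw [LTSeries.head_map]
      exact hlt
    have := length_le_of_krullDim_le _ h ((l.map ι hι).cons q' hc)
    simp at this
    exact this
  · have hqe : q = l.head.1.asIdeal := by
      rcases lt_or_eq_of_le hq' with h | h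
      · exact absurd h hlt
      · exact h
    have htop : sub q = ⊤ := by
      by_contra hne
      apply ha
      simp only [Set.mem_iUnion]
      refine ⟨sub q, ?_, ?_⟩
      · simp only [s, Finset.mem_erase, Finset.mem_image]
        exact ⟨hne, q, by simpa using hq, rfl⟩
      · show L a ∈ q
        rw [hqe]; exact hla
    have hX : ∀ i, X i ∈ q := by
      intro i
      have : Pi.single i 1 ∈ sub q := by rw [htop]; trivial
      have h2 : L (Pi.single i 1) ∈ q := this
      rw [hL] at h2
      simpa [Pi.single_apply] using h2
    have hmax : ∀ p : Ideal (MvPolynomial (Fin n) k), p.IsPrime → ¬ q < p := by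
      intro p hp hlt
      apply hlt.not_ge
      intro g hg
      have hvars : idealOfVars (Fin n) k ≤ q := by
        rw [idealOfVars, Ideal.span_le]; rintro _ ⟨i, rfl⟩; exact hX i
      have h1 : g - C (coeff 0 g) ∈ idealOfVars (Fin n) k := by
        have := (mem_pow_idealOfVars_iff' (σ := Fin n) (R := k) 1 (g - C (coeff 0 g))).2 (by
          intro x hx
          have : x = 0 := by
            simpa [Finsupp.degree_eq_zero_iff] using hx
          subst this
          simp)
        simpa using this
      have h2 : C (coeff 0 g) ∈ p := by
        have := p.sub_mem hg (hlt.le (hvars h1))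
        simpa using this
      have h3 : coeff 0 g = 0 := by
        by_contra hne
        apply hp.ne_top
        exact Ideal.eq_top_of_isUnit_mem _ h2 ((IsUnit.mk0 _ hne).map C)
      rw [h3] at h1
      simpa using hvars h1
    by_contra hlen
    push Not at hlen
    have hlen0 : 0 < l.length := by omega
    have : l.head < l ⟨1, by omega⟩ := l.strictMono (by simp [Fin.lt_def])
    exact hmax _ (l ⟨1, by omega⟩).1.2 (lt_of_eq_of_lt hqe this)

lemma krull_lin {k : Type*} [Field k] [Infinite k] {n : ℕ} (D : ℕ) :
    ∀ (I : Ideal (MvPolynomial (Fin n) k)),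
    ringKrullDim (MvPolynomial (Fin n) k ⧸ I) ≤ (D : WithBot ℕ∞) →
    ∃ a : Fin D → Fin n → k, ringKrullDim (MvPolynomial (Fin n) k ⧸
      (I ⊔ Ideal.span (Set.range fun s => ∑ i, a s i • (X i : MvPolynomial (Fin n) k)))) ≤ 0 := by
  induction D with
  | zero =>
    intro I hI
    refine ⟨fun s => 0, ?_⟩
    rw [Set.range_eq_empty, Ideal.span_empty, sup_bot_eq]
    simpa using hI
  | succ D ih =>
    intro I hI
    obtain ⟨a, ha⟩ := krull_step I D hI
    obtain ⟨b, hb⟩ := ih _ ha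
    refine ⟨Fin.cons a b, ?_⟩
    have : I ⊔ Ideal.span (Set.range fun s => ∑ i, (Fin.cons a b : Fin (D + 1) → Fin n → k) s i •
        (X i : MvPolynomial (Fin n) k)) =
      I ⊔ Ideal.span {∑ i, a i • X i} ⊔ Ideal.span (Set.range fun s => ∑ i, b s i • X i) := by
      rw [sup_assoc, ← Ideal.span_union]
      congr 2
      ext x
      simp [Fin.exists_fin_succ, eq_comm]
    rw [this]
    exact hb

/-- homogeneous forms defining a zero-dimensional scheme vanish only at the origin -/
lemma zero_of_krull {k : Type*} [Field k] {n : ℕ} (I : Ideal (MvPolynomial (Fin n) k))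
    (J : Set (MvPolynomial (Fin n) k)) (hIJ : I = Ideal.span J)
    (hJ : ∀ g ∈ J, ∃ e : ℕ, 0 < e ∧ g.IsHomogeneous e)
    (h : ringKrullDim (MvPolynomial (Fin n) k ⧸ I) ≤ 0)
    (x : Fin n → k) (hx : ∀ g ∈ J, eval x g = 0) : x = 0 := by
  by_contra hne
  obtain ⟨i, hi⟩ := Function.ne_iff.1 hne
  let φ : MvPolynomial (Fin n) k →+* Polynomial k :=
    (aeval (fun i => Polynomial.C (x i) * Polynomial.X) : MvPolynomial (Fin n) k →ₐ[k] Polynomial k)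
  have hφ : ∀ (e : ℕ) g, g.IsHomogeneous e → φ g = Polynomial.C (eval x g) * Polynomial.X ^ e := by
    intro e g hg
    have h1 : φ g = ∑ m ∈ g.support, Polynomial.C (coeff m g) *
        ∏ i ∈ m.support, (Polynomial.C (x i) * Polynomial.X) ^ m i := by
      simp only [φ, RingHom.coe_coe]
      rw [aeval_def, eval₂_eq]; rfl
    rw [h1, eval_eq, map_sum, Finset.sum_mul]
    refine Finset.sum_congr rfl fun m hm => ?_
    have hm' : m.degree = e := by
      rw [Finsupp.degree_eq_weight_one]; exact hg (mem_support_iff.1 hm)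
    simp only [mul_pow, Finset.prod_mul_distrib, map_mul, map_prod, map_pow]
    rw [Finset.prod_pow_eq_pow_sum, ← hm', mul_assoc]
    rfl
  have hker : ∀ g ∈ I, φ g = 0 := by
    intro g hg
    have : I ≤ RingHom.ker φ := by
      rw [hIJ, Ideal.span_le]
      intro g hg
      obtain ⟨e, he, hge⟩ := hJ g hg
      show φ g = 0
      rw [hφ e g hge, hx g hg]; simp
    exact this hg
  have hsurj : Function.Surjective (Ideal.Quotient.lift I φ hker) := by
    apply Ideal.Quotient.lift_surjective_of_surjective
    intro p
    refine ⟨Polynomial.aeval ((x i)⁻¹ • (X i : MvPolynomial (Fin n) k)) p, ?_⟩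
    have : ∀ y, φ y = (aeval (fun i => Polynomial.C (x i) * Polynomial.X) :
      MvPolynomial (Fin n) k →ₐ[k] Polynomial k) y := fun y => rfl
    rw [this, ← Polynomial.aeval_algHom_apply]
    have h2 : (aeval (fun i => Polynomial.C (x i) * Polynomial.X) :
      MvPolynomial (Fin n) k →ₐ[k] Polynomial k) ((x i)⁻¹ • (X i : MvPolynomial (Fin n) k))
        = Polynomial.X := by
      rw [map_smul, aeval_X, Polynomial.smul_eq_C_mul, ← mul_assoc, ← Polynomial.C_mul,
        inv_mul_cancel₀ hi]
      simp
    rw [h2]; simp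
  have h3 := ringKrullDim_le_of_surjective _ hsurj
  rw [Polynomial.ringKrullDim_of_isNoetherianRing, ringKrullDim_eq_zero_of_field] at h3
  have := h3.trans h
  norm_num at this


/-- stabilisation of an increasing union of Zariski open sets -/
lemma noeth_stab {k T : Type*} [Field k] [Finite T] (Sb : ℕ → Set (MvPolynomial T k)) :
    ∃ B0 : ℕ, ∀ x : T → k, (∃ B, ∃ p ∈ Sb B, eval x p ≠ 0) →
      ∃ B ≤ B0, ∃ p ∈ Sb B, eval x p ≠ 0 := by
  let f : ℕ →o Ideal (MvPolynomial T k) :=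
    ⟨fun B => Ideal.span (⋃ B' ≤ B, Sb B'), fun a b hab => Ideal.span_mono (by
      intro p hp
      simp only [Set.mem_iUnion] at hp ⊢
      obtain ⟨i, hi, h⟩ := hp
      exact ⟨i, hi.trans hab, h⟩)⟩
  obtain ⟨B0, hB0⟩ := monotone_stabilizes_iff_noetherian.2
    (inferInstance : IsNoetherian (MvPolynomial T k) (MvPolynomial T k)) f
  refine ⟨B0, fun x ⟨B, p, hp, hpx⟩ => ?_⟩
  by_contra hcon
  push Not at hcon
  apply hpx
  have h1 : p ∈ f (max B0 B) := Ideal.subset_span (by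
    simp only [Set.mem_iUnion]
    exact ⟨B, le_max_right _ _, hp⟩)
  rw [← hB0 _ (le_max_left _ _)] at h1
  have h2 : f B0 ≤ RingHom.ker (eval x) := by
    show Ideal.span _ ≤ _
    rw [Ideal.span_le]
    intro q hq
    simp only [Set.mem_iUnion] at hq
    obtain ⟨i, hi, h⟩ := hq
    exact hcon i hi q h
  exact h2 h1

/-- every monomial of degree `B` is in the degree `B` part of the ideal generated by `G` -/
def Ugood {k σ J : Type*} [Field k] [Fintype J] (e : J → ℕ) (B : ℕ)
    (G : J → MvPolynomial σ k) : Prop :=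
  ∀ a : σ →₀ ℕ, a.degree = B → ∃ c : J → MvPolynomial σ k,
    monomial a 1 = ∑ j, c j * G j ∧ ∀ j m, coeff m (c j) ≠ 0 → m.degree + e j = B

lemma coeff_hom_zero {k σ : Type*} [Field k] {G : MvPolynomial σ k} {e : ℕ}
    (hG : G.IsHomogeneous e) {m : σ →₀ ℕ} (hm : m.degree ≠ e) : coeff m G = 0 := by
  by_contra h
  apply hm
  rw [Finsupp.degree_eq_weight_one]; exact hG h

lemma ugood_of_ideal {k σ J : Type*} [Field k] [Fintype J] (e : J → ℕ) (B : ℕ)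
    (G : J → MvPolynomial σ k) (hG : ∀ j, (G j).IsHomogeneous (e j))
    (h : ∀ a : σ →₀ ℕ, a.degree = B → monomial a (1 : k) ∈ Ideal.span (Set.range G)) :
    Ugood e B G := by
  classical
  intro a ha
  obtain ⟨c, hc⟩ := (Ideal.mem_span_range_iff_exists_fun).1 (h a ha)
  refine ⟨fun j => if e j ≤ B then homogeneousComponent (B - e j) (c j) else 0, ?_, ?_⟩
  · ext m
    rw [coeff_sum]
    have key : ∀ j, coeff m ((if e j ≤ B then homogeneousComponent (B - e j) (c j) else 0) * G j)
        = if m.degree = B then coeff m (c j * G j) else 0 := by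
      intro j
      rw [coeff_mul, coeff_mul]
      have : (if m.degree = B then ∑ x ∈ Finset.HasAntidiagonal.antidiagonal m, coeff x.1 (c j) * coeff x.2 (G j)
          else 0) = ∑ x ∈ Finset.HasAntidiagonal.antidiagonal m,
            if m.degree = B then coeff x.1 (c j) * coeff x.2 (G j) else 0 := by
        split_ifs <;> simp
      rw [this]
      refine Finset.sum_congr rfl fun x hx => ?_
      have hx' : x.1.degree + x.2.degree = m.degree := by
        rw [← map_add, Finset.HasAntidiagonal.mem_antidiagonal.1 hx]
      by_cases h2 : x.2.degree = e j
      · by_cases hj : e j ≤ B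
        · simp only [if_pos hj, coeff_homogeneousComponent]
          have : x.1.degree = B - e j ↔ m.degree = B := by omega
          simp only [this]
          split_ifs <;> simp
        · have : m.degree ≠ B := by omega
          simp [hj, this]
      · simp [coeff_hom_zero (hG j) h2]
    simp_rw [key]
    have hs : (∑ j, if m.degree = B then coeff m (c j * G j) else 0) =
        if m.degree = B then coeff m (∑ j, c j * G j) else 0 := by
      split_ifs <;> simp [coeff_sum]
    rw [hs, hc, coeff_monomial]
    split_ifs with h1 h2 h2
    · rfl
    · exact absurd (h1 ▸ ha) h2
    · rfl
    · rfl
  · intro j m hm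
    by_cases hj : e j ≤ B
    · simp only [if_pos hj, coeff_homogeneousComponent] at hm
      have : m.degree = B - e j := by
        by_contra h; simp [h] at hm
      omega
    · simp [hj] at hm

lemma ugood_exists {k σ J : Type*} [Field k] [IsAlgClosed k] [Fintype J] [Finite σ] (e : J → ℕ)
    (G : J → MvPolynomial σ k) (hG : ∀ j, (G j).IsHomogeneous (e j))
    (h0 : ∀ x : σ → k, (∀ j, eval x (G j) = 0) → x = 0) :
    ∃ B, Ugood e B G := by
  have hle : idealOfVars σ k ≤ (Ideal.span (Set.range G)).radical := by
    rw [← vanishingIdeal_zeroLocus_eq_radical (K := k), idealOfVars, Ideal.span_le]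
    rintro _ ⟨i, rfl⟩
    rw [SetLike.mem_coe, mem_vanishingIdeal_iff]
    intro x hx
    have : x = 0 := h0 x fun j => by
      have := hx (G j) (Ideal.subset_span ⟨j, rfl⟩)
      simpa [aeval_eq_eval] using this
    simp [this]
  obtain ⟨B, hB⟩ := Ideal.exists_pow_le_of_le_radical_of_fg hle (idealOfVars_fg σ k)
  refine ⟨B, ugood_of_ideal e B G hG fun a ha => hB ?_⟩
  exact (monomial_mem_pow_idealOfVars_iff B a one_ne_zero).2 ha.ge

lemma mem_fa {σ : Type*} [Fintype σ] [DecidableEq σ] (m : σ →₀ ℕ) (B : ℕ) :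
    m ∈ Finset.finsuppAntidiag (Finset.univ : Finset σ) B ↔ m.degree = B := by
  simp [Finset.mem_finsuppAntidiag, Finsupp.degree_eq_sum]

/-- uniform bound for the degree in the projective Nullstellensatz -/
lemma ugood_unif (k σ J : Type*) [Field k] [IsAlgClosed k] [Fintype J] [Fintype σ] (e : J → ℕ) :
    ∃ B0 : ℕ, ∀ G : J → MvPolynomial σ k, (∀ j, (G j).IsHomogeneous (e j)) →
      (∀ x : σ → k, (∀ j, eval x (G j) = 0) → x = 0) → ∃ B ≤ B0, Ugood e B G := by
  classical
  let S : Finset (σ →₀ ℕ) := Finset.univ.biUnion fun j => Finset.finsuppAntidiag Finset.univ (e j)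
  let Mon : ℕ → Finset (σ →₀ ℕ) := fun B => Finset.finsuppAntidiag Finset.univ B
  let Le : ℕ → Finset (σ →₀ ℕ) := fun B => (Finset.range (B + 1)).biUnion Mon
  let gm : (B : ℕ) → Matrix (J × Le B) (Mon B) (MvPolynomial (J × S) k) := fun B => Matrix.of
    fun jb a => if jb.2.1.degree + e jb.1 = B ∧ jb.2.1 ≤ a.1 then
      (if h : a.1 - jb.2.1 ∈ S then X (jb.1, ⟨_, h⟩) else 0) else 0
  let Mx : (B : ℕ) → (J → MvPolynomial σ k) → Matrix (J × Le B) (Mon B) k := fun B G => Matrix.of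
    fun jb a => if jb.2.1.degree + e jb.1 = B ∧ jb.2.1 ≤ a.1 then
      coeff (a.1 - jb.2.1) (G jb.1) else 0
  let ev : (J → MvPolynomial σ k) → (J × S → k) := fun G t => coeff t.2.1 (G t.1)
  have hgm : ∀ B G, (gm B).map (eval (ev G)) = Mx B G := by
    intro B G
    ext jb a
    simp only [gm, Mx, Matrix.map_apply, Matrix.of_apply]
    by_cases h : jb.2.1.degree + e jb.1 = B ∧ jb.2.1 ≤ a.1
    · rw [if_pos h, if_pos h]
      have ha : a.1.degree = B := (mem_fa _ _).1 a.2
      have hmem : a.1 - jb.2.1 ∈ S := by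
        simp only [S, Finset.mem_biUnion, Finset.mem_univ, true_and]
        refine ⟨jb.1, (mem_fa _ _).2 ?_⟩
        have h1 : (a.1 - jb.2.1).degree + jb.2.1.degree = a.1.degree := by
          rw [← map_add, tsub_add_cancel_of_le h.2]
        omega
      rw [dif_pos hmem, eval_X]
    · rw [if_neg h, if_neg h, map_zero]
  have hcoef : ∀ (B : ℕ) (G c : J → MvPolynomial σ k) (a : Mon B),
      (∀ j m, coeff m (c j) ≠ 0 → m.degree + e j = B) →
      coeff a.1 (∑ j, c j * G j) = ∑ jb : J × Le B, coeff jb.2.1 (c jb.1) * Mx B G jb a := by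
    intro B G c a hc
    rw [coeff_sum, Fintype.sum_prod_type]
    refine Finset.sum_congr rfl fun j _ => ?_
    have h1 : c j = ∑ b : Le B, monomial b.1 (coeff b.1 (c j)) := by
      rw [Finset.sum_coe_sort (Le B) (fun b => monomial b (coeff b (c j)))]
      conv_lhs => rw [(c j).as_sum]
      refine Finset.sum_subset ?_ ?_
      · intro m hm
        have := hc j m (mem_support_iff.1 hm)
        simp only [Le, Mon, Finset.mem_biUnion, Finset.mem_range]
        exact ⟨m.degree, by omega, (mem_fa _ _).2 rfl⟩
      · intro m _ hm
        simp [notMem_support_iff.1 hm]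
    conv_lhs => rw [h1, Finset.sum_mul, coeff_sum]
    refine Finset.sum_congr rfl fun b _ => ?_
    rw [coeff_monomial_mul']
    simp only [Mx, Matrix.of_apply]
    by_cases hd : b.1.degree + e j = B
    · by_cases hb : b.1 ≤ a.1 <;> simp [hd, hb]
    · have : coeff b.1 (c j) = 0 := by
        by_contra h; exact hd (hc j _ h)
      simp [this]
  let pd : (B : ℕ) → Matrix (Mon B) (J × Le B) k → MvPolynomial (J × S) k := fun B Y =>
    Matrix.det ((Y.map (C : k →+* MvPolynomial (J × S) k) :
      Matrix (Mon B) (J × Le B) (MvPolynomial (J × S) k)) * gm B :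
        Matrix (Mon B) (Mon B) (MvPolynomial (J × S) k))
  obtain ⟨B0, hB0⟩ := noeth_stab (k := k) (T := J × S) (fun B =>
    Set.range fun Y : Matrix (Mon B) (J × Le B) k => pd B Y)
  have hdet : ∀ B G (Y : Matrix (Mon B) (J × Le B) k),
      eval (ev G) (pd B Y) = Matrix.det (Y * Mx B G : Matrix (Mon B) (Mon B) k) := by
    intro B G Y
    simp only [pd]
    rw [RingHom.map_det, RingHom.mapMatrix_apply, Matrix.map_mul, hgm]
    congr 2
    ext i j
    simp
  refine ⟨B0, fun G hG h0 => ?_⟩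
  obtain ⟨B, hB⟩ := ugood_exists e G hG h0
  obtain ⟨B', hB', _, ⟨Y, rfl⟩, hY⟩ := hB0 (ev G) ⟨B, by
    choose! c hc using hB
    let Y : Matrix (Mon B) (J × Le B) k := Matrix.of fun a jb => coeff jb.2.1 (c a.1 jb.1)
    refine ⟨_, ⟨Y, rfl⟩, ?_⟩
    rw [hdet]
    have : (Y * Mx B G : Matrix (Mon B) (Mon B) k) = 1 := by
      ext a a'
      have ha := hc a.1 ((mem_fa _ _).1 a.2)
      rw [Matrix.mul_apply]
      have := hcoef B G (c a.1) a' ha.2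
      rw [← ha.1, coeff_monomial] at this
      simp only [Y, Matrix.of_apply]
      rw [← this, Matrix.one_apply]
      by_cases haa : a = a'
      · rw [if_pos haa, if_pos (congrArg Subtype.val haa)]
      · rw [if_neg haa, if_neg (fun h => haa (Subtype.ext h))]
    rw [this]; simp⟩
  refine ⟨B', hB', ?_⟩
  rw [hdet] at hY
  have hu : IsUnit (Y * Mx B' G).det := IsUnit.mk0 _ hY
  let Z := (Y * Mx B' G)⁻¹ * Y
  have hZ : Z * Mx B' G = 1 := by
    rw [Matrix.mul_assoc, Matrix.nonsing_inv_mul _ hu]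
  intro a ha
  have haM : a ∈ Mon B' := (mem_fa _ _).2 ha
  let c : J → MvPolynomial σ k := fun j => ∑ b : Le B',
    monomial b.1 (if b.1.degree + e j = B' then Z ⟨a, haM⟩ (j, b) else 0)
  have hcc : ∀ j (b : Le B'), coeff b.1 (c j) =
      if b.1.degree + e j = B' then Z ⟨a, haM⟩ (j, b) else 0 := by
    intro j b
    simp only [c, coeff_sum, coeff_monomial]
    rw [Finset.sum_eq_single b]
    · simp
    · intro b' _ hb'
      rw [if_neg]
      exact fun h => hb' (Subtype.ext h)
    · simp
  have hc2 : ∀ j m, coeff m (c j) ≠ 0 → m.degree + e j = B' := by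
    intro j m hm
    simp only [c, coeff_sum, coeff_monomial] at hm
    obtain ⟨b, _, hb⟩ := Finset.exists_ne_zero_of_sum_ne_zero hm
    by_contra hne
    by_cases hbm : b.1 = m
    · rw [if_pos hbm, hbm, if_neg hne] at hb; exact hb rfl
    · rw [if_neg hbm] at hb; exact hb rfl
  refine ⟨c, ?_, hc2⟩
  ext m
  by_cases hm : m.degree = B'
  · rw [hcoef B' G c ⟨m, (mem_fa _ _).2 hm⟩ hc2]
    have h1 := congrFun (congrFun hZ ⟨a, haM⟩) ⟨m, (mem_fa _ _).2 hm⟩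
    rw [Matrix.mul_apply, Matrix.one_apply] at h1
    rw [coeff_monomial]
    simp only [Subtype.mk.injEq] at h1
    rw [← h1]
    refine Finset.sum_congr rfl fun jb _ => ?_
    rw [hcc]
    by_cases hd : jb.2.1.degree + e jb.1 = B'
    · simp [hd]
    · simp [hd, Mx]
  · rw [coeff_monomial, if_neg (by rintro rfl; exact hm ha), coeff_sum]
    symm
    refine Finset.sum_eq_zero fun j _ => ?_
    rw [coeff_mul]
    refine Finset.sum_eq_zero fun x hx => ?_
    by_cases h1 : coeff x.1 (c j) = 0
    · simp [h1]
    by_cases h2 : x.2.degree = e j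
    · exfalso
      apply hm
      rw [← hc2 j _ h1, ← h2, ← map_add, Finset.HasAntidiagonal.mem_antidiagonal.1 hx]
    · rw [coeff_hom_zero (hG j) h2, mul_zero]


/-- evaluation of polynomials on a finite set of integer points -/
def evS {σ : Type*} (k : Type*) [Field k] (S : Finset (σ → ℤ)) :
    MvPolynomial σ k →ₗ[k] (S → k) where
  toFun p := fun x => eval (fun s => (x.1 s : k)) p
  map_add' p q := by ext; simp
  map_smul' c p := by ext; simp [smul_eval]

def Wt {σ k : Type*} [Field k] [Fintype σ] {m : ℕ} (S : Finset (σ → ℤ)) (B : ℕ)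
    (L : Fin m → MvPolynomial σ k) (t : ℕ) : Submodule k (S → k) :=
  Submodule.span k (Set.range fun ab : (Fin m → Fin (t + 1)) × (σ → Fin B) =>
    evS k S ((∏ s, L s ^ (ab.1 s : ℕ)) * ∏ i, X i ^ (ab.2 i : ℕ)))

lemma Wt_step {σ k : Type*} [Field k] [Fintype σ] {m : ℕ} (S : Finset (σ → ℤ)) (B : ℕ)
    (L : Fin m → MvPolynomial σ k) (t : ℕ) (p : MvPolynomial σ k)
    (hp : evS k S p ∈ Wt S B L t) (s : Fin m) : evS k S (p * L s) ∈ Wt S B L (t + 1) := by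
  classical
  have h1 : evS k S (p * L s) = evS k S (L s) * evS k S p := by
    ext x; simp [evS, mul_comm]
  rw [h1]
  have h2 : Wt S B L t ≤ (Wt S B L (t + 1)).comap (LinearMap.mulLeft k (evS k S (L s))) := by
    rw [Wt, Submodule.span_le]
    rintro _ ⟨⟨a, b⟩, rfl⟩
    simp only [SetLike.mem_coe, Submodule.mem_comap, LinearMap.mulLeft_apply]
    refine Submodule.subset_span ⟨⟨fun s' => ⟨(a s' : ℕ) + if s' = s then 1 else 0, ?_⟩, b⟩, ?_⟩
    · have := (a s').2
      split_ifs <;> omega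
    · ext x
      simp only [evS, LinearMap.coe_mk, AddHom.coe_mk, Pi.mul_apply, map_mul, map_prod, map_pow,
        pow_add, Finset.prod_mul_distrib]
      have : (∏ x_1, (eval fun s => ((x.1 s : ℤ) : k)) (L x_1) ^ (if x_1 = s then 1 else 0)) =
          (eval fun s => ((x.1 s : ℤ) : k)) (L s) := by
        rw [Finset.prod_eq_single s] <;> simp +contextual
      rw [this]; ring
  exact h2 hp

lemma Wt_mono {σ k : Type*} [Field k] [Fintype σ] {m : ℕ} (S : Finset (σ → ℤ)) (B : ℕ)
    (L : Fin m → MvPolynomial σ k) {t t' : ℕ} (h : t ≤ t') : Wt S B L t ≤ Wt S B L t' := by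
  rw [Wt, Submodule.span_le]
  rintro _ ⟨⟨a, b⟩, rfl⟩
  refine Submodule.subset_span ⟨⟨fun s' => ⟨(a s' : ℕ), ?_⟩, b⟩, rfl⟩
  have := (a s').2
  omega

lemma Wt_small {σ k : Type*} [Field k] [Fintype σ] {m : ℕ} (S : Finset (σ → ℤ)) (B : ℕ)
    (L : Fin m → MvPolynomial σ k) (t : ℕ) (a : σ →₀ ℕ) (hB : ∀ i, a i < B) :
    evS k S (monomial a 1) ∈ Wt S B L t := by
  have h : monomial a (1 : k) = (∏ s, L s ^ (((fun _ => 0 : Fin m → Fin (t + 1)) s : Fin (t + 1)) : ℕ)) *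
      ∏ i, X i ^ (((fun i => ⟨a i, hB i⟩ : σ → Fin B) i : Fin B) : ℕ) := by
    rw [monomial_eq, Finsupp.prod_fintype _ _ (by simp)]
    simp
  rw [h]
  exact Submodule.subset_span ⟨(fun _ => 0, fun i => ⟨a i, hB i⟩), rfl⟩

lemma Wt_monomial {k σ I : Type*} [Field k] [Fintype I] [Fintype σ] (e0 m B : ℕ)
    (G : I ⊕ Fin m → MvPolynomial σ k)
    (hU : Ugood (Sum.elim (fun _ => e0) (fun _ => 1)) B G) (S : Finset (σ → ℤ))
    (hv : ∀ p ∈ S, ∀ i, eval (fun s => (p s : k)) (G (Sum.inl i)) = 0) (t : ℕ) :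
    ∀ a : σ →₀ ℕ, a.degree ≤ t → evS k S (monomial a 1) ∈ Wt S B (fun s => G (Sum.inr s)) t := by
  classical
  induction t with
  | zero =>
    intro a ha
    by_cases hB : ∀ i, a i < B
    · exact Wt_small _ _ _ _ a hB
    push Not at hB
    obtain ⟨i, hi⟩ := hB
    have h0 : a = 0 := by
      rw [← Finsupp.degree_eq_zero_iff]; omega
    have hB0 : B = 0 := by simpa [h0] using hi
    obtain ⟨c, hc1, hc2⟩ := hU a (by simp [h0, hB0])
    have : evS k S (monomial a 1) = 0 := by
      rw [hc1, map_sum]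
      refine Finset.sum_eq_zero fun j _ => ?_
      rcases j with j | j
      · ext x
        simp [evS, hv x.1 x.2 j]
      · have : c (Sum.inr j) = 0 := by
          ext m
          by_contra h
          have := hc2 (Sum.inr j) m h
          simp at this
          omega
        simp [this]
    rw [this]; exact Submodule.zero_mem _
  | succ t ih =>
    intro a ha
    by_cases hB : ∀ i, a i < B
    · exact Wt_small _ _ _ _ a hB
    push Not at hB
    obtain ⟨i, hi⟩ := hB
    obtain ⟨c, hc1, hc2⟩ := hU (Finsupp.single i B) (by simp)
    let a' := a - Finsupp.single i B
    have haa : a = Finsupp.single i B + a' := by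
      rw [add_tsub_cancel_of_le]
      simpa using hi
    have hdeg : B + a'.degree = a.degree := by
      conv_rhs => rw [haa, map_add]
      simp
    have h1 : evS k S (monomial a 1) =
        ∑ s, evS k S ((c (Sum.inr s) * monomial a' 1) * G (Sum.inr s)) := by
      have : monomial a (1 : k) = monomial (Finsupp.single i B) 1 * monomial a' 1 := by
        rw [monomial_mul, ← haa, one_mul]
      rw [this, hc1, Finset.sum_mul, map_sum, Fintype.sum_sum_type]
      rw [Finset.sum_eq_zero, zero_add]
      · refine Finset.sum_congr rfl fun s _ => ?_
        congr 1; ring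
      · intro j _
        ext x
        simp [evS, hv x.1 x.2 j]
    rw [h1]
    refine Submodule.sum_mem _ fun s _ => Wt_step _ _ _ _ _ ?_ s
    have h2 : c (Sum.inr s) * monomial a' 1 =
        ∑ b ∈ (c (Sum.inr s)).support, coeff b (c (Sum.inr s)) • monomial (b + a') (1 : k) := by
      conv_lhs => rw [(c (Sum.inr s)).as_sum, Finset.sum_mul]
      refine Finset.sum_congr rfl fun b _ => ?_
      rw [monomial_mul, smul_monomial]; simp
    rw [h2, map_sum]
    refine Submodule.sum_mem _ fun b hb => ?_
    rw [map_smul]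
    refine Submodule.smul_mem _ _ (ih _ ?_)
    have := hc2 (Sum.inr s) b (mem_support_iff.1 hb)
    simp at this
    rw [map_add]
    omega

lemma count_D {k σ I : Type*} [Field k] [CharZero k] [Fintype I] [Fintype σ] (e0 m B H : ℕ)
    (G : I ⊕ Fin m → MvPolynomial σ k)
    (hU : Ugood (Sum.elim (fun _ => e0) (fun _ => 1)) B G) (S : Finset (σ → ℤ))
    (hS : ∀ p ∈ S, ∀ i, |p i| ≤ H)
    (hv : ∀ p ∈ S, ∀ i, eval (fun s => (p s : k)) (G (Sum.inl i)) = 0) :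
    S.card ≤ (2 * H * Fintype.card σ + 1) ^ m * B ^ Fintype.card σ := by
  classical
  set t := 2 * H * Fintype.card σ with ht
  have hpoly : ∀ p : MvPolynomial σ k, p.totalDegree ≤ t →
      evS k S p ∈ Wt S B (fun s => G (Sum.inr s)) t := by
    intro p hp
    rw [p.as_sum, map_sum]
    refine Submodule.sum_mem _ fun b hb => ?_
    have : monomial b (coeff b p) = coeff b p • monomial b (1 : k) := by
      rw [smul_monomial]; simp
    rw [this, map_smul]
    refine Submodule.smul_mem _ _ (Wt_monomial e0 m B G hU S hv t b ?_)
    refine le_trans ?_ hp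
    rw [Finsupp.degree_apply]
    exact le_totalDegree hb
  have htop : Wt S B (fun s => G (Sum.inr s)) t = ⊤ := by
    rw [eq_top_iff]
    intro g _
    have : g = ∑ p : S, g p • Pi.single p (1 : k) := by
      ext q
      simp [Finset.sum_apply, Pi.single_apply]
    rw [this]
    refine Submodule.sum_mem _ fun p _ => Submodule.smul_mem _ _ ?_
    let Q : MvPolynomial σ k := ∏ i, ∏ c ∈ (Finset.Icc (-(H : ℤ)) H).erase (p.1 i),
      (X i - C (c : k))
    have hQd : Q.totalDegree ≤ t := by
      refine (totalDegree_finsetProd _ _).trans ?_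
      calc _ ≤ ∑ i : σ, 2 * H := Finset.sum_le_sum fun i _ => by
            refine (totalDegree_finsetProd _ _).trans ?_
            refine (Finset.sum_le_card_nsmul _ _ 1 fun c _ => ?_).trans ?_
            · refine (totalDegree_sub _ _).trans ?_
              exact max_le (totalDegree_X (R := k) i).le (by rw [totalDegree_C]; omega)
            · have hmem : p.1 i ∈ Finset.Icc (-(H : ℤ)) H :=
                Finset.mem_Icc.2 (abs_le.1 (hS p.1 p.2 i))
              rw [Finset.card_erase_of_mem hmem]
              simp
              omega
        _ = t := by rw [Finset.sum_const, Finset.card_univ, smul_eq_mul, ht, mul_comm]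
    have hQv : ∀ q : S, q ≠ p → evS k S Q q = 0 := by
      intro q hq
      have : ∃ i, q.1 i ≠ p.1 i := by
        by_contra h; push Not at h; exact hq (Subtype.ext (funext h))
      obtain ⟨i, hi⟩ := this
      simp only [evS, LinearMap.coe_mk, AddHom.coe_mk, Q, map_prod]
      refine Finset.prod_eq_zero (Finset.mem_univ i) ?_
      refine Finset.prod_eq_zero (i := q.1 i)
        (Finset.mem_erase.2 ⟨hi, Finset.mem_Icc.2 (abs_le.1 (hS q.1 q.2 i))⟩) ?_
      simp
    have hQp : evS k S Q p ≠ 0 := by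
      simp only [evS, LinearMap.coe_mk, AddHom.coe_mk, Q, map_prod]
      refine Finset.prod_ne_zero_iff.2 fun i _ => Finset.prod_ne_zero_iff.2 fun c hc => ?_
      simp only [map_sub, eval_X, eval_C, sub_ne_zero]
      intro h
      exact (Finset.mem_erase.1 hc).1 (by exact_mod_cast h.symm)
    have : Pi.single p (1 : k) = (evS k S Q p)⁻¹ • evS k S Q := by
      ext q
      by_cases hq : q = p
      · subst hq; simp [hQp]
      · simp [hq, hQv q hq]
    rw [this]
    exact Submodule.smul_mem _ _ (hpoly Q hQd)
  have h1 : Module.finrank k (Wt S B (fun s => G (Sum.inr s)) t) ≤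
      Fintype.card ((Fin m → Fin (t + 1)) × (σ → Fin B)) := finrank_range_le_card _
  rw [htop, finrank_top, Module.finrank_fintype_fun_eq_card] at h1
  simpa using h1


/-- iterated partial derivatives -/
def itd {n : ℕ} {A : Type*} [CommRing A] (l : List (Fin n)) (p : MvPolynomial (Fin n) A) :
    MvPolynomial (Fin n) A := l.foldr (fun j q => pderiv j q) p

lemma pd_comm {n : ℕ} {A : Type*} [CommRing A] (i j : Fin n) (p : MvPolynomial (Fin n) A) :
    pderiv i (pderiv j p) = pderiv j (pderiv i p) := by
  by_cases h : i = j
  · rw [h]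
  ext m
  simp only [coeff_pderiv]
  rw [add_right_comm]
  simp [h, Ne.symm h]
  ring

lemma itd_pd {n : ℕ} {A : Type*} [CommRing A] (l : List (Fin n)) (j : Fin n)
    (p : MvPolynomial (Fin n) A) : itd l (pderiv j p) = pderiv j (itd l p) := by
  induction l with
  | nil => rfl
  | cons i l ih =>
    show pderiv i (itd l (pderiv j p)) = pderiv j (pderiv i (itd l p))
    rw [ih, pd_comm]

lemma itd_perm {n : ℕ} {A : Type*} [CommRing A] {l l' : List (Fin n)} (h : l.Perm l')
    (p : MvPolynomial (Fin n) A) : itd l p = itd l' p := by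
  induction h with
  | nil => rfl
  | cons x _ ih => show pderiv x (itd _ p) = pderiv x (itd _ p); rw [ih]
  | swap x y l => exact pd_comm _ _ _
  | trans _ _ h1 h2 => rw [h1, h2]

lemma itd_map {n : ℕ} {A B : Type*} [CommRing A] [CommRing B] (φ : A →+* B) (l : List (Fin n))
    (p : MvPolynomial (Fin n) A) : itd l (map φ p) = map φ (itd l p) := by
  induction l with
  | nil => rfl
  | cons i l ih =>
    show pderiv i (itd l (map φ p)) = map φ (pderiv i (itd l p))
    rw [ih, pderiv_map]

lemma itd_add {n : ℕ} {A : Type*} [CommRing A] (l : List (Fin n))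
    (p q : MvPolynomial (Fin n) A) : itd l (p + q) = itd l p + itd l q := by
  induction l with
  | nil => rfl
  | cons i l ih =>
    show pderiv i (itd l (p + q)) = pderiv i (itd l p) + pderiv i (itd l q)
    rw [ih, map_add]

lemma itd_smul {n : ℕ} {A : Type*} [CommRing A] (l : List (Fin n)) (c : A)
    (p : MvPolynomial (Fin n) A) : itd l (c • p) = c • itd l p := by
  induction l with
  | nil => rfl
  | cons i l ih =>
    show pderiv i (itd l (c • p)) = c • pderiv i (itd l p)
    rw [ih, Derivation.map_smul]

lemma itd_zero {n : ℕ} {A : Type*} [CommRing A] (l : List (Fin n)) :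
    itd l (0 : MvPolynomial (Fin n) A) = 0 := by
  simpa using itd_smul l (0 : A) 0

def Wc {n : ℕ} {A : Type*} [CommRing A] (l : List (Fin n)) (p : MvPolynomial (Fin n) A) : A :=
  coeff 0 (itd l p)

/-- the multilinear forms of Birch -/
def Phi {n e : ℕ} {A : Type*} [CommRing A] (p : MvPolynomial (Fin n) A) (j : Fin n)
    (h : Fin e → Fin n → A) : A :=
  ∑ t : Fin e → Fin n, (∏ s, h s (t s)) * Wc (j :: List.ofFn t) p

lemma coeff_itd_bound {n : ℕ} (p : MvPolynomial (Fin n) ℤ) (d : ℕ) (Ct : ℝ)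
    (hC : ∀ m : Fin n →₀ ℕ, m.degree = d → |((coeff m p : ℤ) : ℝ)| ≤ Ct)
    (l : List (Fin n)) : ∀ m : Fin n →₀ ℕ, m.degree + l.length = d →
      |((coeff m (itd l p) : ℤ) : ℝ)| ≤ Ct * (d : ℝ) ^ l.length := by
  induction l with
  | nil => intro m hm; simpa [itd] using hC m (by simpa using hm)
  | cons i l ih =>
    intro m hm
    show |((coeff m (pderiv i (itd l p)) : ℤ) : ℝ)| ≤ _
    have h1 : (m + Finsupp.single i 1).degree = m.degree + 1 := by simp
    simp only [List.length_cons] at hm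
    have h2 := ih (m + Finsupp.single i 1) (by omega)
    have h3 : m i ≤ m.degree := Finsupp.le_degree i m
    have h4 : ((m i : ℝ) + 1) ≤ d := by
      have : m i + 1 ≤ d := by omega
      exact_mod_cast this
    rw [coeff_pderiv]
    push_cast
    rw [abs_mul, abs_of_nonneg (by positivity : (0 : ℝ) ≤ (m i : ℝ) + 1), List.length_cons, pow_succ,
      ← mul_assoc]
    exact mul_le_mul h2 h4 (by positivity) (le_trans (abs_nonneg _) h2)

lemma coeff_itd_hc {n : ℕ} {A : Type*} [CommRing A] (p : MvPolynomial (Fin n) A) (d : ℕ)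
    (l : List (Fin n)) : ∀ m : Fin n →₀ ℕ, m.degree + l.length = d →
      coeff m (itd l (homogeneousComponent d p)) = coeff m (itd l p) := by
  induction l with
  | nil =>
    intro m hm
    show coeff m (homogeneousComponent d p) = coeff m p
    rw [coeff_homogeneousComponent, if_pos (by simpa using hm)]
  | cons i l ih =>
    intro m hm
    show coeff m (pderiv i (itd l _)) = coeff m (pderiv i (itd l p))
    have h1 : (m + Finsupp.single i 1).degree = m.degree + 1 := by simp
    simp only [List.length_cons] at hm
    rw [coeff_pderiv, coeff_pderiv, ih _ (by omega)]

lemma itd_eq_zero_of_deg {n : ℕ} {A : Type*} [CommRing A] (p : MvPolynomial (Fin n) A)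
    (l : List (Fin n)) (h : p.totalDegree < l.length) : itd l p = 0 := by
  have key : ∀ l : List (Fin n), ∀ m : Fin n →₀ ℕ, p.totalDegree < m.degree + l.length →
      coeff m (itd l p) = 0 := by
    intro l
    induction l with
    | nil =>
      intro m hm
      show coeff m p = 0
      refine coeff_eq_zero_of_totalDegree_lt ?_
      simpa [Finsupp.degree_apply] using hm
    | cons i l ih =>
      intro m hm
      show coeff m (pderiv i (itd l p)) = 0
      have h1 : (m + Finsupp.single i 1).degree = m.degree + 1 := by simp
      simp only [List.length_cons] at hm
      rw [coeff_pderiv, ih _ (by omega), zero_mul]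
  ext m
  rw [key l m (by omega), coeff_zero]

lemma const_of_pd {n : ℕ} (q : MvPolynomial (Fin n) ℤ) (h : ∀ j, pderiv j q = 0) :
    q = C (coeff 0 q) := by
  ext m
  rw [coeff_C]
  split_ifs with hm
  · rw [hm]
  · have : ∃ j, m j ≠ 0 := by
      by_contra hh; push Not at hh; exact hm (Finsupp.ext hh).symm
    obtain ⟨j, hj⟩ := this
    have h1 : m - Finsupp.single j 1 + Finsupp.single j 1 = m :=
      tsub_add_cancel_of_le (by simpa using Nat.one_le_iff_ne_zero.2 hj)
    have h2 := congrArg (coeff (m - Finsupp.single j 1)) (h j)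
    rw [coeff_pderiv, h1, coeff_zero] at h2
    rcases mul_eq_zero.1 h2 with h3 | h3
    · exact h3
    · exfalso; omega

lemma affine_of_pd {n : ℕ} (q : MvPolynomial (Fin n) ℤ) (c : Fin n → ℤ)
    (h : ∀ j, pderiv j q = C (c j)) (x : Fin n → ℤ) :
    eval x q = coeff 0 q + ∑ j, x j * c j := by
  have h1 : ∀ j, pderiv j (q - ∑ i, C (c i) * X i) = 0 := by
    intro j
    rw [map_sub, h, map_sum]
    simp only [pderiv_C_mul, pderiv_X]
    rw [Finset.sum_eq_single j]
    · simp
    · intro b _ hb; simp [hb.symm]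
    · simp
  have h2 := const_of_pd _ h1
  have h3 := congrArg (eval x) h2
  simp only [map_sub, map_sum, map_mul, eval_C, eval_X, coeff_sub, coeff_sum] at h3
  have h4 : ∀ i, coeff 0 (C (c i) * X i : MvPolynomial (Fin n) ℤ) = 0 := by
    intro i; rw [coeff_C_mul, coeff_X, if_neg (by simp), mul_zero]
  simp only [h4, Finset.sum_const_zero, sub_zero] at h3
  rw [sub_eq_iff_eq_add] at h3
  rw [h3]
  simp [mul_comm]

/-- difference operator on polynomials -/
def Dp {n : ℕ} (h : Fin n → ℤ) (p : MvPolynomial (Fin n) ℤ) : MvPolynomial (Fin n) ℤ :=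
  aeval (fun i => X i + C (h i)) p - p

lemma eval_Dp {n : ℕ} (h : Fin n → ℤ) (p : MvPolynomial (Fin n) ℤ) (x : Fin n → ℤ) :
    eval x (Dp h p) = eval (x + h) p - eval x p := by
  rw [Dp, map_sub]
  congr 1
  induction p using MvPolynomial.induction_on with
  | C a => simp
  | add p q hp hq => simp only [map_add, hp, hq]
  | mul_X p i hp => simp only [map_mul, hp, aeval_X, map_add, eval_X, eval_C, Pi.add_apply]

lemma pd_Dp {n : ℕ} (h : Fin n → ℤ) (p : MvPolynomial (Fin n) ℤ) (j : Fin n) :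
    pderiv j (Dp h p) = Dp h (pderiv j p) := by
  rw [Dp, Dp, map_sub]
  congr 1
  induction p using MvPolynomial.induction_on with
  | C a => simp
  | add p q hp hq => simp only [map_add, hp, hq]
  | mul_X p i hp =>
    simp only [map_mul, Derivation.leibniz, hp, map_add, aeval_X, smul_eq_mul, pderiv_X, pderiv_C]
    by_cases hij : i = j
    · subst hij; simp
    · simp [hij]

lemma itd_Dp {n : ℕ} (h : Fin n → ℤ) (p : MvPolynomial (Fin n) ℤ) (l : List (Fin n)) :
    itd l (Dp h p) = Dp h (itd l p) := by
  induction l with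
  | nil => rfl
  | cons i l ih =>
    show pderiv i (itd l (Dp h p)) = Dp h (pderiv i (itd l p))
    rw [ih, pd_Dp]

/-- `D_{h_{e-1}} ... D_{h_0} p` -/
def iDp {n : ℕ} : (e : ℕ) → (Fin e → Fin n → ℤ) → MvPolynomial (Fin n) ℤ → MvPolynomial (Fin n) ℤ
  | 0, _, p => p
  | e + 1, h, p => iDp e (fun s => h s.succ) (Dp (h 0) p)

lemma pd_iDp {n : ℕ} (j : Fin n) (e : ℕ) : ∀ (h : Fin e → Fin n → ℤ) (p : MvPolynomial (Fin n) ℤ),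
    pderiv j (iDp e h p) = iDp e h (pderiv j p) := by
  induction e with
  | zero => intro h p; rfl
  | succ e ih => intro h p; simp only [iDp]; rw [ih, pd_Dp]

lemma coeff0_Dp {n : ℕ} (h : Fin n → ℤ) (q : MvPolynomial (Fin n) ℤ)
    (hq : ∀ l : List (Fin n), l.length = 2 → itd l q = 0) :
    coeff 0 (Dp h q) = ∑ i, h i * coeff 0 (pderiv i q) := by
  have h1 : ∀ j, pderiv j q = C (coeff 0 (pderiv j q)) := fun j =>
    const_of_pd _ fun i => hq [i, j] rfl
  have h2 := affine_of_pd q _ h1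
  have h3 := eval_Dp h q 0
  rw [h2, h2] at h3
  have h4 : coeff 0 (Dp h q) = eval 0 (Dp h q) := by
    rw [← constantCoeff_eq, eval_zero]
  rw [h4, h3]
  simp

lemma iDp_const {n : ℕ} (e : ℕ) : ∀ (h : Fin e → Fin n → ℤ) (p : MvPolynomial (Fin n) ℤ),
    (∀ l : List (Fin n), l.length = e + 1 → itd l p = 0) →
    iDp e h p = C (∑ t : Fin e → Fin n, (∏ s, h s (t s)) * Wc (List.ofFn t) p) := by
  induction e with
  | zero =>
    intro h p hp
    simp only [iDp]
    have := const_of_pd p fun j => hp [j] rfl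
    simpa [Wc, itd] using this
  | succ e ih =>
    intro h p hp
    simp only [iDp]
    rw [ih]
    · congr 1
      rw [← (Fin.consEquiv fun _ => Fin n).sum_comp, Fintype.sum_prod_type, Finset.sum_comm]
      refine Finset.sum_congr rfl fun t _ => ?_
      have h1 : Wc (List.ofFn t) (Dp (h 0) p) =
          ∑ i, h 0 i * Wc (i :: List.ofFn t) p := by
        rw [Wc, itd_Dp, coeff0_Dp]
        · rfl
        · intro l hl
          have : itd l (itd (List.ofFn t) p) = itd (l ++ List.ofFn t) p := by
            simp [itd, List.foldr_append]
          rw [this]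
          exact hp _ (by simp [hl]; omega)
      rw [h1, Finset.mul_sum]
      refine Finset.sum_congr rfl fun i _ => ?_
      simp [Fin.prod_univ_succ, List.ofFn_succ]
      ring
    · intro l hl
      rw [itd_Dp]
      have h1 := const_of_pd (itd l p) fun j => hp (j :: l) (by simp [hl])
      rw [h1]; simp [Dp]

lemma iDp_affine {n e : ℕ} (h : Fin e → Fin n → ℤ) (p : MvPolynomial (Fin n) ℤ)
    (hp : p.totalDegree ≤ e + 1) (x : Fin n → ℤ) :
    eval x (iDp e h p) = coeff 0 (iDp e h p) + ∑ j, x j * Phi p j h := by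
  refine affine_of_pd _ _ (fun j => ?_) x
  rw [pd_iDp, iDp_const]
  · congr 1
    unfold Phi
    refine Finset.sum_congr rfl fun t _ => ?_
    rw [Wc, Wc, itd_pd]; rfl
  · intro l hl
    rw [itd_pd]
    exact itd_eq_zero_of_deg p (j :: l) (by simp [hl]; omega)

lemma euler_it {n : ℕ} {k : Type*} [Field k] (x : Fin n → k) (e : ℕ) :
    ∀ p : MvPolynomial (Fin n) k, p.IsHomogeneous e →
    ∑ t : Fin e → Fin n, (∏ s, x (t s)) * Wc (List.ofFn t) p = (e.factorial : k) * eval x p := by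
  induction e with
  | zero =>
    intro p hp
    have h1 : p = C (coeff 0 p) := by
      rw [← totalDegree_eq_zero_iff_eq_C]
      have := hp.totalDegree_le
      omega
    simp [Wc, itd]
    conv_rhs => rw [h1]
    simp
  | succ e ih =>
    intro p hp
    rw [← (Fin.consEquiv fun _ => Fin n).sum_comp, Fintype.sum_prod_type]
    have h1 : ∀ i, ∑ t : Fin e → Fin n, (∏ s, x ((Fin.consEquiv fun _ => Fin n) (i, t) s)) *
        Wc (List.ofFn ((Fin.consEquiv fun _ => Fin n) (i, t))) p =
        x i * ((e.factorial : k) * eval x (pderiv i p)) := by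
      intro i
      rw [← ih (pderiv i p) hp.pderiv, Finset.mul_sum]
      refine Finset.sum_congr rfl fun t _ => ?_
      have : Wc (List.ofFn t) (pderiv i p) = Wc (i :: List.ofFn t) p := by
        rw [Wc, Wc, itd_pd]; rfl
      rw [this]
      simp [Fin.prod_univ_succ, List.ofFn_succ]
      ring
    simp_rw [h1]
    have h2 := congrArg (eval x) hp.sum_X_mul_pderiv
    simp only [map_sum, map_mul, eval_X, nsmul_eq_mul, map_natCast] at h2
    have h3 : ∑ i, x i * ((e.factorial : k) * eval x (pderiv i p)) =
        (e.factorial : k) * ∑ i, x i * eval x (pderiv i p) := by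
      rw [Finset.mul_sum]; exact Finset.sum_congr rfl fun i _ => by ring
    rw [h3, h2, Nat.factorial_succ]
    push_cast; ring

lemma Phi_diag {n e : ℕ} {k : Type*} [Field k] (x : Fin n → k)
    (g : MvPolynomial (Fin n) k) (hg : g.IsHomogeneous (e + 1)) (j : Fin n) :
    Phi g j (fun _ : Fin e => x) = (e.factorial : k) * eval x (pderiv j g) := by
  rw [← euler_it x e (pderiv j g) hg.pderiv]
  unfold Phi
  refine Finset.sum_congr rfl fun t _ => ?_
  rw [Wc, Wc, itd_pd]; rfl

lemma Phi_map {n e : ℕ} {A B : Type*} [CommRing A] [CommRing B] (φ : A →+* B)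
    (p : MvPolynomial (Fin n) A) (j : Fin n) (h : Fin e → Fin n → A) :
    Phi (map φ p) j (fun s i => φ (h s i)) = φ (Phi p j h) := by
  simp [Phi, Wc, itd_map, coeff_map]

lemma Phi_smul {n e : ℕ} {A : Type*} [CommRing A] (c : A) (p : MvPolynomial (Fin n) A) (j : Fin n)
    (h : Fin e → Fin n → A) : Phi (c • p) j h = c * Phi p j h := by
  simp only [Phi, Wc, itd_smul, coeff_smul, smul_eq_mul, Finset.mul_sum]
  exact Finset.sum_congr rfl fun t _ => by ring

lemma Phi_sum {n e : ℕ} {A ι : Type*} [CommRing A] (S : Finset ι) (p : ι → MvPolynomial (Fin n) A)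
    (j : Fin n) (h : Fin e → Fin n → A) : Phi (∑ i ∈ S, p i) j h = ∑ i ∈ S, Phi (p i) j h := by
  classical
  induction S using Finset.induction_on with
  | empty => simp [Phi, Wc, itd_zero]
  | insert a s ha ih =>
    rw [Finset.sum_insert ha, Finset.sum_insert ha, ← ih]
    simp only [Phi, Wc, itd_add, coeff_add, mul_add, Finset.sum_add_distrib]

lemma Phi_hc {n e : ℕ} {A : Type*} [CommRing A] (p : MvPolynomial (Fin n) A)
    (j : Fin n) (h : Fin e → Fin n → A) :
    Phi (homogeneousComponent (e + 1) p) j h = Phi p j h := by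
  unfold Phi
  refine Finset.sum_congr rfl fun t _ => ?_
  rw [Wc, Wc, coeff_itd_hc _ _ _ _ (by simp)]

lemma Phi_bound {n e : ℕ} (p : MvPolynomial (Fin n) ℤ) (Ct : ℝ)
    (hC : ∀ m : Fin n →₀ ℕ, m.degree = e + 1 → |((coeff m p : ℤ) : ℝ)| ≤ Ct) (j : Fin n)
    (h : Fin e → Fin n → ℤ) (Y : ℝ) (hh : ∀ s i, |((h s i : ℤ) : ℝ)| ≤ Y) :
    |((Phi p j h : ℤ) : ℝ)| ≤ (n : ℝ) ^ e * ((e : ℝ) + 1) ^ (e + 1) * Ct * Y ^ e := by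
  unfold Phi
  push_cast
  refine (Finset.abs_sum_le_sum_abs _ _).trans ?_
  have h1 : ∀ t : Fin e → Fin n, |(∏ s, ((h s (t s) : ℤ) : ℝ)) * ((Wc (j :: List.ofFn t) p : ℤ) : ℝ)| ≤
      Y ^ e * (Ct * ((e : ℝ) + 1) ^ (e + 1)) := by
    intro t
    rw [abs_mul, Finset.abs_prod]
    have h2 := coeff_itd_bound p (e + 1) Ct hC (j :: List.ofFn t) 0 (by simp)
    have h3 : ∏ s, |((h s (t s) : ℤ) : ℝ)| ≤ Y ^ e := by
      calc _ ≤ ∏ _s : Fin e, Y := Finset.prod_le_prod (fun _ _ => abs_nonneg _) fun s _ => hh s _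
        _ = _ := by simp
    simp only [List.length_cons, List.length_ofFn, Nat.cast_add, Nat.cast_one] at h2
    exact mul_le_mul h3 h2 (abs_nonneg _) (le_trans (Finset.prod_nonneg fun _ _ => abs_nonneg _) h3)
  refine (Finset.sum_le_card_nsmul _ _ _ fun t _ => h1 t).trans (le_of_eq ?_)
  simp
  ring

lemma Phi_lin {n e : ℕ} {A : Type*} [CommRing A] (p : MvPolynomial (Fin n) A) (j : Fin n)
    (h : Fin e → Fin n → A) (s : Fin e) (u : Fin n → A) :
    Phi p j (Function.update h s u) =
      ∑ i, u i * Phi p j (Function.update h s (Pi.single i 1)) := by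
  unfold Phi
  simp_rw [Finset.mul_sum]
  rw [Finset.sum_comm]
  refine Finset.sum_congr rfl fun t _ => ?_
  have h1 : ∀ v : Fin n → A, ∏ s', Function.update h s v s' (t s') =
      v (t s) * ∏ s' ∈ Finset.univ.erase s, h s' (t s') := by
    intro v
    rw [← Finset.mul_prod_erase _ _ (Finset.mem_univ s)]
    congr 1
    · simp
    · refine Finset.prod_congr rfl fun s' hs' => ?_
      rw [Function.update_of_ne (Finset.ne_of_mem_erase hs')]
  simp_rw [h1]
  rw [Finset.sum_eq_single (t s)]
  · simp; ring
  · intro b _ hb; simp [hb.symm]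
  · simp

lemma Phi_symm {n e : ℕ} {A : Type*} [CommRing A] (p : MvPolynomial (Fin n) A) (j i : Fin n)
    (h : Fin e → Fin n → A) (s : Fin e) :
    Phi p j (Function.update h s (Pi.single i 1)) = Phi p i (Function.update h s (Pi.single j 1)) := by
  classical
  have h1 : ∀ (i : Fin n) (t : Fin e → Fin n),
      ∏ s', Function.update h s (Pi.single i 1) s' (t s') =
      if t s = i then ∏ s' ∈ Finset.univ.erase s, h s' (t s') else 0 := by
    intro i t
    rw [← Finset.mul_prod_erase _ _ (Finset.mem_univ s)]
    have : ∏ s' ∈ Finset.univ.erase s, Function.update h s (Pi.single i 1) s' (t s') =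
        ∏ s' ∈ Finset.univ.erase s, h s' (t s') :=
      Finset.prod_congr rfl fun s' hs' => by
        rw [Function.update_of_ne (Finset.ne_of_mem_erase hs')]
    rw [this]
    simp [Pi.single_apply]
  unfold Phi
  simp_rw [h1, ite_mul, zero_mul, ← Finset.sum_filter]
  refine Finset.sum_bij' (fun t _ => Function.update t s j) (fun t _ => Function.update t s i)
    ?_ ?_ ?_ ?_ ?_
  · intro t ht; simp
  · intro t ht; simp
  · intro t ht
    have : t s = i := by simpa using ht
    simp [← this]
  · intro t ht
    have : t s = j := by simpa using ht
    simp [← this]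
  · intro t ht
    have ht' : t s = i := by simpa using ht
    congr 1
    · refine Finset.prod_congr rfl fun s' hs' => ?_
      rw [Function.update_of_ne (Finset.ne_of_mem_erase hs')]
    · unfold Wc
      congr 1
      apply itd_perm
      have h2 : (Fin.cons i (Function.update t s j) : Fin (e + 1) → Fin n) =
          (Fin.cons j t : Fin (e + 1) → Fin n) ∘ Equiv.swap 0 s.succ := by
        ext x
        refine Fin.cases ?_ (fun x => ?_) x
        · simp [ht']
        · by_cases hx : x = s
          · subst hx; simp
          · have : Equiv.swap 0 s.succ x.succ = x.succ :=
              Equiv.swap_apply_of_ne_of_ne (Fin.succ_ne_zero x) (by simpa using hx)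
            simp [this, hx]
      have h3 : j :: List.ofFn t = List.ofFn (Fin.cons j t : Fin (e + 1) → Fin n) := by
        simp [List.ofFn_succ]
      have h4 : i :: List.ofFn (Function.update t s j) =
          List.ofFn (Fin.cons i (Function.update t s j) : Fin (e + 1) → Fin n) := by
        rw [List.ofFn_succ]; simp only [Fin.cons_zero, Fin.cons_succ]
      rw [h3, h4, h2]
      exact (Equiv.Perm.ofFn_comp_perm _ _).symm


def PhiP {n e : ℕ} {k : Type*} [Field k] (g : MvPolynomial (Fin n) k) (j : Fin n) :
    MvPolynomial (Fin e × Fin n) k :=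
  ∑ t : Fin e → Fin n, (∏ s, X (s, t s)) * C (Wc (j :: List.ofFn t) g)

lemma PhiP_eval {n e : ℕ} {k : Type*} [Field k] (g : MvPolynomial (Fin n) k) (j : Fin n)
    (y : Fin e × Fin n → k) : eval y (PhiP g j) = Phi g j (fun s i => y (s, i)) := by
  simp [PhiP, Phi]

lemma PhiP_hom {n e : ℕ} {k : Type*} [Field k] (g : MvPolynomial (Fin n) k) (j : Fin n) :
    (PhiP (e := e) g j).IsHomogeneous e := by
  refine IsHomogeneous.sum _ _ _ fun t _ => ?_
  have h1 : (∏ s : Fin e, (X (s, t s) : MvPolynomial (Fin e × Fin n) k)).IsHomogeneous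
      (∑ _s : Fin e, 1) := IsHomogeneous.prod _ _ _ fun s _ => isHomogeneous_X k _
  have h2 := h1.mul (isHomogeneous_C (Fin e × Fin n) (Wc (j :: List.ofFn t) g))
  simpa using h2

/-- counting integer points on `Φ_{b,j} = 0` -/
lemma count_E (n e Δ : ℕ) : ∃ C0 : ℕ, ∀ g : MvPolynomial (Fin n) Qbar,
    g.IsHomogeneous (e + 2) → singDim n g ≤ ((Δ : ℕ∞) : WithBot ℕ∞) → ∀ H : ℕ, 1 ≤ H →
    ∀ S : Finset (Fin (e + 1) → Fin n → ℤ), (∀ h ∈ S, ∀ s i, |h s i| ≤ (H : ℤ)) →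
    (∀ h ∈ S, ∀ j, Phi g j (fun s i => ((h s i : ℤ) : Qbar)) = 0) →
    S.card ≤ C0 * H ^ (e * n + Δ) := by
  classical
  set N := Fintype.card (Fin (e + 1) × Fin n) with hN
  let m := e * n + Δ
  let eq : Fin m ≃ (Fin e × Fin n) ⊕ Fin Δ :=
    finSumFinEquiv.symm.trans (Equiv.sumCongr finProdFinEquiv.symm (Equiv.refl _))
  obtain ⟨B0, hB0⟩ := ugood_unif Qbar (Fin (e + 1) × Fin n) (Fin n ⊕ Fin m)
    (Sum.elim (fun _ => e + 1) (fun _ => 1))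
  refine ⟨(2 * N + 1) ^ m * B0 ^ N, fun g hg hΔ H hH S hS hv => ?_⟩
  obtain ⟨a, ha⟩ := krull_lin Δ _ hΔ
  let L : (Fin e × Fin n) ⊕ Fin Δ → MvPolynomial (Fin (e + 1) × Fin n) Qbar :=
    Sum.elim (fun si => X (si.1.castSucc, si.2) - X (si.1.succ, si.2))
      (fun s => ∑ i, a s i • X (0, i))
  let G : Fin n ⊕ Fin m → MvPolynomial (Fin (e + 1) × Fin n) Qbar :=
    Sum.elim (fun j => PhiP g j) (fun s => L (eq s))
  have hG : ∀ j, (G j).IsHomogeneous ((Sum.elim (fun _ => e + 1) (fun _ => 1) :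
      Fin n ⊕ Fin m → ℕ) j) := by
    rintro (j | s)
    · exact PhiP_hom g j
    · show (L (eq s)).IsHomogeneous 1
      rcases eq s with si | s
      · exact (isHomogeneous_X _ _).sub (isHomogeneous_X _ _)
      · refine IsHomogeneous.sum _ _ _ fun i _ => ?_
        rw [smul_eq_C_mul]
        simpa using (isHomogeneous_C (Fin (e + 1) × Fin n) (a s i)).mul
          (isHomogeneous_X Qbar ((0 : Fin (e + 1)), i))
  have h0 : ∀ y : Fin (e + 1) × Fin n → Qbar, (∀ j, eval y (G j) = 0) → y = 0 := by
    intro y hy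
    have hL : ∀ u, eval y (L u) = 0 := by
      intro u
      have := hy (Sum.inr (eq.symm u))
      simpa [G] using this
    let x : Fin n → Qbar := fun i => y (0, i)
    have hyx : ∀ s i, y (s, i) = x i := by
      intro s i
      induction s using Fin.induction with
      | zero => rfl
      | succ s ih =>
        have := hL (Sum.inl (s, i))
        simp only [L, Sum.elim_inl, map_sub, eval_X] at this
        rw [← ih]; exact (sub_eq_zero.1 this).symm
    have hx : x = 0 := by
      refine zero_of_krull _ (Set.range (fun j : Fin n => pderiv j g) ∪
        Set.range fun s => ∑ i, a s i • (X i : MvPolynomial (Fin n) Qbar))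
        (Ideal.span_union _ _).symm ?_ ha x ?_
      · rintro _ (⟨j, rfl⟩ | ⟨s, rfl⟩)
        · exact ⟨e + 1, by omega, hg.pderiv⟩
        · refine ⟨1, one_pos, IsHomogeneous.sum _ _ _ fun i _ => ?_⟩
          rw [smul_eq_C_mul]
          simpa using (isHomogeneous_C (Fin n) (a s i)).mul (isHomogeneous_X Qbar i)
      · rintro _ (⟨j, rfl⟩ | ⟨s, rfl⟩)
        · have h1 := hy (Sum.inl j)
          have h2 : eval y (PhiP g j) = 0 := h1
          rw [PhiP_eval] at h2
          have h3 : (fun (s : Fin (e + 1)) i => y (s, i)) = fun _ => x := by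
            ext s i; exact hyx s i
          rw [h3, Phi_diag x g hg j] at h2
          exact (mul_eq_zero.1 h2).resolve_left (by exact_mod_cast Nat.factorial_ne_zero _)
        · have h1 := hL (Sum.inr s)
          simp only [L, Sum.elim_inr, map_sum, smul_eval, eval_X] at h1
          simp only [map_sum, smul_eval, eval_X]
          exact h1
    ext ⟨s, i⟩
    rw [hyx, hx]; rfl
  obtain ⟨B, hB, hU⟩ := hB0 G hG h0
  let φ : (Fin (e + 1) → Fin n → ℤ) ≃ (Fin (e + 1) × Fin n → ℤ) := (Equiv.curry _ _ _).symm
  have hcard := count_D (e + 1) m B H G hU (S.map φ.toEmbedding) (by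
    intro p hp i
    obtain ⟨h, hh, rfl⟩ := Finset.mem_map.1 hp
    exact hS h hh i.1 i.2) (by
    intro p hp j
    obtain ⟨h, hh, rfl⟩ := Finset.mem_map.1 hp
    show eval _ (PhiP g j) = 0
    rw [PhiP_eval]
    exact hv h hh j)
  rw [Finset.card_map, ← hN] at hcard
  refine hcard.trans ?_
  calc (2 * H * N + 1) ^ m * B ^ N ≤ ((2 * N + 1) * H) ^ m * B0 ^ N := by
        gcongr
        nlinarith
    _ = _ := by rw [mul_pow]; ring


lemma norm_eC (t : ℝ) : ‖eC t‖ = 1 := by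
  unfold eC
  have : 2 * (Real.pi : ℂ) * Complex.I * (t : ℂ) = ((2 * Real.pi * t : ℝ) : ℂ) * Complex.I := by
    push_cast; ring
  rw [this, Complex.norm_exp_ofReal_mul_I]

lemma eC_add (s t : ℝ) : eC (s + t) = eC s * eC t := by
  unfold eC; rw [← Complex.exp_add]; congr 1; push_cast; ring

lemma eC_neg (t : ℝ) : eC (-t) = (starRingEnd ℂ) (eC t) := by
  unfold eC; rw [← Complex.exp_conj]; congr 1; simp [Complex.conj_ofNat]

lemma eC_int (m : ℤ) : eC m = 1 := by
  unfold eC; rw [← Complex.exp_int_mul_two_pi_mul_I m]; congr 1; push_cast; ring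

def Tsum {n : ℕ} (a b : Fin n → ℤ) (F : (Fin n → ℤ) → ℝ) : ℂ := ∑ x ∈ Finset.Icc a b, eC (F x)

/-- integer points with sup norm at most `X` -/
def bx (n : ℕ) (X : ℝ) : Finset (Fin n → ℤ) := Finset.Icc (fun _ => -⌊X⌋) (fun _ => ⌊X⌋)

lemma mem_bx {n : ℕ} {X : ℝ} {u : Fin n → ℤ} : u ∈ bx n X ↔ ∀ i, |((u i : ℤ) : ℝ)| ≤ X := by
  simp only [bx, Finset.mem_Icc, Pi.le_def]
  constructor
  · rintro ⟨h1, h2⟩ i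
    rw [abs_le]
    have a1 := h1 i
    have a2 := h2 i
    constructor
    · have : -u i ≤ ⌊X⌋ := by omega
      have := Int.le_floor.1 this
      push_cast at this; linarith
    · exact Int.le_floor.1 a2
  · intro h
    refine ⟨fun i => ?_, fun i => ?_⟩
    · have := (abs_le.1 (h i)).1
      have : -u i ≤ ⌊X⌋ := Int.le_floor.2 (by push_cast; linarith)
      omega
    · exact Int.le_floor.2 (abs_le.1 (h i)).2

lemma weyl_step {n : ℕ} (M : ℕ) (a b : Fin n → ℤ) (hab : ∀ j, b j - a j ≤ M)
    (F : (Fin n → ℤ) → ℝ) :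
    ‖Tsum a b F‖ ^ 2 ≤ ∑ h ∈ bx n M,
      ‖Tsum (a ⊔ (a - h)) (b ⊓ (b - h)) (fun x => F (x + h) - F x)‖ := by
  classical
  have h1 : ((‖Tsum a b F‖ ^ 2 : ℝ) : ℂ) = ∑ h ∈ bx n M,
      Tsum (a ⊔ (a - h)) (b ⊓ (b - h)) (fun x => F (x + h) - F x) := by
    rw [← Complex.normSq_eq_norm_sq, ← Complex.mul_conj]
    unfold Tsum
    rw [map_sum, Finset.sum_mul_sum, ← Finset.sum_product', Finset.sum_sigma']
    refine Finset.sum_bij' (fun p _ => ⟨p.1 - p.2, p.2⟩) (fun p _ => (p.2 + p.1, p.2)) ?_ ?_ ?_ ?_ ?_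
    · rintro ⟨x, y⟩ hp
      simp only [Finset.mem_product, Finset.mem_Icc, Pi.le_def] at hp
      simp only [Finset.mem_sigma, Finset.mem_Icc, Pi.le_def,
        Pi.sub_apply, sup_le_iff, le_inf_iff]
      obtain ⟨⟨p1, p2⟩, p3, p4⟩ := hp
      refine ⟨mem_bx.2 fun i => ?_, ⟨p3, fun i => ?_⟩, p4, fun i => ?_⟩
      · have : |x i - y i| ≤ (M : ℤ) := by
          rw [abs_le]
          have := hab i
          constructor <;> linarith [p1 i, p2 i, p3 i, p4 i]
        exact_mod_cast this
      · have := p1 i; linarith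
      · have := p2 i; linarith
    · rintro ⟨h, y⟩ hp
      simp only [Finset.mem_sigma, Finset.mem_Icc, Pi.le_def,
        Pi.sub_apply, sup_le_iff, le_inf_iff] at hp
      simp only [Finset.mem_product, Finset.mem_Icc, Pi.le_def, Pi.add_apply]
      obtain ⟨_, p1, p2⟩ := hp
      refine ⟨⟨fun i => ?_, fun i => ?_⟩, p1.1, p2.1⟩
      · have := p1.2 i; linarith
      · have := p2.2 i; linarith
    · rintro ⟨x, y⟩ _; simp
    · rintro ⟨h, y⟩ _; simp
    · rintro ⟨x, y⟩ _
      simp only [add_sub_cancel]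
      rw [sub_eq_add_neg, eC_add, eC_neg]
  have h2 : ‖Tsum a b F‖ ^ 2 = ‖((‖Tsum a b F‖ ^ 2 : ℝ) : ℂ)‖ := by
    rw [Complex.norm_real, Real.norm_of_nonneg (by positivity)]
  rw [h2, h1]
  exact norm_sum_le _ _

/-- iterated differences -/
def iDf {n : ℕ} : (e : ℕ) → (Fin e → Fin n → ℤ) → ((Fin n → ℤ) → ℝ) → ((Fin n → ℤ) → ℝ)
  | 0, _, F => F
  | e + 1, h, F => iDf e (fun s => h s.succ) (fun x => F (x + h 0) - F x)

lemma sum_pi_cons {α β : Type*} [AddCommMonoid β] {j : ℕ} (s : Fin (j + 1) → Finset α)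
    (f : (Fin (j + 1) → α) → β) :
    ∑ h ∈ Fintype.piFinset s, f h =
      ∑ a ∈ s 0, ∑ h ∈ Fintype.piFinset (fun i : Fin j => s i.succ), f (Fin.cons a h) := by
  rw [← Finset.sum_product']
  refine Finset.sum_bij' (fun h _ => (h 0, fun i => h i.succ)) (fun p _ => Fin.cons p.1 p.2)
    ?_ ?_ ?_ ?_ ?_
  · intro h hh
    rw [Fintype.mem_piFinset] at hh
    simp only [Finset.mem_product, Fintype.mem_piFinset]
    exact ⟨hh 0, fun i => hh i.succ⟩
  · rintro ⟨a, h⟩ hh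
    simp only [Finset.mem_product, Fintype.mem_piFinset] at hh ⊢
    intro i
    refine Fin.cases ?_ (fun i => ?_) i
    · simpa using hh.1
    · simpa using hh.2 i
  · intro h _; exact Fin.cons_self_tail h
  · rintro ⟨a, h⟩ _; simp
  · intro h _; congr 1; exact (Fin.cons_self_tail h).symm

lemma weyl_iter {n : ℕ} (M : ℕ) (j : ℕ) : ∀ (F : (Fin n → ℤ) → ℝ)
    (Kb : (Fin j → Fin n → ℤ) → ℝ),
    (∀ h ∈ Fintype.piFinset (fun _ : Fin j => bx n M), ∀ a b : Fin n → ℤ, (∀ i, b i - a i ≤ M) →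
      ‖Tsum a b (iDf j h F)‖ ≤ Kb h) →
    ∀ a b : Fin n → ℤ, (∀ i, b i - a i ≤ M) →
    ‖Tsum a b F‖ ^ (2 ^ j) ≤ ((bx n M).card : ℝ) ^ (2 ^ j - j - 1) *
      ∑ h ∈ Fintype.piFinset (fun _ : Fin j => bx n M), Kb h := by
  induction j with
  | zero =>
    intro F Kb hK a b hab
    have hm : (fun i => i.elim0 : Fin 0 → Fin n → ℤ) ∈
        Fintype.piFinset (fun _ : Fin 0 => bx n M) := Fintype.mem_piFinset.2 fun i => i.elim0
    have := hK (fun i => i.elim0) hm a b hab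
    simp only [pow_zero, pow_one, Nat.sub_self, Nat.sub_zero, one_mul, iDf] at this ⊢
    rw [Finset.sum_eq_single_of_mem _ hm fun b _ hb => absurd (Subsingleton.elim _ _) hb]
    exact this
  | succ j ih =>
    intro F Kb hK a b hab
    have h1 := weyl_step M a b hab F
    have h2 : ∀ h0 ∈ bx n M, ‖Tsum (a ⊔ (a - h0)) (b ⊓ (b - h0)) (fun x => F (x + h0) - F x)‖ ^ (2 ^ j)
        ≤ ((bx n M).card : ℝ) ^ (2 ^ j - j - 1) *
        ∑ h ∈ Fintype.piFinset (fun _ : Fin j => bx n M), Kb (Fin.cons h0 h) := by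
      intro h0 hh0
      refine ih _ (fun h => Kb (Fin.cons h0 h)) ?_ _ _ ?_
      · intro h hh a' b' hab'
        have := hK (Fin.cons h0 h) (by
          rw [Fintype.mem_piFinset] at hh ⊢
          intro i
          refine Fin.cases ?_ (fun i => ?_) i
          · simpa using hh0
          · simpa using hh i) a' b' hab'
        simpa [iDf] using this
      · intro i
        simp only [Pi.sup_apply, Pi.inf_apply, Pi.sub_apply]
        have := hab i
        have h3 : b i ⊓ (b i - h0 i) ≤ b i := inf_le_left
        have h4 : a i ≤ a i ⊔ (a i - h0 i) := le_sup_left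
        linarith
    have hpos : 0 < 2 ^ j := by positivity
    have hlt : j < 2 ^ j := Nat.lt_two_pow_self
    have hcard : (0 : ℝ) < (bx n M).card := by
      have : (0 : Fin n → ℤ) ∈ bx n M := mem_bx.2 (by simp)
      exact_mod_cast Finset.card_pos.2 ⟨_, this⟩
    calc ‖Tsum a b F‖ ^ (2 ^ (j + 1)) = (‖Tsum a b F‖ ^ 2) ^ (2 ^ j) := by
          rw [← pow_mul, pow_succ, mul_comm]
      _ ≤ (∑ h0 ∈ bx n M,
          ‖Tsum (a ⊔ (a - h0)) (b ⊓ (b - h0)) (fun x => F (x + h0) - F x)‖) ^ (2 ^ j) := by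
          gcongr
      _ ≤ ((bx n M).card : ℝ) ^ (2 ^ j - 1) * ∑ h0 ∈ bx n M,
          ‖Tsum (a ⊔ (a - h0)) (b ⊓ (b - h0)) (fun x => F (x + h0) - F x)‖ ^ (2 ^ j) := by
          obtain ⟨r, hr⟩ : ∃ r, 2 ^ j = r + 1 := ⟨2 ^ j - 1, by omega⟩
          rw [hr, Nat.add_sub_cancel]
          have := pow_sum_div_card_le_sum_pow (s := bx n M) (n := r) (f := fun h0 =>
            ‖Tsum (a ⊔ (a - h0)) (b ⊓ (b - h0)) (fun x => F (x + h0) - F x)‖)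
            (fun _ _ => norm_nonneg _)
          rw [div_le_iff₀ (by positivity)] at this
          linarith
      _ ≤ ((bx n M).card : ℝ) ^ (2 ^ j - 1) * ∑ h0 ∈ bx n M,
          (((bx n M).card : ℝ) ^ (2 ^ j - j - 1) *
        ∑ h ∈ Fintype.piFinset (fun _ : Fin j => bx n M), Kb (Fin.cons h0 h)) := by
          gcongr with h0 hh0
          exact h2 h0 hh0
      _ = _ := by
          rw [sum_pi_cons, ← Finset.mul_sum, ← mul_assoc, ← pow_add]
          congr 2
          rw [pow_succ]; omega

lemma iDf_poly {n R : ℕ} (α : Fin R → ℝ) (e : ℕ) : ∀ (h : Fin e → Fin n → ℤ)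
    (f : Fin R → MvPolynomial (Fin n) ℤ) (x : Fin n → ℤ),
    iDf e h (fun x => ∑ i, α i * ((eval x (f i) : ℤ) : ℝ)) x =
      ∑ i, α i * ((eval x (iDp e h (f i)) : ℤ) : ℝ) := by
  induction e with
  | zero => intro h f x; rfl
  | succ e ih =>
    intro h f x
    simp only [iDf, iDp]
    rw [← ih]
    congr 1
    ext x
    rw [← Finset.sum_sub_distrib]
    refine Finset.sum_congr rfl fun i _ => ?_
    rw [eval_Dp]; push_cast; ring

/-- sum of a linear phase over a box -/
lemma Tsum_affine {n : ℕ} (a b : Fin n → ℤ) (c : ℝ) (β : Fin n → ℝ) :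
    ‖Tsum a b (fun x => c + ∑ j, x j * β j)‖ = ∏ j, ‖∑ y ∈ Finset.Icc (a j) (b j), eC (y * β j)‖ := by
  classical
  unfold Tsum
  have hs : ∀ s : Finset (Fin n), ∀ g : Fin n → ℝ, eC (∑ j ∈ s, g j) = ∏ j ∈ s, eC (g j) := by
    intro s g
    induction s using Finset.induction_on with
    | empty => simp [eC]
    | insert a s ha ih => rw [Finset.sum_insert ha, Finset.prod_insert ha, eC_add, ih]
  simp_rw [eC_add, hs]
  rw [← Finset.mul_sum, norm_mul, norm_eC, one_mul, ← norm_prod]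
  rw [Finset.prod_univ_sum]
  rfl

def nd (x : ℝ) : ℝ := |x - round x|

def kr (M : ℕ) (r : ℕ) : ℝ :=
  2 * M * ((max 1 (r : ℝ))⁻¹ + (max 1 (2 * (M : ℝ) - 1 - r))⁻¹)

lemma kr_nonneg (M r : ℕ) : 0 ≤ kr M r := by unfold kr; positivity

lemma norm_eC_sub_one (β : ℝ) : 4 * nd β ≤ ‖eC β - 1‖ := by
  have h1 : eC β = eC (β - round β) := by
    have : β = (β - round β) + (round β : ℝ) := by ring
    conv_lhs => rw [this, eC_add, eC_int, mul_one]
  rw [h1]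
  unfold nd
  set t := β - round β with ht
  have htb : |t| ≤ 1 / 2 := abs_sub_round β
  have h2 : eC t - 1 = Complex.exp (Complex.I * ((2 * Real.pi * t : ℝ) : ℂ)) - 1 := by
    unfold eC; congr 2; push_cast; ring
  rw [h2, Complex.norm_exp_I_mul_ofReal_sub_one]
  rw [Real.norm_eq_abs, abs_mul, abs_two]
  have h3 : 2 * Real.pi * t / 2 = Real.pi * t := by ring
  rw [h3]
  have h4 : 2 / Real.pi * |Real.pi * t| ≤ |Real.sin (Real.pi * t)| := by
    apply Real.mul_abs_le_abs_sin
    rw [abs_mul, abs_of_pos Real.pi_pos]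
    nlinarith [Real.pi_pos]
  rw [abs_mul, abs_of_pos Real.pi_pos] at h4
  have h5 : 2 / Real.pi * (Real.pi * |t|) = 2 * |t| := by
    field_simp
  rw [h5] at h4
  linarith

lemma geo_bound (a b : ℤ) (β : ℝ) : ‖∑ y ∈ Finset.Icc a b, eC (y * β)‖ * (2 * nd β) ≤ 1 := by
  have h1 : (∑ y ∈ Finset.Icc a b, eC (y * β)) * (eC β - 1) =
      if a ≤ b then eC ((b + 1) * β) - eC (a * β) else 0 := by
    split_ifs with hab
    · obtain ⟨k, rfl⟩ := Int.le.dest hab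
      clear hab
      induction k with
      | zero =>
        simp only [Nat.cast_zero, add_zero, Finset.Icc_self, Finset.sum_singleton]
        rw [add_mul, one_mul, eC_add]; ring
      | succ k ih =>
        have : Finset.Icc a (a + ((k + 1 : ℕ) : ℤ)) =
            insert (a + k + 1) (Finset.Icc a (a + k)) := by
          ext x; simp only [Finset.mem_insert, Finset.mem_Icc]; push_cast; omega
        rw [this, Finset.sum_insert (by simp), add_mul, ih]
        have h2 : (((a + ((k + 1 : ℕ) : ℤ) : ℤ) : ℝ) + 1) * β = ((a + k + 1 : ℤ) : ℝ) * β + β := by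
          push_cast; ring
        rw [h2, eC_add]
        push_cast; ring
    · rw [Finset.Icc_eq_empty hab]; simp
  have h2 : ‖(∑ y ∈ Finset.Icc a b, eC (y * β)) * (eC β - 1)‖ ≤ 2 := by
    rw [h1]
    split_ifs
    · refine (norm_sub_le _ _).trans ?_
      rw [norm_eC, norm_eC]; norm_num
    · simp
  rw [norm_mul] at h2
  have h3 := norm_eC_sub_one β
  nlinarith [norm_nonneg (∑ y ∈ Finset.Icc a b, eC (y * β))]

lemma geo_kr (M : ℕ) (hM : 1 ≤ M) (a b : ℤ) (hab : b - a ≤ M) (β : ℝ) :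
    ‖∑ y ∈ Finset.Icc a b, eC (y * β)‖ ≤ kr M ⌊2 * (M : ℝ) * Int.fract β⌋₊ := by
  set r := ⌊2 * (M : ℝ) * Int.fract β⌋₊ with hr
  set s := ‖∑ y ∈ Finset.Icc a b, eC (y * β)‖ with hs
  have hM' : (1 : ℝ) ≤ M := by exact_mod_cast hM
  have hf0 := Int.fract_nonneg β
  have hf1 := Int.fract_lt_one β
  have hr1 : (r : ℝ) ≤ 2 * M * Int.fract β := Nat.floor_le (by positivity)
  have hr2 : 2 * M * Int.fract β < (r : ℝ) + 1 := Nat.lt_floor_add_one _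
  have htriv : s ≤ 2 * M := by
    calc s ≤ ∑ y ∈ Finset.Icc a b, ‖eC (y * β)‖ := norm_sum_le _ _
      _ = (Finset.Icc a b).card := by simp [norm_eC]
      _ ≤ 2 * M := by
        rw [Int.card_Icc]
        have : (b + 1 - a).toNat ≤ 2 * M := by omega
        exact_mod_cast this
  have hgeo := geo_bound a b β
  rw [← hs] at hgeo
  have hs0 : 0 ≤ s := norm_nonneg _
  have hx : 0 ≤ (max 1 (r : ℝ))⁻¹ := by positivity
  have hy : 0 ≤ (max 1 (2 * (M : ℝ) - 1 - r))⁻¹ := by positivity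
  unfold kr
  by_cases h1 : r < 1
  · have : (r : ℝ) = 0 := by
      have : r = 0 := by omega
      exact_mod_cast this
    rw [this] at hy ⊢
    simp only [max_eq_left zero_le_one, inv_one]
    nlinarith
  have hr1' : (1 : ℝ) ≤ r := by exact_mod_cast not_lt.1 h1
  by_cases h2 : 2 * (M : ℝ) - 1 - r < 1
  · rw [max_eq_left h2.le, inv_one]
    nlinarith
  push Not at h2
  rw [max_eq_right hr1', max_eq_right h2]
  have hnd : nd β = min (Int.fract β) (1 - Int.fract β) := abs_sub_round_eq_min β
  have h2M : (0 : ℝ) < 2 * M - 1 - r := by linarith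
  rcases min_choice (Int.fract β) (1 - Int.fract β) with h | h
  · rw [hnd, h] at hgeo
    have : s ≤ 2 * M * ((r : ℝ))⁻¹ := by
      rw [← div_eq_mul_inv, le_div_iff₀ (by linarith)]
      nlinarith
    have h3 : 0 ≤ (2 * (M : ℝ) - 1 - r)⁻¹ := by positivity
    nlinarith
  · rw [hnd, h] at hgeo
    have : s ≤ 2 * M * ((2 * (M : ℝ) - 1 - r))⁻¹ := by
      rw [← div_eq_mul_inv, le_div_iff₀ (by linarith)]
      nlinarith
    have h3 : 0 ≤ (r : ℝ)⁻¹ := by positivity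
    nlinarith

lemma sum_kr (M : ℕ) (hM : 1 ≤ M) :
    ∑ r ∈ Finset.range (2 * M), kr M r ≤ 4 * M * (2 + Real.log (2 * M)) := by
  have h1 : ∑ r ∈ Finset.range (2 * M), (max 1 (r : ℝ))⁻¹ ≤ 2 + Real.log (2 * M) := by
    obtain ⟨k, hk⟩ : ∃ k, 2 * M = k + 1 := ⟨2 * M - 1, by omega⟩
    rw [hk, Finset.sum_range_succ']
    have h2 : ∑ r ∈ Finset.range k, (max 1 (((r + 1 : ℕ) : ℝ)))⁻¹ = (harmonic k : ℝ) := by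
      simp only [harmonic]
      push_cast
      refine Finset.sum_congr rfl fun r _ => ?_
      rw [max_eq_right]
      have : (0 : ℝ) ≤ r := by positivity
      linarith
    rw [h2]
    have h3 := harmonic_le_one_add_log k
    have h4 : Real.log k ≤ Real.log (2 * M) := by
      have hk0 : 0 < k := by omega
      apply Real.log_le_log (by exact_mod_cast hk0)
      have : k ≤ 2 * M := by omega
      exact_mod_cast this
    simp
    linarith
  have h2 : ∑ r ∈ Finset.range (2 * M), (max 1 (2 * (M : ℝ) - 1 - r))⁻¹ =
      ∑ r ∈ Finset.range (2 * M), (max 1 (r : ℝ))⁻¹ := by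
    rw [← Finset.sum_range_reflect]
    refine Finset.sum_congr rfl fun r hr => ?_
    have : r + 1 ≤ 2 * M := Finset.mem_range.1 hr
    have h3 : ((2 * M - 1 - r : ℕ) : ℝ) = 2 * M - 1 - r := by
      rw [Nat.sub_sub, Nat.cast_sub (by omega)]; push_cast; ring
    rw [h3]
    congr 2; ring
  unfold kr
  rw [← Finset.mul_sum, Finset.sum_add_distrib, h2]
  have : (0 : ℝ) ≤ M := by positivity
  nlinarith


lemma nd_le_of (x : ℝ) (m : ℤ) : nd x ≤ |x - m| := round_le x m

lemma cell_bound {n : ℕ} (M : ℕ) (hM : 1 ≤ M) (β : (Fin n → ℤ) → Fin n → ℝ)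
    (hβ : ∀ u v j, β (u - v) j = β u j - β v j) :
    ∑ u ∈ bx n M, ∏ j, kr M ⌊2 * (M : ℝ) * Int.fract (β u j)⌋₊ ≤
      (((bx n (2 * M)).filter fun u => ∀ j, nd (β u j) ≤ 1 / (2 * M)).card : ℝ) *
        (∑ r ∈ Finset.range (2 * M), kr M r) ^ n := by
  classical
  have hM' : (1 : ℝ) ≤ M := by exact_mod_cast hM
  let cell : (Fin n → ℤ) → (Fin n → ℕ) := fun u j => ⌊2 * (M : ℝ) * Int.fract (β u j)⌋₊
  let Rg := Fintype.piFinset fun _ : Fin n => Finset.range (2 * M)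
  have hmaps : ∀ u ∈ bx n M, cell u ∈ Rg := by
    intro u _
    rw [Fintype.mem_piFinset]
    intro j
    rw [Finset.mem_range]
    have h1 := Int.fract_lt_one (β u j)
    have h0 := Int.fract_nonneg (β u j)
    show ⌊2 * (M : ℝ) * Int.fract (β u j)⌋₊ < 2 * M
    rw [Nat.floor_lt (by positivity)]
    push_cast
    nlinarith
  rw [← Finset.sum_fiberwise_of_maps_to hmaps]
  have h1 : ∀ r ∈ Rg, ∑ u ∈ (bx n M).filter (fun u => cell u = r),
      ∏ j, kr M ⌊2 * (M : ℝ) * Int.fract (β u j)⌋₊ ≤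
      (((bx n (2 * M)).filter fun u => ∀ j, nd (β u j) ≤ 1 / (2 * M)).card : ℝ) *
        ∏ j, kr M (r j) := by
    intro r _
    have h2 : ∑ u ∈ (bx n M).filter (fun u => cell u = r),
        ∏ j, kr M ⌊2 * (M : ℝ) * Int.fract (β u j)⌋₊ =
        (((bx n M).filter (fun u => cell u = r)).card : ℝ) * ∏ j, kr M (r j) := by
      rw [← nsmul_eq_mul, ← Finset.sum_const]
      refine Finset.sum_congr rfl fun u hu => ?_
      rw [← (Finset.mem_filter.1 hu).2]
    rw [h2]
    refine mul_le_mul_of_nonneg_right ?_ (Finset.prod_nonneg fun _ _ => kr_nonneg _ _)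
    rcases ((bx n M).filter (fun u => cell u = r)).eq_empty_or_nonempty with he | ⟨u0, hu0⟩
    · rw [he]; simp
    have hu0' := Finset.mem_filter.1 hu0
    refine Nat.cast_le.2 ?_
    refine Finset.card_le_card_of_injOn (fun u => u - u0) ?_ (fun a _ b _ h => sub_left_injective h)
    intro u hu
    have hu' := Finset.mem_filter.1 hu
    simp only [Finset.coe_filter, Set.mem_ofPred_eq]
    refine ⟨mem_bx.2 fun i => ?_, fun j => ?_⟩
    · have a1 := mem_bx.1 hu'.1 i
      have a2 := mem_bx.1 hu0'.1 i
      rw [Pi.sub_apply]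
      push_cast
      rw [abs_le] at *
      constructor <;> linarith
    · rw [hβ]
      have hc : cell u j = cell u0 j := by rw [hu'.2, hu0'.2]
      have b1 : (cell u j : ℝ) ≤ 2 * M * Int.fract (β u j) :=
        Nat.floor_le (mul_nonneg (by positivity) (Int.fract_nonneg _))
      have b2 : 2 * M * Int.fract (β u j) < (cell u j : ℝ) + 1 := Nat.lt_floor_add_one _
      have b3 : (cell u0 j : ℝ) ≤ 2 * M * Int.fract (β u0 j) :=
        Nat.floor_le (mul_nonneg (by positivity) (Int.fract_nonneg _))
      have b4 : 2 * M * Int.fract (β u0 j) < (cell u0 j : ℝ) + 1 := Nat.lt_floor_add_one _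
      rw [hc] at b1 b2
      refine (nd_le_of _ (⌊β u j⌋ - ⌊β u0 j⌋)).trans ?_
      have : β u j - β u0 j - ((⌊β u j⌋ - ⌊β u0 j⌋ : ℤ) : ℝ) =
          Int.fract (β u j) - Int.fract (β u0 j) := by
        push_cast; unfold Int.fract; ring
      rw [this, le_div_iff₀ (by positivity)]
      have h5 : |Int.fract (β u j) - Int.fract (β u0 j)| * (2 * M) =
          |(Int.fract (β u j) - Int.fract (β u0 j)) * (2 * M)| := by
        rw [abs_mul, abs_of_nonneg (by positivity : (0 : ℝ) ≤ 2 * M)]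
      rw [h5, abs_le]
      constructor <;> nlinarith
  refine (Finset.sum_le_sum h1).trans (le_of_eq ?_)
  rw [← Finset.mul_sum]
  congr 1
  have h3 := Finset.prod_univ_sum (fun _ : Fin n => Finset.range (2 * M)) (fun _ r => kr M r)
  rw [← h3]
  simp

def bet {n R e : ℕ} (α : Fin R → ℝ) (f : Fin R → MvPolynomial (Fin n) ℤ) (j : Fin n)
    (h : Fin e → Fin n → ℤ) : ℝ := ∑ i, α i * ((Phi (f i) j h : ℤ) : ℝ)

/-- the counting function with side lengths `X s` and tolerance `W` -/
def Nct {n R e : ℕ} (α : Fin R → ℝ) (f : Fin R → MvPolynomial (Fin n) ℤ) (X : Fin e → ℝ)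
    (W : ℝ) : Finset (Fin e → Fin n → ℤ) :=
  open Classical in
  (Fintype.piFinset fun s => bx n (X s)).filter fun h => ∀ j, nd (bet α f j h) ≤ W

lemma bet_lin {n R e : ℕ} (α : Fin R → ℝ) (f : Fin R → MvPolynomial (Fin n) ℤ) (j : Fin n)
    (h : Fin e → Fin n → ℤ) (s : Fin e) (u : Fin n → ℤ) :
    bet α f j (Function.update h s u) =
      ∑ i, (u i : ℝ) * bet α f j (Function.update h s (Pi.single i 1)) := by
  unfold bet
  simp_rw [Phi_lin (h := h) (s := s) (u := u), Finset.mul_sum]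
  push_cast
  simp_rw [Finset.mul_sum]
  rw [Finset.sum_comm]
  exact Finset.sum_congr rfl fun i _ => Finset.sum_congr rfl fun i' _ => by ring

lemma bet_symm {n R e : ℕ} (α : Fin R → ℝ) (f : Fin R → MvPolynomial (Fin n) ℤ) (j i : Fin n)
    (h : Fin e → Fin n → ℤ) (s : Fin e) :
    bet α f j (Function.update h s (Pi.single i 1)) =
      bet α f i (Function.update h s (Pi.single j 1)) := by
  unfold bet
  exact Finset.sum_congr rfl fun k _ => by rw [Phi_symm]

lemma weyl_N0 {n R e : ℕ} (α : Fin R → ℝ) (f : Fin R → MvPolynomial (Fin n) ℤ)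
    (hf : ∀ i, (f i).totalDegree ≤ e + 2) (M : ℕ) (hM : 1 ≤ M) (a b : Fin n → ℤ)
    (hab : ∀ i, b i - a i ≤ M) :
    ‖Tsum a b (fun x => ∑ i, α i * ((eval x (f i) : ℤ) : ℝ))‖ ^ (2 ^ (e + 1)) ≤
      ((bx n M).card : ℝ) ^ (2 ^ (e + 1) - (e + 1) - 1) *
      ((4 * M * (2 + Real.log (2 * M))) ^ n *
        ((Nct α f (fun _ : Fin (e + 1) => 2 * (M : ℝ)) (1 / (2 * M))).card : ℝ)) := by
  classical
  have hM' : (1 : ℝ) ≤ M := by exact_mod_cast hM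
  refine (weyl_iter M (e + 1) _
    (fun h => ∏ j, kr M ⌊2 * (M : ℝ) * Int.fract (bet α f j h)⌋₊) ?_ a b hab).trans ?_
  · intro h _ a' b' hab'
    have h1 : iDf (e + 1) h (fun x => ∑ i, α i * ((eval x (f i) : ℤ) : ℝ)) =
        fun x => (∑ i, α i * ((coeff 0 (iDp (e + 1) h (f i)) : ℤ) : ℝ)) +
          ∑ j, x j * bet α f j h := by
      ext x
      rw [iDf_poly]
      have : ∀ i, ((eval x (iDp (e + 1) h (f i)) : ℤ) : ℝ) =
          ((coeff 0 (iDp (e + 1) h (f i)) : ℤ) : ℝ) + ∑ j, (x j : ℝ) * ((Phi (f i) j h : ℤ) : ℝ) := by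
        intro i
        rw [iDp_affine h (f i) (hf i) x]; push_cast; rfl
      simp_rw [this, mul_add, Finset.sum_add_distrib, bet, Finset.mul_sum]
      congr 1
      rw [Finset.sum_comm]
      exact Finset.sum_congr rfl fun j _ => Finset.sum_congr rfl fun i _ => by ring
    rw [h1, Tsum_affine]
    exact Finset.prod_le_prod (fun _ _ => norm_nonneg _) fun j _ => geo_kr M hM _ _ (hab' j) _
  · refine mul_le_mul_of_nonneg_left ?_ (by positivity)
    rw [sum_pi_cons, Finset.sum_comm]
    have h2 : ∀ h' : Fin e → Fin n → ℤ,
        ∑ u ∈ bx n M, ∏ j, kr M ⌊2 * (M : ℝ) * Int.fract (bet α f j (Fin.cons u h'))⌋₊ ≤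
        (((bx n (2 * M)).filter fun u => ∀ j, nd (bet α f j (Fin.cons u h' : Fin (e + 1) → _)) ≤
          1 / (2 * M)).card : ℝ) *
        (∑ r ∈ Finset.range (2 * M), kr M r) ^ n := by
      intro h'
      refine cell_bound M hM (fun u j => bet α f j (Fin.cons u h' : Fin (e + 1) → _)) ?_
      intro u v j
      have h3 : ∀ u : Fin n → ℤ, (Fin.cons u h' : Fin (e + 1) → Fin n → ℤ) =
          Function.update (Fin.cons 0 h' : Fin (e + 1) → Fin n → ℤ) 0 u := by
        intro u; exact (Fin.update_cons_zero _ _ _).symm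
      show bet α f j (Fin.cons (u - v) h' : Fin (e + 1) → _) =
        bet α f j (Fin.cons u h' : Fin (e + 1) → _) - bet α f j (Fin.cons v h' : Fin (e + 1) → _)
      rw [h3 (u - v), h3 u, h3 v, bet_lin _ _ _ _ _ (u - v), bet_lin _ _ _ _ _ u,
        bet_lin _ _ _ _ _ v, ← Finset.sum_sub_distrib]
      refine Finset.sum_congr rfl fun i _ => ?_
      rw [Pi.sub_apply]; push_cast; ring
    refine (Finset.sum_le_sum fun h' _ => h2 h').trans ?_
    rw [← Finset.sum_mul, mul_comm]
    have hs0 : 0 ≤ ∑ r ∈ Finset.range (2 * M), kr M r := Finset.sum_nonneg fun _ _ => kr_nonneg _ _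
    refine mul_le_mul (pow_le_pow_left₀ hs0 (sum_kr M hM) n) ?_ (by positivity)
      (pow_nonneg (hs0.trans (sum_kr M hM)) n)
    have h4 : ((Nct α f (fun _ : Fin (e + 1) => 2 * (M : ℝ)) (1 / (2 * M))).card : ℝ) =
        ∑ h ∈ Fintype.piFinset (fun _ : Fin (e + 1) => bx n (2 * (M : ℝ))),
          if ∀ j, nd (bet α f j h) ≤ 1 / (2 * (M : ℝ)) then (1 : ℝ) else 0 := by
      unfold Nct
      rw [Finset.sum_boole]
    rw [h4, sum_pi_cons, Finset.sum_comm]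
    have h5 : ∀ h' : Fin e → Fin n → ℤ,
        (((bx n (2 * M)).filter fun u => ∀ j, nd (bet α f j (Fin.cons u h' : Fin (e + 1) → _)) ≤
          1 / (2 * M)).card : ℝ) = ∑ u ∈ bx n (2 * M),
          if ∀ j, nd (bet α f j (Fin.cons u h' : Fin (e + 1) → _)) ≤ 1 / (2 * (M : ℝ))
          then (1 : ℝ) else 0 := by
      intro h'
      rw [Finset.sum_boole]
    simp_rw [h5]
    refine Finset.sum_le_sum_of_subset_of_nonneg ?_ ?_
    · intro h hh
      rw [Fintype.mem_piFinset] at hh ⊢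
      intro s
      refine mem_bx.2 fun i => (mem_bx.1 (hh s) i).trans ?_
      linarith
    · intro h _ _
      exact Finset.sum_nonneg fun u _ => by split_ifs <;> norm_num


lemma packing {E : Type*} [NormedAddCommGroup E] [NormedSpace ℝ E] [FiniteDimensional ℝ E]
    {ι : Type*} (T : Finset ι) (v : ι → E) (r s : ℝ) (hr : 0 ≤ r) (hs : 0 < s)
    (hT : ∀ x ∈ T, ‖v x‖ ≤ r) (hsep : ∀ x ∈ T, ∀ y ∈ T, x ≠ y → s < ‖v x - v y‖) :
    (T.card : ℝ) ≤ (1 + 2 * r / s) ^ Module.finrank ℝ E := by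
  borelize E
  let μ : Measure E := Measure.addHaar
  set k := Module.finrank ℝ E with hk
  have D : Set.Pairwise (T : Set ι) (Function.onFun Disjoint fun c => Metric.ball (v c) (s / 2)) := by
    intro c hc d hd hcd
    apply Metric.ball_disjoint_ball
    rw [dist_eq_norm]
    linarith [hsep c hc d hd hcd]
  have A_subset : (⋃ c ∈ T, Metric.ball (v c) (s / 2)) ⊆ Metric.ball (0 : E) (r + s / 2) := by
    refine Set.iUnion₂_subset fun x hx => ?_
    apply Metric.ball_subset_ball'
    rw [dist_zero_right]
    linarith [hT x hx]
  have I : (T.card : ENNReal) * ENNReal.ofReal ((s / 2) ^ k) * μ (Metric.ball 0 1) ≤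
      ENNReal.ofReal ((r + s / 2) ^ k) * μ (Metric.ball 0 1) := by
    calc
      (T.card : ENNReal) * ENNReal.ofReal ((s / 2) ^ k) * μ (Metric.ball 0 1)
          = μ (⋃ c ∈ T, Metric.ball (v c) (s / 2)) := by
        rw [measure_biUnion_finset D fun c _ => measurableSet_ball]
        have I : 0 < s / 2 := by linarith
        simp only [μ.addHaar_ball_of_pos _ I]
        simp only [Finset.sum_const, nsmul_eq_mul, mul_assoc, hk]
      _ ≤ μ (Metric.ball (0 : E) (r + s / 2)) := measure_mono A_subset
      _ = _ := by
        have I : 0 < r + s / 2 := by linarith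
        simp only [μ.addHaar_ball_of_pos _ I, hk]
  have J : (T.card : ENNReal) * ENNReal.ofReal ((s / 2) ^ k) ≤ ENNReal.ofReal ((r + s / 2) ^ k) :=
    (ENNReal.mul_le_mul_iff_left (Metric.measure_ball_pos _ _ zero_lt_one).ne' measure_ball_lt_top.ne).1 I
  have h1 := ENNReal.toReal_le_of_le_ofReal (by positivity) J
  rw [ENNReal.toReal_mul, ENNReal.toReal_natCast, ENNReal.toReal_ofReal (by positivity)] at h1
  have h2 : 1 + 2 * r / s = (r + s / 2) / (s / 2) := by field_simp; ring
  rw [h2, div_pow, le_div_iff₀ (by positivity)]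
  exact h1

lemma pack2 {E : Type*} [NormedAddCommGroup E] [NormedSpace ℝ E] [FiniteDimensional ℝ E]
    {G : Type*} [AddCommGroup G] (v : G → E) (S2 S1 : Finset G) (r s : ℝ) (hr : 0 ≤ r)
    (hs : 0 < s) (hT : ∀ x ∈ S2, ‖v x‖ ≤ r)
    (hd : ∀ x ∈ S2, ∀ y ∈ S2, ‖v x - v y‖ ≤ s → x - y ∈ S1) :
    (S2.card : ℝ) ≤ (1 + 2 * r / s) ^ Module.finrank ℝ E * S1.card := by
  classical
  let Sep : Finset G → Prop := fun T => ∀ x ∈ T, ∀ y ∈ T, x ≠ y → s < ‖v x - v y‖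
  let F := S2.powerset.filter Sep
  have hF : F.Nonempty := ⟨∅, by simp [F, Sep]⟩
  obtain ⟨T, hTF, hmax⟩ := Finset.exists_max_image F Finset.card hF
  obtain ⟨hTS, hsep⟩ := Finset.mem_filter.1 hTF
  rw [Finset.mem_powerset] at hTS
  have hcov : ∀ x ∈ S2, ∃ t ∈ T, ‖v x - v t‖ ≤ s := by
    intro x hx
    by_contra! hcon
    have hxT : x ∉ T := by
      intro h
      have := hcon x h
      rw [sub_self, norm_zero] at this
      linarith
    have : insert x T ∈ F := by
      refine Finset.mem_filter.2 ⟨Finset.mem_powerset.2 (Finset.insert_subset hx hTS), ?_⟩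
      intro a ha b hb hab
      rcases Finset.mem_insert.1 ha with rfl | ha'
      · rcases Finset.mem_insert.1 hb with rfl | hb
        · exact absurd rfl hab
        · exact hcon b hb
      · rcases Finset.mem_insert.1 hb with rfl | hb
        · rw [norm_sub_rev]; exact hcon a ha'
        · exact hsep a ha' b hb hab
    have := hmax _ this
    rw [Finset.card_insert_of_notMem hxT] at this
    omega
  have h1 : S2 ⊆ T.biUnion fun t => S2.filter fun x => ‖v x - v t‖ ≤ s := by
    intro x hx
    obtain ⟨t, ht, h⟩ := hcov x hx
    exact Finset.mem_biUnion.2 ⟨t, ht, Finset.mem_filter.2 ⟨hx, h⟩⟩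
  have h2 : S2.card ≤ T.card * S1.card := by
    refine (Finset.card_le_card h1).trans (Finset.card_biUnion_le_card_mul _ _ _ ?_)
    intro t ht
    refine Finset.card_le_card_of_injOn (fun x => x - t) ?_ (fun a _ b _ h => sub_left_injective h)
    intro x hx
    have := Finset.mem_filter.1 hx
    exact hd x this.1 t (hTS ht) this.2
  have h3 := packing T v r s hr hs (fun x hx => hT x (hTS hx)) hsep
  calc (S2.card : ℝ) ≤ T.card * S1.card := by exact_mod_cast h2
    _ ≤ _ := mul_le_mul_of_nonneg_right h3 (by positivity)

/-- the standard symplectic form -/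
def sympl (n : ℕ) : LinearMap.BilinForm ℝ ((Fin n → ℝ) × (Fin n → ℝ)) :=
  LinearMap.mk₂ ℝ (fun x y => ∑ i, (x.1 i * y.2 i - x.2 i * y.1 i))
    (by intro a b c; rw [← Finset.sum_add_distrib]
        refine Finset.sum_congr rfl fun i _ => ?_
        simp only [Prod.fst_add, Prod.snd_add, Pi.add_apply]; ring)
    (by intro a b c; rw [smul_eq_mul, Finset.mul_sum]
        refine Finset.sum_congr rfl fun i _ => ?_
        simp only [Prod.smul_fst, Prod.smul_snd, Pi.smul_apply, smul_eq_mul]; ring)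
    (by intro a b c; rw [← Finset.sum_add_distrib]
        refine Finset.sum_congr rfl fun i _ => ?_
        simp only [Prod.fst_add, Prod.snd_add, Pi.add_apply]; ring)
    (by intro a b c; rw [smul_eq_mul, Finset.mul_sum]
        refine Finset.sum_congr rfl fun i _ => ?_
        simp only [Prod.smul_fst, Prod.smul_snd, Pi.smul_apply, smul_eq_mul]; ring)

lemma sympl_apply (n : ℕ) (x y : (Fin n → ℝ) × (Fin n → ℝ)) :
    sympl n x y = ∑ i, (x.1 i * y.2 i - x.2 i * y.1 i) := rfl

lemma sympl_nondeg (n : ℕ) : (sympl n).Nondegenerate := by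
  constructor
  · intro x hx
    have h1 := hx (-x.2, x.1)
    rw [sympl_apply] at h1
    simp only [Pi.neg_apply] at h1
    have h2 : ∀ i ∈ Finset.univ, 0 ≤ x.1 i * x.1 i - x.2 i * -x.2 i := fun i _ => by
      nlinarith [mul_self_nonneg (x.1 i), mul_self_nonneg (x.2 i)]
    have h3 := (Finset.sum_eq_zero_iff_of_nonneg h2).1 h1
    ext i
    · have := h3 i (Finset.mem_univ _)
      show x.1 i = 0
      nlinarith [mul_self_nonneg (x.1 i), mul_self_nonneg (x.2 i)]
    · have := h3 i (Finset.mem_univ _)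
      show x.2 i = 0
      nlinarith [mul_self_nonneg (x.1 i), mul_self_nonneg (x.2 i)]
  · intro x hx
    have h1 := hx (x.2, -x.1)
    rw [sympl_apply] at h1
    simp only [Pi.neg_apply] at h1
    have h2 : ∀ i ∈ Finset.univ, 0 ≤ x.2 i * x.2 i - -x.1 i * x.1 i := fun i _ => by
      nlinarith [mul_self_nonneg (x.1 i), mul_self_nonneg (x.2 i)]
    have h3 := (Finset.sum_eq_zero_iff_of_nonneg h2).1 h1
    ext i
    · have := h3 i (Finset.mem_univ _)
      show x.1 i = 0
      nlinarith [mul_self_nonneg (x.1 i), mul_self_nonneg (x.2 i)]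
    · have := h3 i (Finset.mem_univ _)
      show x.2 i = 0
      nlinarith [mul_self_nonneg (x.1 i), mul_self_nonneg (x.2 i)]

lemma isotropic_finrank (n : ℕ) (A : Set ((Fin n → ℝ) × (Fin n → ℝ)))
    (hA : ∀ x ∈ A, ∀ y ∈ A, sympl n x y = 0) :
    Module.finrank ℝ (Submodule.span ℝ A) ≤ n := by
  have h1 : Submodule.span ℝ A ≤ (sympl n).orthogonal (Submodule.span ℝ A) := by
    intro y hy
    rw [LinearMap.BilinForm.mem_orthogonal_iff]
    intro x hx
    show sympl n x y = 0
    refine Submodule.span_induction (p := fun x _ => sympl n x y = 0) ?_ ?_ ?_ ?_ hx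
    · intro x hx
      refine Submodule.span_induction (p := fun y _ => sympl n x y = 0) ?_ ?_ ?_ ?_ hy
      · exact fun y hy => hA x hx y hy
      · simp
      · intro a b _ _ h1 h2; rw [map_add, h1, h2, add_zero]
      · intro a b _ h1; rw [map_smul, h1, smul_zero]
    · simp
    · intro a b _ _ h1 h2; rw [map_add, LinearMap.add_apply, h1, h2, add_zero]
    · intro a b _ h1; rw [map_smul, LinearMap.smul_apply, h1, smul_zero]
  have h2 := Submodule.finrank_mono h1
  rw [LinearMap.BilinForm.finrank_orthogonal (sympl_nondeg n)] at h2
  have h3 : Module.finrank ℝ ((Fin n → ℝ) × (Fin n → ℝ)) = n + n := by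
    rw [Module.finrank_prod, Module.finrank_fin_fun]
  omega

/-- number of `u` in a box for which all the linear forms are near integers -/
def fib {n : ℕ} (Γ : Fin n → Fin n → ℝ) (X W : ℝ) : Finset (Fin n → ℤ) :=
  open Classical in
  (bx n X).filter fun u => ∀ j, nd (∑ i, (u i : ℝ) * Γ j i) ≤ W

lemma mem_fib {n : ℕ} {Γ : Fin n → Fin n → ℝ} {X W : ℝ} {u : Fin n → ℤ} :
    u ∈ fib Γ X W ↔ (∀ i, |(u i : ℝ)| ≤ X) ∧ ∀ j, nd (∑ i, (u i : ℝ) * Γ j i) ≤ W := by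
  unfold fib
  rw [Finset.mem_filter, mem_bx]

lemma shrink {n : ℕ} (Γ : Fin n → Fin n → ℝ) (hΓ : ∀ i j, Γ i j = Γ j i) (X W τ : ℝ)
    (hX : 0 < X) (hW : 0 < W) (hXW : X * W ≤ 1) (hτ : 0 < τ) (hτ1 : τ ≤ 1) :
    ((fib Γ X W).card : ℝ) ≤
      ((4 * n + 5) ^ (2 * n) * 3 ^ n) * (1 / τ) ^ n * ((fib Γ (τ * X) (τ * W)).card : ℝ) := by
  let v : (Fin n → ℤ) → (Fin n → ℝ) × (Fin n → ℝ) := fun u =>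
    (fun i => (u i : ℝ) / X, fun j => ((∑ i, (u i : ℝ) * Γ j i) -
      (round (∑ i, (u i : ℝ) * Γ j i) : ℤ)) / W)
  have hv1 : ∀ ρ : ℝ, 0 ≤ ρ → ∀ u ∈ fib Γ (ρ * X) (ρ * W), ‖v u‖ ≤ ρ := by
    intro ρ hρ u hu
    obtain ⟨h1, h2⟩ := mem_fib.1 hu
    rw [Prod.norm_def, sup_le_iff, pi_norm_le_iff_of_nonneg hρ, pi_norm_le_iff_of_nonneg hρ]
    constructor
    · intro i
      rw [Real.norm_eq_abs, abs_div, abs_of_pos hX, div_le_iff₀ hX]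
      exact h1 i
    · intro j
      rw [Real.norm_eq_abs, abs_div, abs_of_pos hW, div_le_iff₀ hW]
      exact h2 j
  have hv2 : ∀ ρ : ℝ, 0 ≤ ρ → ∀ u u' : Fin n → ℤ, ‖v u - v u'‖ ≤ ρ →
      u - u' ∈ fib Γ (ρ * X) (ρ * W) := by
    intro ρ hρ u u' h
    rw [Prod.norm_def, sup_le_iff, pi_norm_le_iff_of_nonneg hρ, pi_norm_le_iff_of_nonneg hρ] at h
    obtain ⟨h1, h2⟩ := h
    rw [mem_fib]
    constructor
    · intro i
      have := h1 i
      simp only [v, Prod.fst_sub, Pi.sub_apply] at this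
      rw [← sub_div, Real.norm_eq_abs, abs_div, abs_of_pos hX, div_le_iff₀ hX] at this
      rw [Pi.sub_apply]; push_cast; exact this
    · intro j
      have := h2 j
      simp only [v, Prod.snd_sub, Pi.sub_apply] at this
      rw [← sub_div, Real.norm_eq_abs, abs_div, abs_of_pos hW, div_le_iff₀ hW] at this
      refine (nd_le_of _ (round (∑ i, (u i : ℝ) * Γ j i) - round (∑ i, (u' i : ℝ) * Γ j i))).trans
        (le_trans (le_of_eq ?_) this)
      congr 1
      simp only [Pi.sub_apply]
      push_cast
      simp_rw [sub_mul]
      rw [Finset.sum_sub_distrib]; ring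
  set c : ℝ := 1 / (2 * (n + 1)) with hc
  have hc0 : 0 < c := by positivity
  have hc1 : c ≤ 1 := by
    rw [hc, div_le_one (by positivity)]; linarith [(Nat.cast_nonneg n : (0 : ℝ) ≤ n)]
  -- step A
  have hA : ((fib Γ X W).card : ℝ) ≤ (4 * n + 5) ^ (2 * n) * (fib Γ (c * X) (c * W)).card := by
    have := pack2 v (fib Γ X W) (fib Γ (c * X) (c * W)) 1 c zero_le_one hc0
      (fun x hx => hv1 1 zero_le_one x (by rwa [one_mul, one_mul]))
      (fun x _ y _ h => hv2 c hc0.le x y h)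
    rw [Module.finrank_prod, Module.finrank_fin_fun, ← two_mul] at this
    have h2 : 1 + 2 * 1 / c = 4 * n + 5 := by rw [hc]; field_simp; ring
    rwa [h2] at this
  -- step B
  have hiso : ∀ x ∈ v '' (fib Γ (c * X) (c * W)), ∀ y ∈ v '' (fib Γ (c * X) (c * W)),
      sympl n x y = 0 := by
    rintro _ ⟨u, hu, rfl⟩ _ ⟨u', hu', rfl⟩
    have e1 := hv1 c hc0.le u hu
    have e2 := hv1 c hc0.le u' hu'
    rw [Prod.norm_def, sup_le_iff, pi_norm_le_iff_of_nonneg hc0.le,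
      pi_norm_le_iff_of_nonneg hc0.le] at e1 e2
    have b1 : |sympl n (v u) (v u')| ≤ n * (2 * c ^ 2) := by
      rw [sympl_apply]
      refine (Finset.abs_sum_le_sum_abs _ _).trans ?_
      refine (Finset.sum_le_card_nsmul _ _ (2 * c ^ 2) ?_).trans (by simp)
      intro i _
      refine (abs_sub _ _).trans ?_
      rw [abs_mul, abs_mul]
      have := mul_le_mul (e1.1 i) (e2.2 i) (norm_nonneg _) hc0.le
      have := mul_le_mul (e1.2 i) (e2.1 i) (norm_nonneg _) hc0.le
      simp only [Real.norm_eq_abs] at *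
      nlinarith
    have b2 : X * W * sympl n (v u) (v u') =
        ((∑ i, (round (∑ k, (u k : ℝ) * Γ i k) * u' i -
          u i * round (∑ k, (u' k : ℝ) * Γ i k)) : ℤ) : ℝ) := by
      rw [sympl_apply, Finset.mul_sum]
      have : ∀ i, X * W * ((v u).1 i * (v u').2 i - (v u).2 i * (v u').1 i) =
          ((u i : ℝ) * (∑ k, (u' k : ℝ) * Γ i k) - (∑ k, (u k : ℝ) * Γ i k) * u' i) +
          (((round (∑ k, (u k : ℝ) * Γ i k) : ℤ) : ℝ) * u' i -
            u i * (round (∑ k, (u' k : ℝ) * Γ i k) : ℤ)) := by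
        intro i
        simp only [v]
        field_simp
        ring
      simp_rw [this]
      rw [Finset.sum_add_distrib]
      push_cast
      have z : ∑ i, ((u i : ℝ) * (∑ k, (u' k : ℝ) * Γ i k) - (∑ k, (u k : ℝ) * Γ i k) * u' i) = 0 := by
        rw [Finset.sum_sub_distrib, sub_eq_zero]
        simp_rw [Finset.mul_sum, Finset.sum_mul]
        rw [Finset.sum_comm]
        refine Finset.sum_congr rfl fun i _ => Finset.sum_congr rfl fun k _ => ?_
        rw [hΓ k i]; ring
      rw [z, zero_add]
    have b3 : |X * W * sympl n (v u) (v u')| < 1 := by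
      rw [abs_mul, abs_of_pos (mul_pos hX hW)]
      have : (n : ℝ) * (2 * c ^ 2) < 1 := by
        rw [hc, div_pow, one_pow, mul_one_div, mul_div_assoc', div_lt_one (by positivity)]
        nlinarith [(Nat.cast_nonneg n : (0 : ℝ) ≤ n)]
      calc _ ≤ 1 * |sympl n (v u) (v u')| := mul_le_mul_of_nonneg_right hXW (abs_nonneg _)
        _ < 1 := by rw [one_mul]; exact b1.trans_lt this
    rw [b2, ← Int.cast_abs] at b3
    have b4 : |∑ i, (round (∑ k, (u k : ℝ) * Γ i k) * u' i -
          u i * round (∑ k, (u' k : ℝ) * Γ i k))| < 1 := by exact_mod_cast b3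
    rw [Int.abs_lt_one_iff] at b4
    rw [b4, Int.cast_zero] at b2
    exact (mul_eq_zero.1 b2).resolve_left (mul_pos hX hW).ne'
  have hrk := isotropic_finrank n _ hiso
  set V := Submodule.span ℝ (v '' (fib Γ (c * X) (c * W))) with hV
  classical
  let w : (Fin n → ℤ) → V := fun u => if h : v u ∈ V then ⟨v u, h⟩ else 0
  have hw : ∀ u ∈ fib Γ (c * X) (c * W), (w u : (Fin n → ℝ) × (Fin n → ℝ)) = v u := by
    intro u hu
    have : v u ∈ V := Submodule.subset_span ⟨u, hu, rfl⟩
    simp only [w, dif_pos this]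
  have hB := pack2 w (fib Γ (c * X) (c * W)) (fib Γ (τ * X) (τ * W)) c τ hc0.le hτ
    (fun x hx => by rw [← Submodule.norm_coe, hw x hx]; exact hv1 c hc0.le x hx)
    (fun x hx y hy h => by
      rw [← Submodule.norm_coe, Submodule.coe_sub, hw x hx, hw y hy] at h
      exact hv2 τ hτ.le x y h)
  have hB2 : (1 + 2 * c / τ) ^ Module.finrank ℝ V ≤ 3 ^ n * (1 / τ) ^ n := by
    have h1 : (1 : ℝ) ≤ 1 + 2 * c / τ := by
      have : 0 ≤ 2 * c / τ := by positivity
      linarith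
    refine (pow_le_pow_right₀ h1 hrk).trans ?_
    rw [← mul_pow]
    refine pow_le_pow_left₀ (by linarith) ?_ n
    rw [mul_one_div (3 : ℝ), le_div_iff₀ hτ, add_mul, div_mul_cancel₀ _ hτ.ne']
    linarith
  calc ((fib Γ X W).card : ℝ) ≤ (4 * n + 5) ^ (2 * n) * (fib Γ (c * X) (c * W)).card := hA
    _ ≤ (4 * n + 5) ^ (2 * n) * ((1 + 2 * c / τ) ^ Module.finrank ℝ V *
        (fib Γ (τ * X) (τ * W)).card) := mul_le_mul_of_nonneg_left hB (by positivity)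
    _ ≤ (4 * n + 5) ^ (2 * n) * ((3 ^ n * (1 / τ) ^ n) * (fib Γ (τ * X) (τ * W)).card) := by
        gcongr
    _ = _ := by ring


lemma mem_Nct {n R e : ℕ} {α : Fin R → ℝ} {f : Fin R → MvPolynomial (Fin n) ℤ} {X : Fin e → ℝ}
    {W : ℝ} {h : Fin e → Fin n → ℤ} :
    h ∈ Nct α f X W ↔ (∀ s i, |(h s i : ℝ)| ≤ X s) ∧ ∀ j, nd (bet α f j h) ≤ W := by
  unfold Nct
  rw [Finset.mem_filter, Fintype.mem_piFinset]
  simp_rw [mem_bx]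

lemma Nct_fib {n R e : ℕ} (α : Fin R → ℝ) (f : Fin R → MvPolynomial (Fin n) ℤ) (X : Fin e → ℝ)
    (W : ℝ) (s : Fin e) :
    ((Nct α f X W).card : ℝ) =
      ∑ g ∈ Fintype.piFinset (Function.update (fun t => bx n (X t)) s {0}),
        ((fib (fun j i => bet α f j (Function.update g s (Pi.single i 1))) (X s) W).card : ℝ) := by
  classical
  have hm : ∀ h ∈ Nct α f X W, Function.update h s 0 ∈
      Fintype.piFinset (Function.update (fun t => bx n (X t)) s {0}) := by
    intro h hh
    rw [Fintype.mem_piFinset]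
    intro t
    by_cases ht : t = s
    · subst ht; simp
    · rw [Function.update_of_ne ht, Function.update_of_ne ht]
      exact mem_bx.2 ((mem_Nct.1 hh).1 t)
  rw [Finset.card_eq_sum_card_fiberwise hm]
  push_cast
  refine Finset.sum_congr rfl fun g hg => ?_
  rw [Fintype.mem_piFinset] at hg
  have hgs : g s = 0 := by
    have := hg s
    rw [Function.update_self, Finset.mem_singleton] at this
    exact this
  have hgt : ∀ t, t ≠ s → ∀ i, |(g t i : ℝ)| ≤ X t := by
    intro t ht
    have := hg t
    rw [Function.update_of_ne ht] at this
    exact mem_bx.1 this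
  congr 1
  refine Finset.card_nbij' (fun h => h s) (fun u => Function.update g s u) ?_ ?_ ?_ ?_
  · intro h hh
    obtain ⟨h1, h2⟩ := Finset.mem_filter.1 hh
    obtain ⟨h3, h4⟩ := mem_Nct.1 h1
    refine mem_fib.2 ⟨h3 s, fun j => ?_⟩
    rw [← bet_lin, ← h2, Function.update_idem, Function.update_eq_self]
    exact h4 j
  · intro u hu
    obtain ⟨h3, h4⟩ := mem_fib.1 hu
    show Function.update g s u ∈ _
    refine Finset.mem_coe.2 (Finset.mem_filter.2 ⟨mem_Nct.2 ⟨?_, ?_⟩, ?_⟩)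
    · intro t
      by_cases ht : t = s
      · subst ht; rw [Function.update_self]; exact h3
      · rw [Function.update_of_ne ht]; exact hgt t ht
    · intro j
      rw [bet_lin]
      exact h4 j
    · rw [Function.update_idem, ← hgs, Function.update_eq_self]
  · intro h hh
    obtain ⟨h1, h2⟩ := Finset.mem_filter.1 hh
    show Function.update g s (h s) = h
    rw [← h2, Function.update_idem, Function.update_eq_self]
  · intro u _
    show Function.update g s u s = u
    rw [Function.update_self]

lemma Nct_step {n R e : ℕ} (α : Fin R → ℝ) (f : Fin R → MvPolynomial (Fin n) ℤ) (X : Fin e → ℝ)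
    (W τ : ℝ) (s : Fin e) (hX : 0 < X s) (hW : 0 < W) (hXW : X s * W ≤ 1) (hτ : 0 < τ)
    (hτ1 : τ ≤ 1) :
    ((Nct α f X W).card : ℝ) ≤ ((4 * n + 5) ^ (2 * n) * 3 ^ n) * (1 / τ) ^ n *
      ((Nct α f (Function.update X s (τ * X s)) (τ * W)).card : ℝ) := by
  rw [Nct_fib α f X W s, Nct_fib α f _ (τ * W) s, Finset.mul_sum]
  have h1 : Function.update (fun t => bx n (Function.update X s (τ * X s) t)) s {0} =
      Function.update (fun t => bx n (X t)) s {0} := by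
    funext t
    by_cases ht : t = s
    · subst ht; simp
    · rw [Function.update_of_ne ht, Function.update_of_ne ht, Function.update_of_ne ht]
  rw [h1, Function.update_self]
  refine Finset.sum_le_sum fun g _ => ?_
  exact shrink _ (fun i j => bet_symm _ _ _ _ _ _) _ _ _ hX hW hXW hτ hτ1

lemma Nct_shrink {n R e : ℕ} (α : Fin R → ℝ) (f : Fin R → MvPolynomial (Fin n) ℤ)
    (X W τ : ℝ) (hX : 0 < X) (hW : 0 < W) (hXW : X * W ≤ 1) (hτ : 0 < τ) (hτ1 : τ ≤ 1) :
    ((Nct α f (fun _ : Fin e => X) W).card : ℝ) ≤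
      (((4 * n + 5) ^ (2 * n) * 3 ^ n) * (1 / τ) ^ n) ^ e *
      ((Nct α f (fun _ : Fin e => τ * X) (τ ^ e * W)).card : ℝ) := by
  have key : ∀ k : ℕ, k ≤ e → ((Nct α f (fun _ : Fin e => X) W).card : ℝ) ≤
      (((4 * n + 5) ^ (2 * n) * 3 ^ n) * (1 / τ) ^ n) ^ k *
      ((Nct α f (fun s : Fin e => if s.val < k then τ * X else X) (τ ^ k * W)).card : ℝ) := by
    intro k
    induction k with
    | zero => intro _; simp
    | succ k ih =>
      intro hk
      refine (ih (by omega)).trans ?_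
      have h1 := Nct_step α f (fun s : Fin e => if s.val < k then τ * X else X) (τ ^ k * W) τ
        ⟨k, hk⟩ (by simpa using hX) (by positivity)
        (by
          simp only [lt_irrefl, if_false]
          calc X * (τ ^ k * W) = τ ^ k * (X * W) := by ring
            _ ≤ 1 * 1 := mul_le_mul (pow_le_one₀ hτ.le hτ1) hXW (by positivity) zero_le_one
            _ = 1 := one_mul 1) hτ hτ1
      have h2 : Function.update (fun s : Fin e => if s.val < k then τ * X else X) ⟨k, hk⟩
          (τ * (fun s : Fin e => if s.val < k then τ * X else X) ⟨k, hk⟩) =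
          fun s : Fin e => if s.val < k + 1 then τ * X else X := by
        funext s
        by_cases hs : s = ⟨k, hk⟩
        · subst hs; simp
        · rw [Function.update_of_ne hs]
          have : s.val ≠ k := fun h => hs (Fin.ext h)
          have : s.val < k ↔ s.val < k + 1 := by omega
          simp only [this]
      rw [h2, ← mul_assoc τ, ← pow_succ'] at h1
      calc _ ≤ _ := mul_le_mul_of_nonneg_left h1 (by positivity)
        _ = _ := by ring
  have := key e le_rfl
  simpa using this


/-- simultaneous rational approximation -/
def Apx {R : ℕ} (Q w : ℝ) (α : Fin R → ℝ) : Prop :=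
  ∃ q : ℕ, 1 ≤ q ∧ (q : ℝ) ≤ Q ∧ ∃ a : Fin R → ℤ, ∀ i, |(q : ℝ) * α i - a i| ≤ w / 2

lemma apx_of_major {R d : ℕ} {Ct P θ : ℝ} {α : Fin R → ℝ} (z : Fin R → ℤ)
    (h : (fun i => α i + (z i : ℝ)) ∈ majorArcs R d Ct P θ) :
    Apx (Ct ^ R * P ^ ((R : ℝ) * ((d : ℝ) - 1) * θ))
      (Ct ^ (R - 1) * P ^ (-(d : ℝ) + (R : ℝ) * ((d : ℝ) - 1) * θ)) α := by
  unfold majorArcs at h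
  simp only [Set.mem_iUnion] at h
  obtain ⟨q, ⟨hq1, hq2⟩, a, _, h⟩ := h
  refine ⟨q, hq1, hq2, fun i => a i - q * z i, fun i => ?_⟩
  have hq0 : (0 : ℝ) < q := by exact_mod_cast hq1
  have := (Set.mem_univ_pi.1 h) i
  simp only [Set.mem_Icc] at this
  set w := Ct ^ (R - 1) * P ^ (-(d : ℝ) + (R : ℝ) * ((d : ℝ) - 1) * θ)
  obtain ⟨h1, h2⟩ := this
  have e1 : (a i : ℝ) / q * q = a i := div_mul_cancel₀ _ hq0.ne'
  have e2 : w / (2 * q) * q = w / 2 := by field_simp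
  have h1' := mul_le_mul_of_nonneg_right h1 hq0.le
  have h2' := mul_le_mul_of_nonneg_right h2 hq0.le
  rw [sub_mul, e1, e2] at h1'
  rw [add_mul (_ / _), e1, e2] at h2'
  push_cast
  rw [abs_le]
  constructor <;> nlinarith

lemma major_of_apx {R d : ℕ} {Ct P θ : ℝ} (hCt : 0 ≤ Ct) (hP : 0 ≤ P) {α : Fin R → ℝ}
    (h : Apx (Ct ^ R * P ^ ((R : ℝ) * ((d : ℝ) - 1) * θ))
      (Ct ^ (R - 1) * P ^ (-(d : ℝ) + (R : ℝ) * ((d : ℝ) - 1) * θ)) α) :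
    ∃ z : Fin R → ℤ, (fun i => α i + (z i : ℝ)) ∈ majorArcs R d Ct P θ := by
  obtain ⟨q, hq1, hq2, a, ha⟩ := h
  set w := Ct ^ (R - 1) * P ^ (-(d : ℝ) + (R : ℝ) * ((d : ℝ) - 1) * θ) with hw
  have hw0 : 0 ≤ w := by positivity
  let G : ℕ := Int.gcd (Finset.univ.gcd a) (q : ℤ)
  have hG0 : 0 < G := Int.gcd_pos_of_ne_zero_right _ (by exact_mod_cast (by omega : q ≠ 0))
  have hGq : G ∣ q := by
    have : (G : ℤ) ∣ (q : ℤ) := Int.gcd_dvd_right ..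
    exact_mod_cast this
  have hGa : ∀ i, (G : ℤ) ∣ a i := fun i =>
    (Int.gcd_dvd_left ..).trans (Finset.gcd_dvd (Finset.mem_univ i))
  obtain ⟨q', hq'⟩ := hGq
  choose a' ha' using hGa
  have hq'0 : 0 < q' := by
    rcases Nat.eq_zero_or_pos q' with h | h
    · subst h; omega
    · exact h
  have hq'z : (0 : ℤ) < q' := by exact_mod_cast hq'0
  have hq'r : (0 : ℝ) < q' := by exact_mod_cast hq'0
  have hGr : (1 : ℝ) ≤ G := by exact_mod_cast hG0
  refine ⟨fun i => -((a' i - 1) / q'), ?_⟩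
  unfold majorArcs
  simp only [Set.mem_iUnion]
  refine ⟨q', ⟨hq'0, ?_⟩, fun i => (a' i - 1) % q' + 1, ⟨?_, ?_⟩, ?_⟩
  · refine le_trans ?_ hq2
    rw [hq']; push_cast
    nlinarith
  · intro i
    have h1 := Int.emod_nonneg (a' i - 1) hq'z.ne'
    have h2 := Int.emod_lt_of_pos (a' i - 1) hq'z
    show 1 ≤ (a' i - 1) % q' + 1 ∧ (a' i - 1) % q' + 1 ≤ q'
    constructor <;> omega
  · set D : ℕ := Int.gcd (Finset.univ.gcd fun i => (a' i - 1) % q' + 1) (q' : ℤ) with hD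
    have d1 : (D : ℤ) ∣ q' := Int.gcd_dvd_right ..
    have d2 : ∀ i, (D : ℤ) ∣ a' i := by
      intro i
      have h1 : (D : ℤ) ∣ (a' i - 1) % q' + 1 :=
        (Int.gcd_dvd_left ..).trans (Finset.gcd_dvd (Finset.mem_univ i))
      have h2 := Int.emod_add_mul_ediv (a' i - 1) q'
      have h3 : a' i = ((a' i - 1) % q' + 1) + q' * ((a' i - 1) / q') := by linarith
      rw [h3]
      exact dvd_add h1 (d1.mul_right _)
    have d3 : ((G * D : ℕ) : ℤ) ∣ (G : ℤ) := by
      refine Int.dvd_coe_gcd (Finset.dvd_gcd fun i _ => ?_) ?_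
      · rw [ha' i]; push_cast; exact mul_dvd_mul_left _ (d2 i)
      · rw [hq']; push_cast; exact mul_dvd_mul_left _ d1
    have d4 : G * D ∣ G * 1 := by rw [mul_one]; exact_mod_cast d3
    exact Nat.dvd_one.1 (Nat.dvd_of_mul_dvd_mul_left hG0 d4)
  · unfold majorArc
    rw [Set.mem_univ_pi]
    intro i
    have h1 := ha i
    rw [hq', ha' i] at h1
    push_cast at h1
    have h1a : |(q' : ℝ) * α i - a' i| ≤ w / 2 := by
      have : (G : ℝ) * q' * α i - G * a' i = G * (q' * α i - a' i) := by ring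
      rw [this, abs_mul, abs_of_pos (by linarith)] at h1
      nlinarith [abs_nonneg ((q' : ℝ) * α i - a' i)]
    have h2 := Int.emod_add_mul_ediv (a' i - 1) q'
    have h3 : (a' i : ℝ) = (((a' i - 1) % q' : ℤ) : ℝ) + 1 + q' * (((a' i - 1) / q' : ℤ) : ℝ) := by
      have : a' i = ((a' i - 1) % q' + 1) + q' * ((a' i - 1) / q') := by linarith
      exact_mod_cast this
    rw [abs_le] at h1a
    simp only [Set.mem_Icc]
    rw [← hw]
    have e1 : ∀ x y : ℝ, x / q' - y / (2 * q') = (x - y / 2) / q' := by intro x y; field_simp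
    have e2 : ∀ x y : ℝ, x / q' + y / (2 * q') = (x + y / 2) / q' := by intro x y; field_simp
    rw [e1, e2, div_le_iff₀ hq'r, le_div_iff₀ hq'r]
    push_cast
    constructor <;> nlinarith

lemma minor_iff {R d : ℕ} {Ct P θ : ℝ} (hCt : 0 ≤ Ct) (hP : 0 ≤ P) {α : Fin R → ℝ} :
    α ∈ minorArcs R d Ct P θ ↔ (∀ i, 0 ≤ α i ∧ α i ≤ 1) ∧
      ¬ Apx (Ct ^ R * P ^ ((R : ℝ) * ((d : ℝ) - 1) * θ))
      (Ct ^ (R - 1) * P ^ (-(d : ℝ) + (R : ℝ) * ((d : ℝ) - 1) * θ)) α := by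
  unfold minorArcs
  constructor
  · rintro ⟨h1, h2⟩
    refine ⟨h1, fun h => ?_⟩
    obtain ⟨z, hz⟩ := major_of_apx hCt hP h
    exact h2 z hz
  · rintro ⟨h1, h2⟩
    exact ⟨h1, fun z hz => h2 (apx_of_major z hz)⟩

lemma indep_or_orth {R : ℕ} (Z : Set (Fin R → ℤ)) :
    (∃ A : Matrix (Fin R) (Fin R) ℤ, A.det ≠ 0 ∧ ∀ k, A k ∈ Z) ∨
    ∃ b : Fin R → ℤ, b ≠ 0 ∧ ∀ y ∈ Z, ∑ i, b i * y i = 0 := by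
  classical
  let cst : (Fin R → ℤ) → (Fin R → ℚ) := fun y i => (y i : ℚ)
  let V := Submodule.span ℚ (cst '' Z)
  by_cases hV : V = ⊤
  · left
    obtain ⟨b, hb1, hb2, hb3⟩ := exists_linearIndependent ℚ (cst '' Z)
    have hsp : (⊤ : Submodule ℚ (Fin R → ℚ)) ≤ Submodule.span ℚ (Set.range ((↑) : b → Fin R → ℚ)) := by
      rw [Subtype.range_coe, hb2]; exact hV.ge
    let B := Module.Basis.mk hb3 hsp
    have : Fintype b := FiniteDimensional.fintypeBasisIndex B
    have hcard : Fintype.card b = Fintype.card (Fin R) := by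
      rw [← Module.finrank_eq_card_basis B, Module.finrank_fin_fun, Fintype.card_fin]
    let eqv : Fin R ≃ b := (Fintype.equivOfCardEq hcard).symm
    have hmem : ∀ k, ∃ y ∈ Z, cst y = (eqv k : Fin R → ℚ) := fun k => hb1 (eqv k).2
    choose A hAZ hA using hmem
    refine ⟨Matrix.of A, ?_, hAZ⟩
    have hli : LinearIndependent ℚ (fun k => cst (A k)) := by
      have : (fun k => cst (A k)) = ((↑) : b → Fin R → ℚ) ∘ eqv := by
        funext k; exact hA k
      rw [this]
      exact hb3.comp _ eqv.injective
    have hu : IsUnit ((Matrix.of A).map (Int.castRingHom ℚ)) :=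
      Matrix.linearIndependent_rows_iff_isUnit.1 hli
    rw [Matrix.isUnit_iff_isUnit_det] at hu
    intro h0
    have : ((Matrix.of A).map (Int.castRingHom ℚ)).det = 0 := by
      rw [← RingHom.mapMatrix_apply, ← RingHom.map_det, h0, map_zero]
    rw [this] at hu
    exact not_isUnit_zero hu
  · right
    obtain ⟨φ, hφ, hle⟩ := Submodule.exists_le_ker_of_lt_top V (lt_top_iff_ne_top.2 hV)
    let r : Fin R → ℚ := fun i => φ (Pi.single i 1)
    have hφr : ∀ x : Fin R → ℚ, φ x = ∑ i, r i * x i := by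
      intro x
      rw [LinearMap.pi_apply_eq_sum_univ φ x]
      refine Finset.sum_congr rfl fun i _ => ?_
      rw [smul_eq_mul, mul_comm]
      congr 2
      funext j
      simp [Pi.single_apply, eq_comm]
    obtain ⟨⟨D, hD⟩, hDr⟩ := IsLocalization.exist_integer_multiples_of_finite (nonZeroDivisors ℤ) r
    choose b hb using hDr
    have hD0 : D ≠ 0 := nonZeroDivisors.ne_zero hD
    have hb' : ∀ i, (b i : ℚ) = D * r i := by
      intro i
      have := hb i
      simpa using this
    refine ⟨b, ?_, ?_⟩
    · intro hb0
      apply hφ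
      ext i
      have h1 := hb' i
      rw [hb0] at h1
      have h2 : r i = 0 := by
        have : (D : ℚ) ≠ 0 := by exact_mod_cast hD0
        simpa [this] using h1.symm
      simpa [r] using h2
    · intro y hy
      have h1 : cst y ∈ LinearMap.ker φ := hle (Submodule.subset_span ⟨y, hy, rfl⟩)
      rw [LinearMap.mem_ker, hφr] at h1
      have h2 : ((∑ i, b i * y i : ℤ) : ℚ) = D * ∑ i, r i * cst y i := by
        push_cast
        rw [Finset.mul_sum]
        refine Finset.sum_congr rfl fun i _ => ?_
        rw [hb' i, mul_assoc]
      rw [h1, mul_zero] at h2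
      exact_mod_cast h2

lemma apx_of_det {r : ℕ} (A : Matrix (Fin (r + 1)) (Fin (r + 1)) ℤ) (hA : A.det ≠ 0)
    (α : Fin (r + 1) → ℝ) (B ω : ℝ) (hB : ∀ k i, |(A k i : ℝ)| ≤ B)
    (hω : ∀ k, nd (∑ i, α i * (A k i : ℝ)) ≤ ω) :
    Apx ((r + 1).factorial * B ^ (r + 1)) (2 * ((r + 1).factorial * B ^ r * ω)) α := by
  have hB0 : 0 ≤ B := (abs_nonneg _).trans (hB 0 0)
  have hω0 : 0 ≤ ω := (abs_nonneg _).trans (hω 0)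
  let A' : Matrix (Fin (r + 1)) (Fin (r + 1)) ℝ := A.map (Int.castRingHom ℝ)
  have hA' : A'.det = (A.det : ℝ) := by
    show (A.map (Int.castRingHom ℝ)).det = _
    rw [← RingHom.mapMatrix_apply, ← RingHom.map_det]; rfl
  have hadj : ∀ i k, A'.adjugate i k = (A.adjugate i k : ℝ) := by
    intro i k
    show (A.map (Int.castRingHom ℝ)).adjugate i k = _
    rw [← RingHom.mapMatrix_apply, ← RingHom.map_adjugate]; rfl
  let m : Fin (r + 1) → ℤ := fun k => round (∑ i, α i * (A k i : ℝ))
  have hdet : ∀ i, (A.det : ℝ) * α i = ∑ k, (A.adjugate i k : ℝ) * (∑ i, α i * (A k i : ℝ)) := by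
    intro i
    have h1 : (A'.adjugate * A').mulVec α = A'.det • α := by
      rw [Matrix.adjugate_mul, Matrix.smul_mulVec, Matrix.one_mulVec]
    rw [← Matrix.mulVec_mulVec] at h1
    have h2 := congrFun h1 i
    rw [Pi.smul_apply, smul_eq_mul, hA'] at h2
    rw [← h2]
    simp only [Matrix.mulVec, dotProduct]
    refine Finset.sum_congr rfl fun k _ => ?_
    rw [hadj]
    congr 1
    refine Finset.sum_congr rfl fun i _ => ?_
    rw [mul_comm]; rfl
  have hadjB : ∀ i k, |(A.adjugate i k : ℝ)| ≤ r.factorial * B ^ r := by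
    intro i k
    rw [← hadj, Matrix.adjugate_fin_succ_eq_det_submatrix, abs_mul, abs_pow, abs_neg, abs_one,
      one_pow, one_mul]
    have := Matrix.det_le (A := A'.submatrix k.succAbove i.succAbove)
      (abv := AbsoluteValue.abs) (x := B) (fun a b => hB _ _)
    simpa [nsmul_eq_mul] using this
  have hdetB : |(A.det : ℝ)| ≤ (r + 1).factorial * B ^ (r + 1) := by
    rw [← hA']
    have := Matrix.det_le (A := A') (abv := AbsoluteValue.abs) (x := B) (fun a b => hB _ _)
    simpa [nsmul_eq_mul] using this
  have herr : ∀ i, |(A.det : ℝ) * α i - ((∑ k, A.adjugate i k * m k : ℤ) : ℝ)| ≤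
      (r + 1).factorial * B ^ r * ω := by
    intro i
    rw [hdet i]
    push_cast
    rw [← Finset.sum_sub_distrib]
    refine (Finset.abs_sum_le_sum_abs _ _).trans ?_
    refine (Finset.sum_le_card_nsmul _ _ (r.factorial * B ^ r * ω) ?_).trans (le_of_eq ?_)
    · intro k _
      rw [← mul_sub, abs_mul]
      exact mul_le_mul (hadjB i k) (hω k) (abs_nonneg _) (by positivity)
    · rw [Finset.card_univ, Fintype.card_fin, nsmul_eq_mul, Nat.factorial_succ]
      push_cast; ring
  refine ⟨A.det.natAbs, Int.natAbs_pos.2 hA, ?_, fun i => A.det.sign * ∑ k, A.adjugate i k * m k, ?_⟩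
  · rw [Nat.cast_natAbs, Int.cast_abs]; exact hdetB
  · intro i
    have h1 : ((A.det.natAbs : ℕ) : ℝ) = A.det.sign * A.det := by
      rw [← Int.cast_mul, Int.sign_mul_self_eq_abs, Nat.cast_natAbs]
    have h2 : ((A.det.natAbs : ℕ) : ℝ) * α i - ((A.det.sign * ∑ k, A.adjugate i k * m k : ℤ) : ℝ) =
        (A.det.sign : ℝ) * ((A.det : ℝ) * α i - ((∑ k, A.adjugate i k * m k : ℤ) : ℝ)) := by
      rw [h1]; push_cast; ring
    rw [h2, abs_mul]
    have h3 : |(A.det.sign : ℝ)| = 1 := by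
      rcases lt_or_gt_of_ne hA with h | h
      · rw [Int.sign_eq_neg_one_of_neg h]; simp
      · rw [Int.sign_eq_one_of_pos h]; simp
    rw [h3, one_mul, mul_div_cancel_left₀ _ (two_ne_zero)]
    exact herr i


lemma count_orth (n e Δ R : ℕ) : ∃ C0 : ℕ, ∀ (f : Fin R → MvPolynomial (Fin n) ℤ),
    birchDelta n R (fun i => homogeneousComponent (e + 2) (f i)) ≤ ((Δ : ℕ∞) : WithBot ℕ∞) →
    ∀ b : Fin R → ℤ, b ≠ 0 → ∀ Y : ℝ, 1 ≤ Y →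
    ∀ S : Finset (Fin (e + 1) → Fin n → ℤ), (∀ h ∈ S, ∀ s i, |(h s i : ℝ)| ≤ Y) →
    (∀ h ∈ S, ∀ j, ∑ i, b i * Phi (f i) j h = 0) →
    (S.card : ℝ) ≤ C0 * Y ^ (e * n + Δ) := by
  obtain ⟨C0, hC0⟩ := count_E n e Δ
  refine ⟨C0, fun f hΔ b hb Y hY S hS1 hS2 => ?_⟩
  have h1 := hC0 (MvPolynomial.map (Int.castRingHom Qbar)
    (∑ i, b i • homogeneousComponent (e + 2) (f i))) ?_ ?_ ⌊Y⌋₊ ?_ S ?_ ?_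
  · calc (S.card : ℝ) ≤ ((C0 * ⌊Y⌋₊ ^ (e * n + Δ) : ℕ) : ℝ) := by exact_mod_cast h1
      _ = C0 * (⌊Y⌋₊ : ℝ) ^ (e * n + Δ) := by push_cast; rfl
      _ ≤ _ := by
        gcongr
        exact Nat.floor_le (by linarith)
  · refine IsHomogeneous.map ?_ _
    refine IsHomogeneous.sum _ _ _ fun i _ => ?_
    rw [zsmul_eq_mul]
    have := (isHomogeneous_C (Fin n) (b i)).mul (homogeneousComponent_isHomogeneous (e + 2) (f i))
    rw [zero_add] at this
    simpa using this
  · refine le_trans ?_ hΔ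
    unfold birchDelta
    exact le_iSup₂ (f := fun (b : Fin R → ℤ) (_ : b ≠ 0) => singDim n
      (MvPolynomial.map (Int.castRingHom Qbar) (∑ i, b i • homogeneousComponent (e + 2) (f i)))) b hb
  · exact Nat.one_le_floor_iff _ |>.2 hY
  · intro h hh s i
    have h2 := hS1 h hh s i
    have h3 : ((|h s i|.toNat : ℕ) : ℝ) ≤ Y := by
      have : ((|h s i|.toNat : ℕ) : ℤ) = |h s i| := Int.toNat_of_nonneg (abs_nonneg _)
      have h4 : ((|h s i|.toNat : ℕ) : ℝ) = ((|h s i| : ℤ) : ℝ) := by exact_mod_cast congrArg (Int.cast (R := ℝ)) this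
      rw [h4]; push_cast; exact h2
    have h5 := Nat.le_floor h3
    have : ((|h s i|.toNat : ℕ) : ℤ) = |h s i| := Int.toNat_of_nonneg (abs_nonneg _)
    rw [← this]
    exact_mod_cast h5
  · intro h hh j
    have h2 := Phi_map (Int.castRingHom Qbar) (∑ i, b i • homogeneousComponent (e + 2) (f i)) j h
    have h3 : (fun s i => ((h s i : ℤ) : Qbar)) = fun s i => (Int.castRingHom Qbar) (h s i) := rfl
    rw [h3, h2, Phi_sum]
    have h4 : ∑ i, Phi (b i • homogeneousComponent (e + 2) (f i)) j h = 0 := by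
      rw [← hS2 h hh j]
      exact Finset.sum_congr rfl fun i _ => by rw [Phi_smul, Phi_hc]
    rw [h4, map_zero]

/-- the constant `c₁` -/
def cOne (n e : ℕ) : ℝ := (n : ℝ) ^ (e + 1) * (((e + 1 : ℕ) : ℝ) + 1) ^ (e + 1 + 1)

lemma one_le_cOne {n : ℕ} (e : ℕ) (hn : 0 < n) : 1 ≤ cOne n e := by
  unfold cOne
  have h1 : (1 : ℝ) ≤ n := by exact_mod_cast hn
  have h2 : (1 : ℝ) ≤ ((e + 1 : ℕ) : ℝ) + 1 := by
    have : (0 : ℝ) ≤ ((e + 1 : ℕ) : ℝ) := Nat.cast_nonneg _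
    linarith
  exact one_le_mul_of_one_le_of_one_le (one_le_pow₀ h1) (one_le_pow₀ h2)

/-- the constant `ρ` -/
def rho (n r e : ℕ) : ℝ := 1 / (2 * (r + 1).factorial * cOne n e)

lemma rho_pos {n : ℕ} (r e : ℕ) (hn : 0 < n) : 0 < rho n r e := by
  have := one_le_cOne e hn
  have h2 : (0 : ℝ) < (r + 1).factorial := by exact_mod_cast Nat.factorial_pos _
  unfold rho; positivity

lemma rho_mul {n : ℕ} (r e : ℕ) (hn : 0 < n) :
    (r + 1).factorial * (cOne n e * rho n r e) = 1 / 2 := by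
  have := one_le_cOne e hn
  have h2 : (0 : ℝ) < (r + 1).factorial := by exact_mod_cast Nat.factorial_pos _
  unfold rho; field_simp

lemma Nct_small (n e Δ r : ℕ) (hn : 0 < n) : ∃ C1 : ℝ, 1 ≤ C1 ∧
    ∀ (f : Fin (r + 1) → MvPolynomial (Fin n) ℤ),
    birchDelta n (r + 1) (fun i => homogeneousComponent (e + 2) (f i)) ≤
      ((Δ : ℕ∞) : WithBot ℕ∞) →
    ∀ Ct : ℝ, 1 ≤ Ct → (∀ i (m : Fin n →₀ ℕ), m.degree = e + 2 →
      |((coeff m (f i) : ℤ) : ℝ)| ≤ Ct) →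
    ∀ P M θ : ℝ, 1 ≤ P → P ≤ M → 0 < θ → θ ≤ 1 →
    ∀ α ∈ minorArcs (r + 1) (e + 2) Ct P θ,
    ((Nct α f (fun _ : Fin (e + 1) => rho n r e * P ^ θ)
      ((rho n r e * P ^ θ / (2 * M)) ^ (e + 1) * (1 / (2 * M)))).card : ℝ) ≤
      C1 * (rho n r e * P ^ θ) ^ (e * n + Δ) := by
  obtain ⟨C0, hC0⟩ := count_orth n e Δ (r + 1)
  have hρ := rho_pos r e hn
  have hc1 := one_le_cOne e hn
  have hfac : (1 : ℝ) ≤ (r + 1).factorial := by exact_mod_cast Nat.factorial_pos _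
  have hρm := rho_mul r e hn
  have hcρ : cOne n e * rho n r e ≤ 1 := by
    have : 0 < cOne n e * rho n r e := by positivity
    nlinarith
  have hρ1 : rho n r e ≤ 1 := by nlinarith
  have hfρ : (r + 1).factorial * rho n r e ≤ 1 / 2 := by
    rw [← hρm]
    have : 0 ≤ (r + 1).factorial * rho n r e := by positivity
    nlinarith
  refine ⟨C0 + 1 + (1 / rho n r e) ^ (e * n + Δ), ?_, ?_⟩
  · have : 0 ≤ (1 / rho n r e) ^ (e * n + Δ) := by positivity
    have : (0 : ℝ) ≤ C0 := by positivity
    linarith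
  intro f hΔ Ct hCt hcoef P M θ hP hPM hθ hθ1 α hα
  have hP0 : 0 < P := by linarith
  have hM0 : 0 < M := by linarith
  set ρ := rho n r e with hρdef
  set Y := ρ * P ^ θ with hY
  have hPθ : 1 ≤ P ^ θ := Real.one_le_rpow hP hθ.le
  have hY0 : 0 < Y := by positivity
  have hρY : ρ ≤ Y := by rw [hY]; nlinarith
  set ω := (Y / (2 * M)) ^ (e + 1) * (1 / (2 * M)) with hω
  by_cases hY1 : Y < 1
  · -- only the zero vector
    have h1 : (Nct α f (fun _ : Fin (e + 1) => Y) ω).card ≤ 1 := by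
      rw [Finset.card_le_one]
      intro a ha b hb
      have z : ∀ h ∈ Nct α f (fun _ : Fin (e + 1) => Y) ω, h = 0 := by
        intro h hh
        funext s i
        have h2 := ((mem_Nct.1 hh).1 s i).trans_lt hY1
        have h3 : |h s i| < 1 := by exact_mod_cast h2
        exact Int.abs_lt_one_iff.1 h3
      rw [z a ha, z b hb]
    have h2 : (1 : ℝ) ≤ (1 / ρ) ^ (e * n + Δ) * Y ^ (e * n + Δ) := by
      rw [← mul_pow]
      refine one_le_pow₀ ?_
      rw [one_div_mul_eq_div, le_div_iff₀ hρ]; linarith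
    have h3 : (0 : ℝ) ≤ (C0 + 1) * Y ^ (e * n + Δ) := by positivity
    calc ((Nct α f (fun _ : Fin (e + 1) => Y) ω).card : ℝ) ≤ 1 := by exact_mod_cast h1
      _ ≤ _ := by rw [add_mul]; linarith
  push Not at hY1
  have hred : ∀ b : Fin (r + 1) → ℤ, b ≠ 0 →
      (∀ h ∈ Nct α f (fun _ : Fin (e + 1) => Y) ω, ∀ j, ∑ i, b i * Phi (f i) j h = 0) →
      ((Nct α f (fun _ : Fin (e + 1) => Y) ω).card : ℝ) ≤
        (C0 + 1 + (1 / ρ) ^ (e * n + Δ)) * Y ^ (e * n + Δ) := by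
    intro b hb h
    refine (hC0 f hΔ b hb Y hY1 _ (fun h hh => (mem_Nct.1 hh).1) h).trans ?_
    refine mul_le_mul_of_nonneg_right ?_ (by positivity)
    have : 0 ≤ (1 / ρ) ^ (e * n + Δ) := by positivity
    linarith
  rcases indep_or_orth {y : Fin (r + 1) → ℤ | ∃ h ∈ Nct α f (fun _ : Fin (e + 1) => Y) ω, ∃ j,
      y = fun i => Phi (f i) j h} with ⟨A, hA0, hA⟩ | ⟨b, hb, hb2⟩
  · exfalso
    have hmin := ((minor_iff (by linarith) hP0.le).1 hα).2
    apply hmin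
    have hB : ∀ k i, |(A k i : ℝ)| ≤ cOne n e * Ct * Y ^ (e + 1) := by
      intro k i
      obtain ⟨h, hh, j, hy⟩ := hA k
      rw [hy]
      exact Phi_bound (f i) Ct (hcoef i) j h Y (mem_Nct.1 hh).1
    have hW : ∀ k, nd (∑ i, α i * (A k i : ℝ)) ≤ ω := by
      intro k
      obtain ⟨h, hh, j, hy⟩ := hA k
      rw [hy]
      exact (mem_Nct.1 hh).2 j
    obtain ⟨q, hq1, hq2, a, ha⟩ := apx_of_det A hA0 α _ ω hB hW
    have hYe : Y ^ (e + 1) ≤ ρ * P ^ (((e + 1 : ℕ) : ℝ) * θ) := by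
      rw [hY, mul_pow, ← Real.rpow_mul_natCast hP0.le, mul_comm θ]
      refine mul_le_mul_of_nonneg_right ?_ (by positivity)
      calc ρ ^ (e + 1) ≤ ρ ^ 1 := pow_le_pow_of_le_one hρ.le hρ1 (by omega)
        _ = ρ := pow_one _
    set Z := P ^ (((e + 1 : ℕ) : ℝ) * θ) with hZ
    have hZ0 : 0 < Z := by positivity
    have hBle : cOne n e * Ct * Y ^ (e + 1) ≤ (cOne n e * ρ) * (Ct * Z) := by
      calc _ ≤ cOne n e * Ct * (ρ * Z) := mul_le_mul_of_nonneg_left hYe (by positivity)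
        _ = _ := by ring
    have hB0 : 0 ≤ cOne n e * Ct * Y ^ (e + 1) := by positivity
    have hBle2 : cOne n e * Ct * Y ^ (e + 1) ≤ Ct * Z := hBle.trans (by
      have : 0 ≤ Ct * Z := by positivity
      nlinarith)
    refine ⟨q, hq1, hq2.trans ?_, a, fun i => (ha i).trans ?_⟩
    · have e1 : P ^ (((r + 1 : ℕ) : ℝ) * (((e + 2 : ℕ) : ℝ) - 1) * θ) = Z ^ (r + 1) := by
        rw [hZ, ← Real.rpow_mul_natCast hP0.le]
        congr 1; push_cast; ring
      rw [e1, ← mul_pow, pow_succ, pow_succ (Ct * Z)]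
      calc (r + 1).factorial * ((cOne n e * Ct * Y ^ (e + 1)) ^ r * (cOne n e * Ct * Y ^ (e + 1)))
          ≤ (r + 1).factorial * ((Ct * Z) ^ r * ((cOne n e * ρ) * (Ct * Z))) := by gcongr
        _ = ((r + 1).factorial * (cOne n e * ρ)) * ((Ct * Z) ^ r * (Ct * Z)) := by ring
        _ ≤ 1 * ((Ct * Z) ^ r * (Ct * Z)) := by
          refine mul_le_mul_of_nonneg_right ?_ (by positivity)
          rw [hρm]; norm_num
        _ = _ := one_mul _
    · rw [mul_div_cancel_left₀ _ (two_ne_zero)]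
      have e1 : P ^ (-((e + 2 : ℕ) : ℝ) + ((r + 1 : ℕ) : ℝ) * (((e + 2 : ℕ) : ℝ) - 1) * θ) =
          Z ^ r * (Z * (1 / P ^ (e + 2))) := by
        rw [hZ, ← Real.rpow_mul_natCast hP0.le, one_div, ← Real.rpow_natCast P (e + 2),
          ← Real.rpow_neg hP0.le, ← Real.rpow_add hP0, ← Real.rpow_add hP0]
        congr 1; push_cast; ring
      have hωle : ω ≤ ρ * Z * (1 / P ^ (e + 2)) := by
        rw [hω, div_pow, div_mul_div_comm, mul_one, ← pow_succ, mul_one_div]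
        have : P ≤ 2 * M := by linarith
        gcongr
      have hω0 : 0 ≤ ω := by positivity
      rw [e1, Nat.add_sub_cancel]
      calc (r + 1).factorial * (cOne n e * Ct * Y ^ (e + 1)) ^ r * ω
          ≤ (r + 1).factorial * (Ct * Z) ^ r * (ρ * Z * (1 / P ^ (e + 2))) := by gcongr
        _ = ((r + 1).factorial * ρ) * ((Ct * Z) ^ r * (Z * (1 / P ^ (e + 2)))) := by ring
        _ ≤ 1 / 2 * ((Ct * Z) ^ r * (Z * (1 / P ^ (e + 2)))) := by
          exact mul_le_mul_of_nonneg_right hfρ (by positivity)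
        _ = _ := by rw [mul_pow]; ring
  · exact hred b hb fun h hh j => hb2 _ ⟨h, hh, j, rfl⟩


lemma card_bx_le (n M : ℕ) (hM : 1 ≤ M) : ((bx n (M : ℝ)).card : ℝ) ≤ (3 * M) ^ n := by
  have h1 : (bx n (M : ℝ)).card = (2 * M + 1) ^ n := by
    unfold bx
    rw [Pi.card_Icc]
    simp only [Int.floor_natCast, Int.card_Icc, Finset.prod_const, Finset.card_univ,
      Fintype.card_fin]
    congr 1
    omega
  rw [h1]
  push_cast
  have : (1 : ℝ) ≤ M := by exact_mod_cast hM
  exact pow_le_pow_left₀ (by positivity) (by linarith) n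

set_option maxHeartbeats 2000000 in
lemma weyl_main (n e Δ r : ℕ) (hn : 0 < n) (ε : ℝ) (hε : 0 < ε) : ∃ C2 : ℝ, 0 < C2 ∧
    ∀ (f : Fin (r + 1) → MvPolynomial (Fin n) ℤ), (∀ i, (f i).totalDegree ≤ e + 2) →
    birchDelta n (r + 1) (fun i => homogeneousComponent (e + 2) (f i)) ≤
      ((Δ : ℕ∞) : WithBot ℕ∞) →
    ∀ (aB bB : Fin n → ℝ), (∀ j, bB j - aB j < 1) →
    ∀ Ct : ℝ, 1 ≤ Ct → (∀ i (m : Fin n →₀ ℕ), m.degree = e + 2 →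
      |((coeff m (f i) : ℤ) : ℝ)| ≤ Ct) →
    ∀ P θ : ℝ, 2 ≤ P → 0 < θ → θ ≤ 1 →
    ∀ α ∈ minorArcs (r + 1) (e + 2) Ct P θ,
    ‖Sexp f aB bB P α‖ ≤ C2 * P ^ ((n : ℝ) - ((n : ℝ) - Δ) / 2 ^ (e + 1) * θ + ε) := by
  obtain ⟨C1, hC1, hN⟩ := Nct_small n e Δ r hn
  have hρ := rho_pos r e hn
  obtain ⟨ρ, hρdef⟩ : ∃ ρ, ρ = rho n r e := ⟨_, rfl⟩
  rw [← hρdef] at hρ hN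
  obtain ⟨N, hNdef⟩ : ∃ N : ℕ, N = 2 ^ (e + 1) := ⟨_, rfl⟩
  have hNlt : e + 1 < N := hNdef ▸ Nat.lt_two_pow_self
  obtain ⟨k, hk⟩ : ∃ k, N = k + (e + 2) := ⟨N - (e + 2), by omega⟩
  have hk' : N - (e + 1) - 1 = k := by omega
  have hn' : (0 : ℝ) < n := by exact_mod_cast hn
  have hNr : (0 : ℝ) < N := by exact_mod_cast (by omega : 0 < N)
  obtain ⟨ε', hε'⟩ : ∃ ε', ε' = (N : ℝ) * ε / n := ⟨_, rfl⟩
  have hε'0 : 0 < ε' := by rw [hε']; positivity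
  obtain ⟨Cl, hCl⟩ : ∃ Cl, Cl = 2 + (4 : ℝ) ^ ε' / ε' := ⟨_, rfl⟩
  have hCl0 : 0 < Cl := by rw [hCl]; positivity
  obtain ⟨Cn, hCn⟩ : ∃ Cn : ℝ, Cn = (4 * n + 5) ^ (2 * n) * 3 ^ n := ⟨_, rfl⟩
  have hCn0 : 0 < Cn := by rw [hCn]; positivity
  obtain ⟨K0, hK0⟩ : ∃ K0 : ℝ, K0 = 6 ^ (n * k) * (8 * Cl) ^ n * (Cn * 4 ^ n) ^ (e + 1) * C1 *
    (ρ ^ Δ / ρ ^ n) := ⟨_, rfl⟩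
  have hK00 : 0 < K0 := by rw [hK0]; positivity
  refine ⟨1 + K0, by positivity, ?_⟩
  intro f hf hΔ aB bB hab Ct hCt hcoef P θ hP hθ hθ1 α hα
  have hP0 : 0 < P := by linarith
  obtain ⟨M, hMdef⟩ : ∃ M, M = ⌈P⌉₊ := ⟨_, rfl⟩
  have hPM : P ≤ M := by rw [hMdef]; exact Nat.le_ceil P
  have hMP : (M : ℝ) ≤ 2 * P := by
    have := Nat.ceil_lt_add_one hP0.le
    rw [← hMdef] at this
    linarith
  have hM1 : 1 ≤ M := Nat.one_le_iff_ne_zero.2 (by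
    intro h; rw [h] at hPM; norm_num at hPM; linarith)
  have hM0 : (0 : ℝ) < M := by linarith
  obtain ⟨Y, hY⟩ : ∃ Y, Y = ρ * P ^ θ := ⟨_, rfl⟩
  have hPθ : P ^ θ ≤ P := by
    calc P ^ θ ≤ P ^ (1 : ℝ) := Real.rpow_le_rpow_of_exponent_le (by linarith) hθ1
      _ = P := Real.rpow_one P
  have hY0 : 0 < Y := by rw [hY]; positivity
  have hρ1 : ρ ≤ 1 := by
    have h1 := rho_mul r e hn
    have h2 := one_le_cOne e hn
    have h3 : (1 : ℝ) ≤ (r + 1).factorial := by exact_mod_cast Nat.factorial_pos _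
    rw [← hρdef] at h1
    have : cOne n e * ρ ≤ 1 := by
      have : 0 < cOne n e * ρ := by positivity
      nlinarith
    nlinarith
  have hYM : Y / (2 * M) ≤ 1 := by
    rw [div_le_one (by positivity)]
    have : 0 < P ^ θ := by positivity
    rw [hY]
    nlinarith
  have hS : Sexp f aB bB P α = Tsum (fun j => ⌈P * aB j⌉) (fun j => ⌊P * bB j⌋)
      (fun x => ∑ i, α i * ((eval x (f i) : ℤ) : ℝ)) := rfl
  have hW := weyl_N0 α f hf M hM1 (fun j => ⌈P * aB j⌉) (fun j => ⌊P * bB j⌋) (by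
    intro i
    have h1 := Int.floor_le (P * bB i)
    have h2 := Int.le_ceil (P * aB i)
    have h3 : P * (bB i - aB i) ≤ P := by nlinarith [hab i]
    have : ((⌊P * bB i⌋ - ⌈P * aB i⌉ : ℤ) : ℝ) ≤ ((M : ℤ) : ℝ) := by push_cast; nlinarith
    exact_mod_cast this)
  rw [← hS, ← hNdef, hk'] at hW
  have hSh := Nct_shrink (e := e + 1) α f (2 * (M : ℝ)) (1 / (2 * M)) (Y / (2 * M)) (by positivity)
    (by positivity) (by rw [mul_one_div_cancel (by positivity)]) (by positivity) hYM
  rw [div_mul_cancel₀ _ (by positivity), ← hCn] at hSh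
  have hNs := hN f hΔ Ct hCt hcoef P M θ (by linarith) hPM hθ hθ1 α hα
  rw [← hY] at hNs
  have hlog : 2 + Real.log (2 * M) ≤ Cl * P ^ ε' := by
    have h1 : Real.log (2 * M) ≤ Real.log (4 * P) := Real.log_le_log (by positivity) (by linarith)
    have h2 : Real.log (4 * P) ≤ (4 * P) ^ ε' / ε' := Real.log_le_rpow_div (by positivity) hε'0
    rw [Real.mul_rpow (by norm_num) hP0.le] at h2
    have h3 : 1 ≤ P ^ ε' := Real.one_le_rpow (by linarith) hε'0.le
    calc 2 + Real.log (2 * M) ≤ 2 * P ^ ε' + 4 ^ ε' * P ^ ε' / ε' := by linarith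
      _ = Cl * P ^ ε' := by rw [hCl]; ring
  have hlog0 : 0 ≤ 2 + Real.log (2 * M) := by
    have : 0 ≤ Real.log (2 * M) := Real.log_nonneg (by
      have : (1 : ℝ) ≤ M := by exact_mod_cast hM1
      linarith)
    linarith
  have hτ : 1 / (Y / (2 * M)) ≤ 4 * P / Y := by
    rw [one_div_div]
    exact div_le_div_of_nonneg_right (by linarith) hY0.le
  have hbig : ‖Sexp f aB bB P α‖ ^ N ≤ ((6 * P) ^ n) ^ k * ((8 * P * (Cl * P ^ ε')) ^ n *
      ((Cn * (4 * P / Y) ^ n) ^ (e + 1) * (C1 * Y ^ (e * n + Δ)))) := by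
    refine hW.trans ?_
    have h4 : 0 ≤ 4 * P / Y := div_nonneg (by linarith) hY0.le
    have h5 : 0 ≤ 1 / (Y / (2 * (M : ℝ))) := one_div_nonneg.2 (div_nonneg hY0.le (by linarith))
    have h6 : 0 ≤ 4 * (M : ℝ) * (2 + Real.log (2 * M)) := mul_nonneg (by linarith) hlog0
    have b1 : ((bx n (M : ℝ)).card : ℝ) ≤ (6 * P) ^ n :=
      (card_bx_le n M hM1).trans (pow_le_pow_left₀ (by positivity) (by linarith) n)
    have b2 : 4 * M * (2 + Real.log (2 * M)) ≤ 8 * P * (Cl * P ^ ε') :=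
      mul_le_mul (by linarith) hlog hlog0 (by positivity)
    have b3 : ((Nct α f (fun _ : Fin (e + 1) => 2 * (M : ℝ)) (1 / (2 * M))).card : ℝ) ≤
        (Cn * (4 * P / Y) ^ n) ^ (e + 1) * (C1 * Y ^ (e * n + Δ)) := by
      refine hSh.trans (mul_le_mul ?_ hNs (Nat.cast_nonneg _) (pow_nonneg
        (mul_nonneg hCn0.le (pow_nonneg h4 _)) _))
      exact pow_le_pow_left₀ (mul_nonneg hCn0.le (pow_nonneg h5 _))
        (mul_le_mul_of_nonneg_left (pow_le_pow_left₀ h5 hτ _) hCn0.le) _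
    exact mul_le_mul (pow_le_pow_left₀ (Nat.cast_nonneg _) b1 _)
      (mul_le_mul (pow_le_pow_left₀ h6 b2 _) b3 (Nat.cast_nonneg _) (pow_nonneg (h6.trans b2) _))
      (mul_nonneg (pow_nonneg h6 _) (Nat.cast_nonneg _)) (pow_nonneg (pow_nonneg (by linarith) _) _)
  have hcalc : ((6 * P) ^ n) ^ k * ((8 * P * (Cl * P ^ ε')) ^ n *
      ((Cn * (4 * P / Y) ^ n) ^ (e + 1) * (C1 * Y ^ (e * n + Δ)))) =
      K0 * (P ^ (n * N) * (P ^ ε') ^ n * ((P ^ θ) ^ Δ / (P ^ θ) ^ n)) := by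
    rw [hk, hK0]
    have hYq : (1 / Y ^ n) ^ (e + 1) * Y ^ (e * n + Δ) =
        (ρ ^ Δ / ρ ^ n) * ((P ^ θ) ^ Δ / (P ^ θ) ^ n) := by
      rw [div_mul_div_comm, ← mul_pow, ← mul_pow, ← hY, one_div, inv_pow, pow_succ, ← pow_mul,
        mul_comm n e, pow_add]
      field_simp
    calc _ = 6 ^ (n * k) * (8 * Cl) ^ n * (Cn * 4 ^ n) ^ (e + 1) * C1 *
          (P ^ (n * (k + (e + 2))) * (P ^ ε') ^ n) * ((1 / Y ^ n) ^ (e + 1) * Y ^ (e * n + Δ)) := by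
          rw [div_pow, div_eq_mul_one_div ((4 * P) ^ n)]
          simp only [mul_pow, ← pow_mul]
          ring
      _ = _ := by rw [hYq]; ring
  have hexp : P ^ (n * N) * (P ^ ε') ^ n * ((P ^ θ) ^ Δ / (P ^ θ) ^ n) =
      (P ^ ((n : ℝ) - ((n : ℝ) - Δ) / N * θ + ε)) ^ N := by
    rw [← Real.rpow_mul_natCast hP0.le, ← Real.rpow_mul_natCast hP0.le,
      ← Real.rpow_mul_natCast hP0.le, ← Real.rpow_mul_natCast hP0.le,
      ← Real.rpow_natCast P (n * N), ← Real.rpow_sub hP0, ← Real.rpow_add hP0, ← Real.rpow_add hP0]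
    congr 1
    rw [hε']
    push_cast
    field_simp
    ring
  have hNc : (2 : ℝ) ^ (e + 1) = (N : ℝ) := by rw [hNdef]; push_cast; rfl
  rw [hNc]
  rw [hcalc, hexp] at hbig
  refine le_of_pow_le_pow_left₀ (by omega : N ≠ 0) (by positivity) (hbig.trans ?_)
  rw [mul_pow]
  refine mul_le_mul_of_nonneg_right ?_ (by positivity)
  calc K0 ≤ 1 + K0 := by linarith
    _ = (1 + K0) ^ 1 := (pow_one _).symm
    _ ≤ (1 + K0) ^ N := pow_le_pow_right₀ (by linarith) (by omega)


lemma meas_line (q : ℕ) (hq : 1 ≤ q) (w : ℝ) (hw : 0 < w) :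
    volume {x : ℝ | (0 ≤ x ∧ x ≤ 1) ∧ ∃ a : ℤ, |q * x - a| ≤ w / 2} ≤ ENNReal.ofReal (2 * w) := by
  have hq0 : (0 : ℝ) < q := by exact_mod_cast hq
  rcases le_or_gt 1 w with h | h
  · calc _ ≤ volume (Set.Icc (0 : ℝ) 1) := measure_mono fun x hx => hx.1
      _ = ENNReal.ofReal (1 - 0) := Real.volume_Icc
      _ ≤ _ := ENNReal.ofReal_le_ofReal (by linarith)
  · have hsub : {x : ℝ | (0 ≤ x ∧ x ≤ 1) ∧ ∃ a : ℤ, |q * x - a| ≤ w / 2} ⊆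
        ⋃ a ∈ Finset.range (q + 1), Set.Icc (((a : ℕ) : ℝ) / q - w / (2 * q)) (a / q + w / (2 * q)) := by
      rintro x ⟨⟨h0, h1⟩, a, ha⟩
      rw [abs_le] at ha
      have e1 : (-1 : ℝ) < a := by nlinarith
      have e2 : (a : ℝ) < q + 1 := by nlinarith
      have e1' : -1 < a := by exact_mod_cast e1
      have e2' : a < q + 1 := by exact_mod_cast e2
      obtain ⟨b, rfl⟩ := Int.eq_ofNat_of_zero_le (by omega : 0 ≤ a)
      simp only [Set.mem_iUnion, Finset.mem_range]
      refine ⟨b, by omega, ?_⟩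
      push_cast at ha
      have e3 : ((b : ℕ) : ℝ) / q - w / (2 * q) = (b - w / 2) / q := by field_simp
      have e4 : ((b : ℕ) : ℝ) / q + w / (2 * q) = (b + w / 2) / q := by field_simp
      rw [e3, e4]
      constructor
      · rw [div_le_iff₀ hq0]; linarith
      · rw [le_div_iff₀ hq0]; linarith
    refine (measure_mono hsub).trans ((measure_biUnion_finset_le _ _).trans ?_)
    simp only [Real.volume_Icc]
    have e5 : ∀ a : ℕ, ((a : ℕ) : ℝ) / q + w / (2 * q) - (a / q - w / (2 * q)) = w / q := by
      intro a; field_simp; ring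
    simp only [e5, Finset.sum_const, Finset.card_range]
    rw [← ENNReal.ofReal_nsmul]
    refine ENNReal.ofReal_le_ofReal ?_
    rw [nsmul_eq_mul, mul_div_assoc', div_le_iff₀ hq0]
    push_cast
    have : (1 : ℝ) ≤ q := by exact_mod_cast hq
    nlinarith

lemma meas_apx (R : ℕ) (Q w : ℝ) (hQ : 0 ≤ Q) (hw : 0 < w) :
    volume {α : Fin R → ℝ | (∀ i, 0 ≤ α i ∧ α i ≤ 1) ∧ Apx Q w α} ≤
      ENNReal.ofReal (Q * (2 * w) ^ R) := by
  have hsub : {α : Fin R → ℝ | (∀ i, 0 ≤ α i ∧ α i ≤ 1) ∧ Apx Q w α} ⊆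
      ⋃ q ∈ Finset.Icc 1 ⌊Q⌋₊, Set.univ.pi fun _ : Fin R =>
        {x : ℝ | (0 ≤ x ∧ x ≤ 1) ∧ ∃ a : ℤ, |(q : ℕ) * x - a| ≤ w / 2} := by
    rintro α ⟨h1, q, hq, hqQ, a, ha⟩
    simp only [Set.mem_iUnion, Finset.mem_Icc]
    exact ⟨q, ⟨hq, Nat.le_floor hqQ⟩, fun i _ => ⟨h1 i, a i, ha i⟩⟩
  refine (measure_mono hsub).trans ((measure_biUnion_finset_le _ _).trans ?_)
  calc _ ≤ ∑ q ∈ Finset.Icc 1 ⌊Q⌋₊, ENNReal.ofReal ((2 * w) ^ R) := by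
        refine Finset.sum_le_sum fun q hq => ?_
        rw [volume_pi_pi, ENNReal.ofReal_pow (by positivity)]
        refine (Finset.prod_le_prod' fun i _ => meas_line q (Finset.mem_Icc.1 hq).1 w hw).trans ?_
        simp
    _ ≤ _ := by
        rw [Finset.sum_const, Nat.card_Icc, ← ENNReal.ofReal_nsmul, nsmul_eq_mul]
        refine ENNReal.ofReal_le_ofReal (mul_le_mul_of_nonneg_right ?_ (by positivity))
        simpa using Nat.floor_le hQ

lemma lint_le {X : Type*} [MeasurableSpace X] (μ : Measure X) (F : X → ℝ) (s : Set X) (B m : ℝ)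
    (hB : 0 ≤ B) (h : ∀ x ∈ s, F x ≤ B) (hm : μ s ≤ ENNReal.ofReal m) :
    ∫⁻ x in s, ENNReal.ofReal (F x) ∂μ ≤ ENNReal.ofReal (B * m) := by
  calc _ ≤ ∫⁻ x in s, ENNReal.ofReal B ∂μ :=
        setLIntegral_mono measurable_const fun x hx => ENNReal.ofReal_le_ofReal (h x hx)
    _ = ENNReal.ofReal B * μ s := by simp
    _ ≤ ENNReal.ofReal B * ENNReal.ofReal m := by gcongr
    _ = _ := (ENNReal.ofReal_mul hB).symm

lemma lint_chain {X : Type*} [MeasurableSpace X] (μ : Measure X) (G : X → ENNReal)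
    (s E : ℕ → Set X) (h : ∀ k, s k ⊆ s (k + 1) ∪ (s k ∩ E (k + 1))) (k : ℕ) :
    ∫⁻ x in s 0, G x ∂μ ≤ ∫⁻ x in s k, G x ∂μ +
      ∑ i ∈ Finset.range k, ∫⁻ x in s i ∩ E (i + 1), G x ∂μ := by
  induction k with
  | zero => simp
  | succ k ih =>
    refine ih.trans ?_
    rw [Finset.sum_range_succ]
    have := (lintegral_mono_set (μ := μ) (f := G) (h k)).trans (lintegral_union_le G _ _)
    calc _ ≤ (∫⁻ x in s (k + 1), G x ∂μ + ∫⁻ x in s k ∩ E (k + 1), G x ∂μ) +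
          ∑ i ∈ Finset.range k, ∫⁻ x in s i ∩ E (i + 1), G x ∂μ := by gcongr
      _ = _ := by ring

lemma minor_fixed (n e Δ r : ℕ) (hn : 0 < n) (θ₀ δ : ℝ) (hθ₀ : 0 < θ₀)
    (hθT : ((r : ℝ) + 1) * (e + 1) * θ₀ < 1) (K : ℝ) (hK : K = ((n : ℝ) - Δ) / 2 ^ (e + 1))
    (hKB : δ < (K - ((r : ℝ) + 1) * (r + 2) * (e + 1)) * θ₀) (hδ : 0 < δ) :
    ∃ c : ℝ, 0 < c ∧
    ∀ (f : Fin (r + 1) → MvPolynomial (Fin n) ℤ), (∀ i, (f i).totalDegree ≤ e + 2) →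
    birchDelta n (r + 1) (fun i => homogeneousComponent (e + 2) (f i)) ≤
      ((Δ : ℕ∞) : WithBot ℕ∞) →
    ∀ (aB bB : Fin n → ℝ), (∀ j, bB j - aB j < 1) →
    ∀ Ct : ℝ, 1 ≤ Ct → (∀ i (m : Fin n →₀ ℕ), m.degree = e + 2 →
      |((coeff m (f i) : ℤ) : ℝ)| ≤ Ct) →
    ∀ P : ℝ, 2 ≤ P →
    ∫⁻ α in minorArcs (r + 1) (e + 2) Ct P θ₀, ENNReal.ofReal ‖Sexp f aB bB P α‖ ≤
      ENNReal.ofReal (c * Ct ^ ((r + 1) ^ 2) * P ^ ((n : ℝ) - (r + 1) * (e + 2) - δ)) := by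
  obtain ⟨B, hB⟩ : ∃ B : ℝ, B = ((r : ℝ) + 1) * (r + 2) * (e + 1) := ⟨_, rfl⟩
  have hB0 : 0 < B := by rw [hB]; positivity
  rw [← hB] at hKB
  have hKB0 : 0 < K - B := by
    by_contra h
    nlinarith
  obtain ⟨κ, hκ⟩ : ∃ κ : ℝ, κ = (K - B) * θ₀ - δ := ⟨_, rfl⟩
  have hκ0 : 0 < κ := by rw [hκ]; linarith
  obtain ⟨θT, hT⟩ : ∃ θT : ℝ, θT = ((e : ℝ) + 2) / ((r + 2) * (e + 1)) := ⟨_, rfl⟩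
  have he : (0 : ℝ) ≤ e := Nat.cast_nonneg _
  have hr : (0 : ℝ) ≤ r := Nat.cast_nonneg _
  have hT1 : θT ≤ 1 := by
    rw [hT, div_le_one (by positivity)]
    nlinarith [mul_nonneg hr he]
  have hT0 : θ₀ ≤ θT := by
    have h1 : θ₀ ≤ 1 / (((r : ℝ) + 1) * (e + 1)) := by
      rw [le_div_iff₀ (by positivity)]; linarith
    refine h1.trans ?_
    rw [hT, div_le_div_iff₀ (by positivity) (by positivity)]
    have : 0 ≤ (e : ℝ) + 1 := by positivity
    have h2 : (r : ℝ) + 2 ≤ (e + 2) * (r + 1) := by nlinarith [mul_nonneg hr he]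
    nlinarith
  have hBT : B * θT = (r + 1) * (e + 2) := by
    rw [hB, hT]; field_simp
  obtain ⟨k, hk⟩ := exists_nat_gt (2 * B * (θT - θ₀) / κ)
  have hk0 : (0 : ℝ) < k := lt_of_le_of_lt (div_nonneg (mul_nonneg (by positivity) (by linarith)) hκ0.le) hk
  obtain ⟨s, hs⟩ : ∃ s : ℝ, s = (θT - θ₀) / k := ⟨_, rfl⟩
  have hs0 : 0 ≤ s := by rw [hs]; exact div_nonneg (by linarith) hk0.le
  have hks : k * s = θT - θ₀ := by rw [hs]; field_simp
  have hBs : B * s ≤ κ / 2 := by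
    rw [div_lt_iff₀ hκ0] at hk
    rw [hs, mul_div_assoc', div_le_iff₀ hk0]
    nlinarith
  obtain ⟨C2, hC2, hW⟩ := weyl_main n e Δ r hn (κ / 2) (by linarith)
  rw [← hK] at hW
  refine ⟨C2 * (1 + k * 2 ^ (r + 1)), by positivity, ?_⟩
  intro f hf hΔ aB bB hab Ct hCt hcoef P hP
  have hP0 : 0 < P := by linarith
  have hC0 : 0 < Ct := by linarith
  obtain ⟨X, hX⟩ : ∃ X : ℝ, X = Ct ^ ((r + 1) ^ 2) * P ^ ((n : ℝ) - (r + 1) * (e + 2) - δ) :=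
    ⟨_, rfl⟩
  have hX0 : 0 < X := by rw [hX]; positivity
  let th : ℕ → ℝ := fun i => θ₀ + i * s
  let Q : ℝ → ℝ := fun θ => Ct ^ (r + 1) * P ^ (((r + 1 : ℕ) : ℝ) * (((e + 2 : ℕ) : ℝ) - 1) * θ)
  let w : ℝ → ℝ := fun θ => Ct ^ (r + 1 - 1) *
    P ^ (-((e + 2 : ℕ) : ℝ) + ((r + 1 : ℕ) : ℝ) * (((e + 2 : ℕ) : ℝ) - 1) * θ)
  let E : ℕ → Set (Fin (r + 1) → ℝ) := fun i =>
    {α | (∀ i, 0 ≤ α i ∧ α i ≤ 1) ∧ Apx (Q (th i)) (w (th i)) α}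
  have hchain := lint_chain volume (fun α => ENNReal.ofReal ‖Sexp f aB bB P α‖)
    (fun i => minorArcs (r + 1) (e + 2) Ct P (th i)) E (by
      intro i α hα
      have h1 := ((minor_iff hC0.le hP0.le).1 hα).1
      by_cases h : Apx (Q (th (i + 1))) (w (th (i + 1))) α
      · exact Or.inr ⟨hα, h1, h⟩
      · exact Or.inl ((minor_iff hC0.le hP0.le).2 ⟨h1, h⟩)) k
  have hth0 : th 0 = θ₀ := by simp [th]
  have hthk : th k = θT := by simp only [th]; linarith
  have hthpos : ∀ i, θ₀ ≤ th i := fun i => by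
    have : 0 ≤ (i : ℝ) * s := by positivity
    simp only [th]; linarith
  have hthle : ∀ i, i ≤ k → th i ≤ 1 := fun i hi => by
    have h1 : (i : ℝ) ≤ k := by exact_mod_cast hi
    have h2 : (i : ℝ) * s ≤ k * s := by gcongr
    simp only [th]; linarith
  have hsup : ∀ i, i ≤ k → ∀ α ∈ minorArcs (r + 1) (e + 2) Ct P (th i),
      ‖Sexp f aB bB P α‖ ≤ C2 * P ^ ((n : ℝ) - K * th i + κ / 2) := fun i hi =>
    hW f hf hΔ aB bB hab Ct hCt hcoef P (th i) hP (lt_of_lt_of_le hθ₀ (hthpos i)) (hthle i hi)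
  have hlast : ∫⁻ α in minorArcs (r + 1) (e + 2) Ct P (th k), ENNReal.ofReal ‖Sexp f aB bB P α‖ ≤
      ENNReal.ofReal (C2 * X) := by
    refine (lint_le volume _ _ (C2 * P ^ ((n : ℝ) - K * th k + κ / 2)) 1 (by positivity)
      (hsup k le_rfl) ?_).trans (ENNReal.ofReal_le_ofReal ?_)
    · calc _ ≤ volume (Set.univ.pi fun _ : Fin (r + 1) => Set.Icc (0 : ℝ) 1) :=
            measure_mono fun α hα i _ => hα.1 i
        _ ≤ _ := by rw [volume_pi_pi]; simp
    · rw [mul_one]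
      refine mul_le_mul_of_nonneg_left ?_ hC2.le
      rw [hX, ← one_mul (P ^ ((n : ℝ) - K * th k + κ / 2))]
      refine mul_le_mul (one_le_pow₀ hCt) ?_ (by positivity) (by positivity)
      refine Real.rpow_le_rpow_of_exponent_le (by linarith) ?_
      rw [hthk]
      have : (K - B) * θ₀ ≤ (K - B) * θT := by gcongr
      nlinarith
  have hmid : ∀ i ∈ Finset.range k, ∫⁻ α in minorArcs (r + 1) (e + 2) Ct P (th i) ∩ E (i + 1),
      ENNReal.ofReal ‖Sexp f aB bB P α‖ ≤ ENNReal.ofReal (C2 * 2 ^ (r + 1) * X) := by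
    intro i hi
    have hi' := Finset.mem_range.1 hi
    refine (lint_le volume _ _ (C2 * P ^ ((n : ℝ) - K * th i + κ / 2))
      (Q (th (i + 1)) * (2 * w (th (i + 1))) ^ (r + 1)) (by positivity)
      (fun α hα => hsup i hi'.le α hα.1) ((measure_mono Set.inter_subset_right).trans
      (meas_apx _ _ _ (by positivity) (by positivity)))).trans (ENNReal.ofReal_le_ofReal ?_)
    obtain ⟨t, ht⟩ : ∃ t, t = th (i + 1) := ⟨_, rfl⟩
    have htt : t = th i + s := by rw [ht]; simp only [th]; push_cast; ring
    have hQw : Q t * (2 * w t) ^ (r + 1) = 2 ^ (r + 1) * Ct ^ ((r + 1) ^ 2) *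
        P ^ (-((r : ℝ) + 1) * (e + 2) + B * t) := by
      simp only [Q, w]
      rw [mul_pow, mul_pow, ← Real.rpow_mul_natCast hP0.le, ← pow_mul]
      have e1 : (r + 1) ^ 2 = (r + 1) + (r + 1 - 1) * (r + 1) := by simp; ring
      have e2 : -((r : ℝ) + 1) * (e + 2) + B * t =
        ((r + 1 : ℕ) : ℝ) * (((e + 2 : ℕ) : ℝ) - 1) * t + (-((e + 2 : ℕ) : ℝ) +
          ((r + 1 : ℕ) : ℝ) * (((e + 2 : ℕ) : ℝ) - 1) * t) * ((r + 1 : ℕ) : ℝ) := by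
        rw [hB]; push_cast; ring
      rw [e1, e2, pow_add, Real.rpow_add hP0]
      ring
    rw [← ht, hQw]
    have e3 : C2 * P ^ ((n : ℝ) - K * th i + κ / 2) * (2 ^ (r + 1) * Ct ^ ((r + 1) ^ 2) *
        P ^ (-((r : ℝ) + 1) * (e + 2) + B * t)) = C2 * 2 ^ (r + 1) * (Ct ^ ((r + 1) ^ 2) *
        P ^ (((n : ℝ) - K * th i + κ / 2) + (-((r : ℝ) + 1) * (e + 2) + B * t))) := by
      rw [Real.rpow_add hP0 ((n : ℝ) - K * th i + κ / 2) (-((r : ℝ) + 1) * (e + 2) + B * t)]; ring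
    rw [e3, hX]
    refine mul_le_mul_of_nonneg_left ?_ (by positivity)
    refine mul_le_mul_of_nonneg_left ?_ (by positivity)
    refine Real.rpow_le_rpow_of_exponent_le (by linarith) ?_
    have : (K - B) * θ₀ ≤ (K - B) * th i := mul_le_mul_of_nonneg_left (hthpos i) hKB0.le
    rw [htt]
    nlinarith
  simp only [hth0] at hchain
  refine hchain.trans ((add_le_add hlast (Finset.sum_le_sum hmid)).trans ?_)
  rw [Finset.sum_const, Finset.card_range, ← ENNReal.ofReal_nsmul,
    ← ENNReal.ofReal_add (by positivity) (by positivity), nsmul_eq_mul]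
  refine ENNReal.ofReal_le_ofReal (le_of_eq ?_)
  rw [mul_assoc (C2 * _), ← hX]
  ring


/-- **Lemma 2.5 (minor arcs estimate).** -/
theorem minor_arcs_bound (n R d : ℕ) (hR : 0 < R) (hd : 2 ≤ d) (hnR : R < n)
    (θ₀ δ : ℝ) (hθ₀ : 0 < θ₀) (hδ : 0 < δ) :
    ∃ c : ℝ, 0 < c ∧
      ∀ (f : Fin R → MvPolynomial (Fin n) ℤ),
        (∀ i, (f i).totalDegree = d) →
        ∀ (aB bB : Fin n → ℝ),
        (∀ j, -1 ≤ aB j ∧ 0 < bB j - aB j ∧ bB j - aB j < 1 ∧ bB j ≤ 1) →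
        ∀ C Ct K : ℝ, 1 ≤ C → 1 ≤ Ct →
        coeffMax f C →
        coeffMax (fun i => MvPolynomial.homogeneousComponent d (f i)) Ct →
        KofDelta n R d (fun i => MvPolynomial.homogeneousComponent d (f i)) K →
        ∀ P : ℝ, 2 ≤ P →
        (R : ℝ) * ((d : ℝ) - 1) * θ₀ + (R : ℝ) * Real.log Ct / Real.log P < 1 →
        δ / ((R : ℝ) * ((d : ℝ) - 1) * θ₀) < K / ((R : ℝ) * ((d : ℝ) - 1)) - ((R : ℝ) + 1) →
        ∀ ν : Fin R → ℤ,
          (∫ α in minorArcs R d Ct P θ₀,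
              ‖Sexp f aB bB P α * eC (-(∑ i, α i * (ν i : ℝ)))‖) ≤
            c * Ct ^ (R ^ 2) * P ^ ((n : ℝ) - (R : ℝ) * (d : ℝ) - δ) := by
  obtain ⟨r, rfl⟩ : ∃ r, R = r + 1 := ⟨R - 1, by omega⟩
  obtain ⟨e, rfl⟩ : ∃ e, d = e + 2 := ⟨d - 2, by omega⟩
  have hn : 0 < n := by omega
  have key : ∀ Δ : ℕ, ∃ c : ℝ, 0 < c ∧ (((r : ℝ) + 1) * (e + 1) * θ₀ < 1 →
      δ < (((n : ℝ) - Δ) / 2 ^ (e + 1) - ((r : ℝ) + 1) * (r + 2) * (e + 1)) * θ₀ →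
      ∀ (f : Fin (r + 1) → MvPolynomial (Fin n) ℤ), (∀ i, (f i).totalDegree ≤ e + 2) →
      birchDelta n (r + 1) (fun i => homogeneousComponent (e + 2) (f i)) ≤
        ((Δ : ℕ∞) : WithBot ℕ∞) →
      ∀ (aB bB : Fin n → ℝ), (∀ j, bB j - aB j < 1) →
      ∀ Ct : ℝ, 1 ≤ Ct → (∀ i (m : Fin n →₀ ℕ), m.degree = e + 2 →
        |((coeff m (f i) : ℤ) : ℝ)| ≤ Ct) →
      ∀ P : ℝ, 2 ≤ P →
      ∫⁻ α in minorArcs (r + 1) (e + 2) Ct P θ₀, ENNReal.ofReal ‖Sexp f aB bB P α‖ ≤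
        ENNReal.ofReal (c * Ct ^ ((r + 1) ^ 2) * P ^ ((n : ℝ) - (r + 1) * (e + 2) - δ))) := by
    intro Δ
    by_cases h1 : ((r : ℝ) + 1) * (e + 1) * θ₀ < 1
    · by_cases h2 : δ < (((n : ℝ) - Δ) / 2 ^ (e + 1) - ((r : ℝ) + 1) * (r + 2) * (e + 1)) * θ₀
      · obtain ⟨c, hc, h⟩ := minor_fixed n e Δ r hn θ₀ δ hθ₀ h1 _ rfl h2 hδ
        exact ⟨c, hc, fun _ _ => h⟩
      · exact ⟨1, one_pos, fun _ h => absurd h h2⟩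
    · exact ⟨1, one_pos, fun h => absurd h h1⟩
  choose c hc hmain using key
  refine ⟨∑ Δ ∈ Finset.range (n + 1), c Δ, Finset.sum_pos (fun Δ _ => hc Δ) ⟨0, by simp⟩, ?_⟩
  intro f hf aB bB hab C Ct K _ hCt _ hCmax hKD P hP hη hKδ ν
  obtain ⟨Δ, hΔ, hK⟩ := hKD
  have hP0 : 0 < P := by linarith
  have hlogs : 0 ≤ ((r + 1 : ℕ) : ℝ) * Real.log Ct / Real.log P :=
    div_nonneg (mul_nonneg (Nat.cast_nonneg _) (Real.log_nonneg hCt)) (Real.log_nonneg (by linarith))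
  have hηs : ((r : ℝ) + 1) * (e + 1) * θ₀ < 1 := by
    have e1 : ((r + 1 : ℕ) : ℝ) * (((e + 2 : ℕ) : ℝ) - 1) * θ₀ = ((r : ℝ) + 1) * (e + 1) * θ₀ := by
      push_cast; ring
    linarith
  have hK' : K = ((n : ℝ) - Δ) / 2 ^ (e + 1) := hK
  have hRd : (0 : ℝ) < ((r : ℝ) + 1) * (e + 1) := by positivity
  have hKB : δ < (K - ((r : ℝ) + 1) * (r + 2) * (e + 1)) * θ₀ := by
    have e1 : ((r + 1 : ℕ) : ℝ) * (((e + 2 : ℕ) : ℝ) - 1) = ((r : ℝ) + 1) * (e + 1) := by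
      push_cast; ring
    rw [e1, div_lt_iff₀ (by positivity)] at hKδ
    have e2 : (K / (((r : ℝ) + 1) * (e + 1)) - (((r + 1 : ℕ) : ℝ) + 1)) *
        (((r : ℝ) + 1) * (e + 1) * θ₀) = (K - ((r : ℝ) + 1) * (r + 2) * (e + 1)) * θ₀ := by
      push_cast; field_simp; ring
    linarith
  have hΔn : Δ < n + 1 := by
    by_contra h
    have h1 : (n : ℝ) ≤ Δ := by exact_mod_cast (by omega : n ≤ Δ)
    have h2 : K ≤ 0 := by
      rw [hK']; exact div_nonpos_of_nonpos_of_nonneg (by linarith) (by positivity)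
    have h3 : (0 : ℝ) < ((r : ℝ) + 1) * (r + 2) * (e + 1) := by positivity
    nlinarith
  have hcoef : ∀ i (m : Fin n →₀ ℕ), m.degree = e + 2 → |((coeff m (f i) : ℤ) : ℝ)| ≤ Ct := by
    intro i m hm
    refine hCmax.2 ⟨i, m, ?_⟩
    simp [coeff_homogeneousComponent, hm]
  have hfin := hmain Δ hηs (by rw [← hK']; exact hKB) f (fun i => (hf i).le) hΔ.symm.le aB bB
    (fun j => (hab j).2.2.1) Ct hCt hcoef P hP
  have hcle : c Δ ≤ ∑ Δ ∈ Finset.range (n + 1), c Δ :=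
    Finset.single_le_sum (f := c) (fun i _ => (hc i).le) (Finset.mem_range.2 hΔn)
  have hexp : (n : ℝ) - ((r + 1 : ℕ) : ℝ) * ((e + 2 : ℕ) : ℝ) - δ =
      (n : ℝ) - (r + 1) * (e + 2) - δ := by push_cast; ring
  rw [hexp]
  calc (∫ α in minorArcs (r + 1) (e + 2) Ct P θ₀,
          ‖Sexp f aB bB P α * eC (-(∑ i, α i * (ν i : ℝ)))‖)
      = ∫ α in minorArcs (r + 1) (e + 2) Ct P θ₀, ‖Sexp f aB bB P α‖ := by
        simp only [norm_mul, norm_eC, mul_one]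
    _ ≤ ‖∫ α in minorArcs (r + 1) (e + 2) Ct P θ₀, ‖Sexp f aB bB P α‖‖ := Real.le_norm_self _
    _ ≤ ENNReal.toReal (∫⁻ α in minorArcs (r + 1) (e + 2) Ct P θ₀,
          ENNReal.ofReal ‖‖Sexp f aB bB P α‖‖) := norm_integral_le_lintegral_norm _
    _ ≤ c Δ * Ct ^ ((r + 1) ^ 2) * P ^ ((n : ℝ) - (r + 1) * (e + 2) - δ) := by
        refine ENNReal.toReal_le_of_le_ofReal ?_ ?_
        · have := hc Δ
          positivity
        · simpa only [norm_norm] using hfin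
    _ ≤ _ := by gcongr

end
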